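/- Let T be an LFC tiling of ℝ^d whose face poset is in class 2_I for some I ⊆ {0, …, d}, and let j ∈ {0, …, d} with j ∉ I. Then j = 0 or j = d. -/

import Mathlib

/-! Generic definitions about flags, flag orbits, and abstract polytopes. -/

variable {α : Type*} [PartialOrder α]

/-- Two flags (maximal chains) are in the same orbit of the automorphism group
(the group of order automorphisms) if some order automorphism maps one onto the other. -/
def SameFlagOrbit (Φ Ψ : Flag α) : Prop :=
  ∃ γ : α ≃o α, γ '' (Φ : Set α) = (Ψ : Set α)

/-- The automorphism group has exactly two orbits on the flags. -/
def TwoFlagOrbits (α : Type*) [PartialOrder α] : Prop :=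
  ∃ Φ Ψ : Flag α, ¬ SameFlagOrbit Φ Ψ ∧
    ∀ Ω : Flag α, SameFlagOrbit Ω Φ ∨ SameFlagOrbit Ω Ψ

/-- `Ψ` is the flag `Φ^i`: it differs from `Φ` in exactly the rank-`i` element
(with respect to the rank function `rk`). -/
def IsIAdjacent (rk : α → ℤ) (i : ℤ) (Φ Ψ : Flag α) : Prop :=
  Φ ≠ Ψ ∧ ∀ x : α, rk x ≠ i → (x ∈ Φ ↔ x ∈ Ψ)

/-- A two-orbit polytope (with rank function `rk`, adjacency indices `0, …, n-1`)
is in class `2_I` if, for every flag `Φ` and every `i < n`, the `i`-adjacent flag `Φ^i`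
lies in the same orbit as `Φ` exactly when `i ∈ I`. -/
def InClass (rk : α → ℤ) (n : ℕ) (I : Set ℕ) : Prop :=
  TwoFlagOrbits α ∧
    ∀ (Φ Ψ : Flag α) (i : ℕ), i < n → IsIAdjacent rk i Φ Ψ →
      (SameFlagOrbit Φ Ψ ↔ i ∈ I)

/-- An abstract polytope of rank `d`: a bounded poset, graded by a rank function `rk`
taking values `-1, 0, …, d`, in which every flag (maximal chain) has exactly one element
of each rank, satisfying the diamond condition and strong flag-connectivity. -/
structure IsAbstractPolytope (α : Type*) [PartialOrder α] [BoundedOrder α]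
    (rk : α → ℤ) (d : ℕ) : Prop where
  rk_bot : rk ⊥ = -1
  rk_top : rk ⊤ = d
  rk_strictMono : StrictMono rk
  rk_cover : ∀ x y : α, x ⋖ y → rk y = rk x + 1
  flag_ranks : ∀ (Φ : Flag α) (i : ℤ), -1 ≤ i → i ≤ d → ∃! x, x ∈ Φ ∧ rk x = i
  diamond : ∀ x y : α, x < y → rk y = rk x + 2 →
    ∃ a b : α, a ≠ b ∧ ∀ z : α, (x < z ∧ z < y) ↔ (z = a ∨ z = b)
  connected : ∀ Φ Ψ : Flag α, ∃ (n : ℕ) (c : Fin (n + 1) → Flag α),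
    c 0 = Φ ∧ c (Fin.last n) = Ψ ∧
    (∀ k : Fin n, ∃ i : ℤ, IsIAdjacent rk i (c k.castSucc) (c k.succ)) ∧
    (∀ k, (Φ : Set α) ∩ (Ψ : Set α) ⊆ (c k : Set α))
/-! Definitions about convex polytopes and their face lattices. -/

/-- Euclidean `d`-space. -/
abbrev EucSp (d : ℕ) : Type := EuclideanSpace ℝ (Fin d)

/-- A convex `d`-polytope: the convex hull of a finite set of points of `ℝ^d`,
with nonempty interior. -/
def IsConvexPolytope {d : ℕ} (P : Set (EucSp d)) : Prop :=
  (∃ S : Finset (EucSp d), P = convexHull ℝ (S : Set (EucSp d))) ∧ (interior P).Nonempty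

/-- The face lattice of `P`: the exposed faces of `P` (intersections of `P` with supporting
hyperplanes, together with `∅` and `P` itself), ordered by inclusion. -/
def Faces {d : ℕ} (P : Set (EucSp d)) : Type := {F : Set (EucSp d) // IsExposed ℝ P F}

noncomputable instance {d : ℕ} (P : Set (EucSp d)) : PartialOrder (Faces P) :=
  Subtype.partialOrder _

open scoped Classical

/-- The rank of a face: `-1` for the empty face, and otherwise its affine dimension. -/
noncomputable def faceRank {d : ℕ} {P : Set (EucSp d)} (F : Faces P) : ℤ :=
  if F.1 = ∅ then -1
  else (Module.finrank ℝ (affineSpan ℝ F.1).direction : ℤ)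
/-! Definitions about locally finite face-to-face tilings of Euclidean space by convex
polytopes (LFC tilings) and their face posets. -/

/-- An LFC tiling of `ℝ^d`: a face-to-face, locally finite tiling of `ℝ^d` by convex
`d`-polytopes. -/
structure IsLFCTiling {d : ℕ} (T : Set (Set (EucSp d))) : Prop where
  /-- Every tile is a convex `d`-polytope. -/
  polytope : ∀ t ∈ T, IsConvexPolytope t
  /-- The tiles cover all of `ℝ^d`. -/
  covers : ⋃₀ T = Set.univ
  /-- The tiling is face-to-face: the intersection of any two tiles is a
  (possibly empty) face of each. -/
  face_to_face : ∀ t ∈ T, ∀ s ∈ T, IsExposed ℝ t (t ∩ s) ∧ IsExposed ℝ s (t ∩ s)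
  /-- The tiling is locally finite: every bounded set meets only finitely many tiles. -/
  locally_finite : ∀ B : Set (EucSp d), Bornology.IsBounded B →
    {t ∈ T | (t ∩ B).Nonempty}.Finite

/-- The faces of the tiling `T`: all faces of all tiles (the empty face included). -/
def TFace {d : ℕ} (T : Set (Set (EucSp d))) : Type :=
  {F : Set (EucSp d) // ∃ t ∈ T, IsExposed ℝ t F}

noncomputable instance {d : ℕ} (T : Set (Set (EucSp d))) : PartialOrder (TFace T) :=
  Subtype.partialOrder _

/-- The face poset of the tiling `T`: all faces of all tiles, together with a greatest
element, ordered by inclusion.  It is an abstract polytope of rank `d + 1`. -/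
abbrev TPoset {d : ℕ} (T : Set (Set (EucSp d))) : Type := WithTop (TFace T)

/-- The rank of a subset of `ℝ^d` regarded as a face: `-1` for the empty face, and
otherwise its affine dimension. -/
noncomputable def setRank {d : ℕ} (F : Set (EucSp d)) : ℤ :=
  if F = ∅ then -1 else (Module.finrank ℝ (affineSpan ℝ F).direction : ℤ)

/-- The rank function of the face poset of a tiling of `ℝ^d`: faces get their affine
dimension (`-1` for the empty face), and the greatest element gets rank `d + 1`. -/
noncomputable def tileRank {d : ℕ} (T : Set (Set (EucSp d))) : TPoset T → ℤ :=
  WithTop.recTopCoe ((d : ℤ) + 1) (fun F => setRank F.1)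

/-- A tiling is normal if its tiles are uniformly bounded: for some `u, U > 0`, every tile
contains a ball of radius `u` and is contained in a ball of radius `U`. -/
def IsNormalTiling {d : ℕ} (T : Set (Set (EucSp d))) : Prop :=
  ∃ u U : ℝ, 0 < u ∧ 0 < U ∧ ∀ t ∈ T,
    (∃ x, Metric.closedBall x u ⊆ t) ∧ (∃ x, t ⊆ Metric.closedBall x U)
namespace TVF
open Topology Filter

/-- A function on flags is compatible on a set `S` of flags. -/
def Compat {Fl Y : Type} (Rel : Fl → Fl → Y → Y → Prop) (S : Set Fl) (g : Fl → Y) : Prop :=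
  ∀ Φ ∈ S, ∀ Φ' ∈ S, Rel Φ Φ' (g Φ) (g Φ')

theorem Compat.mono {Fl Y : Type} {Rel : Fl → Fl → Y → Y → Prop} {S S' : Set Fl} {g : Fl → Y}
    (h : Compat Rel S g) (hS : S' ⊆ S) : Compat Rel S' g :=
  fun Φ hΦ Φ' hΦ' => h Φ (hS hΦ) Φ' (hS hΦ')

theorem machine_local {X Fl Y : Type} [TopologicalSpace X] [SimplyConnectedSpace X]
    [LocallyPathConnectedSpace X]
    (Rel : Fl → Fl → Y → Y → Prop) (S : X → Set Fl)
    (hne : ∀ x, (S x).Nonempty) (hs : ∀ x, ∀ᶠ y in 𝓝 x, S y ⊆ S x)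
    (hex : ∀ x, ∀ Φ ∈ S x, ∀ v : Y, ∃ g : Fl → Y, g Φ = v ∧ Compat Rel (S x) g)
    (huq : ∀ x, ∀ g g' : Fl → Y, Compat Rel (S x) g → Compat Rel (S x) g' →
      ∀ Φ ∈ S x, g Φ = g' Φ → ∀ Φ' ∈ S x, g Φ' = g' Φ')
    (x0 : X) (Φ0 : Fl) (hΦ0 : Φ0 ∈ S x0) (v0 : Y) :
    ∃ s : X → Fl → Y, (∀ x, Compat Rel (S x) (s x)) ∧ s x0 Φ0 = v0 ∧
      ∀ x, ∀ᶠ y in 𝓝 x, ∀ Φ ∈ S y, s y Φ = s x Φ := by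
  choose fl hfl using hne
  -- `ext x Φ v` the compatible function at `x` with value `v` at `Φ`
  have hex' : ∀ x Φ (v : Y), ∃ g : Fl → Y, Φ ∈ S x → (g Φ = v ∧ Compat Rel (S x) g) := by
    intro x Φ v
    by_cases h : Φ ∈ S x
    · obtain ⟨g, hg⟩ := hex x Φ h v
      exact ⟨g, fun _ => hg⟩
    · exact ⟨fun _ => v, fun h' => (h h').elim⟩
  choose ext hext using hex'
  have ext_self : ∀ x Φ v, Φ ∈ S x → ext x Φ v Φ = v := fun x Φ v h => (hext x Φ v h).1
  have ext_c : ∀ x Φ v, Φ ∈ S x → Compat Rel (S x) (ext x Φ v) := fun x Φ v h => (hext x Φ v h).2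
  have ext_eq : ∀ x Φ v g, Φ ∈ S x → Compat Rel (S x) g → g Φ = v →
      ∀ Φ' ∈ S x, ext x Φ v Φ' = g Φ' := by
    intro x Φ v g h hg hv Φ' h'
    exact huq x _ _ (ext_c x Φ v h) hg Φ h (by rw [ext_self x Φ v h, hv]) Φ' h'
  let N : X → Set X := fun x => interior {y | S y ⊆ S x}
  have hN : ∀ x y, y ∈ N x → S y ⊆ S x := fun x y h => interior_subset h
  have hNself : ∀ x, x ∈ N x := fun x => mem_interior_iff_mem_nhds.2 (hs x)
  have key : ∀ x y Φ v, y ∈ N x → Φ ∈ S y → ∀ g, Compat Rel (S x) g → g Φ = v →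
      ∀ Φ' ∈ S y, ext y Φ v Φ' = g Φ' := by
    intro x y Φ v hy hΦ g hg hv Φ' hΦ'
    exact ext_eq y Φ v g hΦ (hg.mono (hN x y hy)) hv Φ' hΦ'
  let cc : X → X → X → Y → Y := fun x x' y v => ext x' (fl y) (ext x (fl x) v (fl y)) (fl x')
  have cc_eq : ∀ x x' y v, y ∈ N x → y ∈ N x' → ∀ Φ ∈ S y,
      cc x x' y v = ext x' Φ (ext x (fl x) v Φ) (fl x') := by
    intro x x' y v hy hy' Φ hΦ
    have h1 := hN x y hy
    have h2 := hN x' y hy'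
    refine ext_eq x' (fl y) _ _ (h2 (hfl y)) (ext_c x' Φ _ (h2 hΦ)) ?_ _ (hfl x')
    have c1 : Compat Rel (S y) (ext x' Φ (ext x (fl x) v Φ)) := (ext_c x' Φ _ (h2 hΦ)).mono h2
    have c2 : Compat Rel (S y) (ext x (fl x) v) := (ext_c x _ _ (hfl x)).mono h1
    refine huq y _ _ c1 c2 Φ hΦ ?_ _ (hfl y)
    rw [ext_self x' Φ _ (h2 hΦ)]
  let _ : TopologicalSpace Y := ⊥
  have _ : DiscreteTopology Y := ⟨rfl⟩
  let Z : FiberBundleCore X X Y :=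
    { baseSet := N
      isOpen_baseSet := fun x => isOpen_interior
      indexAt := id
      mem_baseSet_at := hNself
      coordChange := cc
      coordChange_self := by
        intro x y hy v
        rw [cc_eq x x y v hy hy (fl y) (hfl y)]
        rw [ext_eq x (fl y) _ (ext x (fl x) v) (hN x y hy (hfl y)) (ext_c x _ _ (hfl x)) rfl _ (hfl x)]
        exact ext_self x _ _ (hfl x)
      continuousOn_coordChange := by
        intro x x'
        rintro ⟨y, v⟩ ⟨⟨hy, hy'⟩, -⟩
        refine ContinuousAt.continuousWithinAt ?_
        refine ContinuousAt.congr (f := fun _ => cc x x' y v) continuousAt_const ?_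
        have h1 : ∀ᶠ p : X × Y in 𝓝 (y, v), p.1 ∈ N x ∩ N x' ∧ S p.1 ⊆ S y := by
          have : ∀ᶠ z in 𝓝 y, z ∈ N x ∩ N x' ∧ S z ⊆ S y :=
            Filter.Eventually.and
              ((isOpen_interior.inter isOpen_interior).mem_nhds ⟨hy, hy'⟩) (hs y)
          exact (continuous_fst.tendsto (y, v)).eventually this
        have h2 : ∀ᶠ p : X × Y in 𝓝 (y, v), p.2 = v :=
          (continuous_snd.tendsto (y, v)).eventually (mem_nhds_discrete.2 rfl : {v} ∈ 𝓝 v)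
        filter_upwards [h1, h2] with p hp hv
        change cc x x' y v = cc x x' p.1 p.2
        rw [hv, cc_eq x x' p.1 v hp.1.1 hp.1.2 _ (hfl _), cc_eq x x' y v hy hy' _ (hp.2 (hfl _))]
      coordChange_comp := by
        intro x x' x'' y ⟨⟨hy, hy'⟩, hy''⟩ v
        rw [cc_eq x x' y v hy hy' _ (hfl y), cc_eq x' x'' y _ hy' hy'' _ (hfl y),
          cc_eq x x'' y _ hy hy'' _ (hfl y)]
        congr 1
        have h2 := hN x' y hy'
        rw [ext_eq x' (fl x') _ (ext x' (fl y) (ext x (fl x) v (fl y))) (hfl x')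
          (ext_c x' _ _ (h2 (hfl y))) rfl _ (h2 (hfl y)), ext_self x' _ _ (h2 (hfl y))] }
  have hcov : IsCoveringMap (Z.proj) := FiberBundle.isCoveringMap (F := Y) (E := Z.Fiber)
  obtain ⟨F, ⟨hF0, hF⟩, -⟩ := hcov.existsUnique_continuousMap_lifts (ContinuousMap.id X) x0
    (⟨x0, ext x0 Φ0 v0 (fl x0)⟩ : Z.TotalSpace) rfl
  have hF1 : ∀ x, (F x).1 = x := fun x => congrFun hF x
  let val : X → Y := fun x => (F x).2
  have hloc : ∀ x, ∀ᶠ y in 𝓝 x, cc y x y (val y) = val x := by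
    intro x
    have hcont : ContinuousAt (fun y => (Z.localTriv x (F y)).2) x := by
      have : ContinuousAt (Z.localTriv x) (F x) := by
        apply (Z.localTriv x).continuousAt
        rw [Bundle.Trivialization.mem_source]
        change (F x).1 ∈ N x
        rw [hF1]; exact hNself x
      exact continuousAt_snd.comp (this.comp F.continuous.continuousAt)
    have e1 : ∀ y, (Z.localTriv x (F y)).2 = cc (F y).1 x (F y).1 (F y).2 := fun y => rfl
    have e2 : ∀ y, (Z.localTriv x (F y)).2 = cc y x y (val y) := by
      intro y
      rw [e1, hF1]
    have hx : cc x x x (val x) = val x := Z.coordChange_self x x (hNself x) _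
    have := hcont.eventually (mem_nhds_discrete.2 rfl :
      {(Z.localTriv x (F x)).2} ∈ 𝓝 ((Z.localTriv x (F x)).2))
    filter_upwards [this] with y hy
    have hy : (Z.localTriv x (F y)).2 = (Z.localTriv x (F x)).2 := hy
    rw [e2, e2, hx] at hy
    exact hy
  refine ⟨fun x => ext x (fl x) (val x), fun x => ext_c _ _ _ (hfl x), ?_, ?_⟩
  · have : val x0 = ext x0 Φ0 v0 (fl x0) := by
      change (F x0).2 = _
      rw [hF0]
    change ext x0 (fl x0) (val x0) Φ0 = v0
    rw [this, ext_eq x0 (fl x0) _ (ext x0 Φ0 v0) (hfl _) (ext_c _ _ _ hΦ0) rfl _ hΦ0,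
      ext_self _ _ _ hΦ0]
  · intro x
    filter_upwards [hloc x, hs x, isOpen_interior.mem_nhds (hNself x)] with y hy hyS hyN Φ hΦ
    have := cc_eq y x y (val y) (hNself y) hyN Φ hΦ
    rw [hy] at this
    change ext y (fl y) (val y) Φ = ext x (fl x) (val x) Φ
    rw [ext_eq x (fl x) (val x) (ext x Φ (ext y (fl y) (val y) Φ)) (hfl x)
      (ext_c _ _ _ (hyS hΦ)) this.symm _ (hyS hΦ), ext_self _ _ _ (hyS hΦ)]

end TVF

namespace TVF
open Topology Filter

theorem affineSpan_ne_top {d : ℕ} (Q : Finset (EucSp d)) (hQ : Q.card ≤ d) :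
    affineSpan ℝ (Q : Set (EucSp d)) ≠ ⊤ := by
  intro h
  rcases Q.eq_empty_or_nonempty with rfl | hne
  · simp at h
  · obtain ⟨n, hn⟩ : ∃ n, Q.card = n + 1 := ⟨Q.card - 1, by have := hne.card_pos; omega⟩
    have h1 := finrank_vectorSpan_image_finset_le ℝ (fun x : EucSp d => x) Q hn
    rw [Finset.image_id', ← direction_affineSpan, h, AffineSubspace.direction_top, finrank_top] at h1
    simp at h1
    omega

theorem gen {d : ℕ} {ι : Type} [Countable ι] (Q : ι → Finset (EucSp d))
    (hQ : ∀ i, (Q i).card ≤ d) (W : Set (EucSp d)) (hW : IsOpen W) (hne : W.Nonempty) :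
    ∃ z ∈ W, ∀ i, z ∉ affineSpan ℝ (Q i : Set (EucSp d)) := by
  by_contra! hcon
  have h0 : MeasureTheory.volume (⋃ i, (affineSpan ℝ (Q i : Set (EucSp d)) : Set (EucSp d))) = 0 := by
    rw [MeasureTheory.measure_iUnion_null_iff]
    intro i
    exact MeasureTheory.Measure.addHaar_affineSubspace _ _ (affineSpan_ne_top _ (hQ i))
  have h1 : MeasureTheory.volume W = 0 := by
    refine MeasureTheory.measure_mono_null ?_ h0
    intro z hz
    obtain ⟨i, hi⟩ := hcon z hz
    exact Set.mem_iUnion.2 ⟨i, hi⟩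
  have hpos := hW.measure_pos MeasureTheory.volume hne
  rw [h1] at hpos
  exact absurd hpos (lt_irrefl _)

/-- Abstract data of a barycentric subdivision of Euclidean space. -/
structure BC (P : Type) [PartialOrder P] (d : ℕ) where
  rk : P → ℕ
  b : P → EucSp d
  C : EucSp d → Finset P
  rk_strictMono : StrictMono rk
  rk_le : ∀ p, rk p ≤ d
  chain : ∀ x, IsChain (· ≤ ·) (C x : Set P)
  repr : ∀ x, ∃ w : P → ℝ, (∀ p ∈ C x, 0 < w p) ∧ ∑ p ∈ C x, w p = 1 ∧
    ∑ p ∈ C x, w p • b p = x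
  uniq : ∀ (D : Finset P) (w : P → ℝ), IsChain (· ≤ ·) (D : Set P) → (∀ p ∈ D, 0 < w p) →
    ∑ p ∈ D, w p = 1 → C (∑ p ∈ D, w p • b p) = D
  star : ∀ x, ∀ᶠ y in 𝓝 x, C x ⊆ C y
  countable : Countable P
  fin_comp : ∀ p : P, {q : P | q ≤ p ∨ p ≤ q}.Finite
  nodigon : ∀ F F' G G' : P, F ≠ F' → G ≠ G' → rk F = rk F' → rk G = rk G' → rk F = rk G + 1 →
    G < F → G < F' → G' < F → G' < F' → False

variable {P : Type} [PartialOrder P] {d : ℕ} (B : BC P d)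

namespace BC

theorem rk_injOn {D : Finset P} (hD : IsChain (· ≤ ·) (D : Set P)) :
    Set.InjOn B.rk (D : Set P) := by
  intro p hp q hq h
  by_contra hne
  rcases hD hp hq hne with h' | h'
  · exact absurd h (B.rk_strictMono (lt_of_le_of_ne h' hne)).ne
  · exact absurd h (B.rk_strictMono (lt_of_le_of_ne h' (Ne.symm hne))).ne'

theorem card_le (B : BC P d) {D : Finset P} (hD : IsChain (· ≤ ·) (D : Set P)) : D.card ≤ d + 1 := by
  rw [← Finset.card_image_of_injOn (B.rk_injOn hD)]
  calc _ ≤ (Finset.range (d + 1)).card := by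
        apply Finset.card_le_card
        intro n hn
        obtain ⟨p, -, rfl⟩ := Finset.mem_image.1 hn
        exact Finset.mem_range.2 (Nat.lt_succ_of_le (B.rk_le p))
    _ = d + 1 := by simp

theorem C_nonempty (x : EucSp d) : (B.C x).Nonempty := by
  obtain ⟨w, -, h, -⟩ := B.repr x
  by_contra hne
  rw [Finset.not_nonempty_iff_eq_empty] at hne
  rw [hne] at h
  simp at h

theorem near {D : Finset P} (hD : IsChain (· ≤ ·) (D : Set P)) {x : EucSp d} (hx : B.C x ⊆ D)
    {N : Set (EucSp d)} (hN : N ∈ 𝓝 x) : ∃ y ∈ N, B.C y = D := by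
  obtain ⟨w, hw, hw1, hwx⟩ := B.repr x
  have hDne : D.Nonempty := (B.C_nonempty x).mono hx
  have hDc : (0 : ℝ) < D.card := by exact_mod_cast hDne.card_pos
  let w' : P → ℝ := fun p => if p ∈ B.C x then w p else 0
  have s1 : ∑ p ∈ D, w' p = 1 := by
    rw [← hw1, ← Finset.sum_filter]
    congr 1
    ext p; simp only [Finset.mem_filter]; exact ⟨fun h => h.2, fun h => ⟨hx h, h⟩⟩
  have s2 : ∑ p ∈ D, w' p • B.b p = x := by
    rw [← hwx]
    simp only [w', ite_smul, zero_smul]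
    rw [← Finset.sum_filter]
    congr 1
    ext p; simp only [Finset.mem_filter]; exact ⟨fun h => h.2, fun h => ⟨hx h, h⟩⟩
  let z : EucSp d := ∑ p ∈ D, ((D.card : ℝ)⁻¹) • B.b p
  have hy : ∀ ε : ℝ, ∑ p ∈ D, ((1 - ε) * w' p + ε * (D.card : ℝ)⁻¹) • B.b p
      = (1 - ε) • x + ε • z := by
    intro ε
    simp only [add_smul, Finset.sum_add_distrib, mul_smul]
    rw [← Finset.smul_sum, ← Finset.smul_sum, s2]
  have hsum : ∀ ε : ℝ, ∑ p ∈ D, ((1 - ε) * w' p + ε * (D.card : ℝ)⁻¹) = 1 := by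
    intro ε
    rw [Finset.sum_add_distrib, ← Finset.mul_sum, s1, Finset.sum_const, nsmul_eq_mul]
    field_simp; ring
  have hcont : Tendsto (fun ε : ℝ => (1 - ε) • x + ε • z) (𝓝[>] 0) (𝓝 x) := by
    have : Continuous (fun ε : ℝ => (1 - ε) • x + ε • z) := by fun_prop
    have h := this.tendsto 0
    simp only [sub_zero, one_smul, zero_smul, add_zero] at h
    exact h.mono_left nhdsWithin_le_nhds
  have h1 : ∀ᶠ ε : ℝ in 𝓝[>] 0, ε < 1 :=
    nhdsWithin_le_nhds (Iio_mem_nhds (by norm_num))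
  have h2 : ∀ᶠ ε : ℝ in 𝓝[>] 0, 0 < ε := self_mem_nhdsWithin
  obtain ⟨ε, hε, hε1, hε0⟩ := ((hcont.eventually hN).and (h1.and h2)).exists
  refine ⟨_, hε, ?_⟩
  rw [← hy ε]
  refine B.uniq D _ hD ?_ (hsum ε)
  intro p hp
  have : 0 ≤ w' p := by
    simp only [w']; split_ifs with h
    · exact (hw p h).le
    · exact le_rfl
  have h3 : 0 ≤ (1 - ε) * w' p := mul_nonneg (by linarith) this
  have h4 : 0 < ε * (D.card : ℝ)⁻¹ := by positivity
  linarith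

theorem exists_cell {D : Finset P} (hD : IsChain (· ≤ ·) (D : Set P)) (hne : D.Nonempty) :
    ∃ y, B.C y = D := by
  refine ⟨_, B.uniq D (fun _ => (D.card : ℝ)⁻¹) hD ?_ ?_⟩
  · intro p hp
    have : (0 : ℝ) < D.card := by exact_mod_cast hne.card_pos
    positivity
  · have : (0 : ℝ) < D.card := by exact_mod_cast hne.card_pos
    rw [Finset.sum_const, nsmul_eq_mul]
    field_simp

theorem mem_span (x : EucSp d) : x ∈ affineSpan ℝ (((B.C x).image B.b : Finset (EucSp d)) :
    Set (EucSp d)) := by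
  obtain ⟨w, hw, hw1, hwx⟩ := B.repr x
  have h : x ∈ convexHull ℝ (((B.C x).image B.b : Finset (EucSp d)) : Set (EucSp d)) := by
    have := (convex_convexHull ℝ (((B.C x).image B.b : Finset (EucSp d)) : Set (EucSp d))).sum_mem
      (t := B.C x) (w := w) (z := B.b) (fun p hp => (hw p hp).le) hw1 (by
        intro p hp
        exact subset_convexHull _ _ (by simpa using ⟨p, hp, rfl⟩))
    rwa [hwx] at this
  exact convexHull_subset_affineSpan _ h

theorem convex_cell (D : Finset P) : Convex ℝ {y | B.C y = D} := by
  intro x hx y hy s t hs ht hst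
  simp only [Set.mem_ofPred_eq] at hx hy ⊢
  have hch : IsChain (· ≤ ·) (D : Set P) := hx ▸ B.chain x
  obtain ⟨w, hw, hw1, hwx⟩ := B.repr x
  obtain ⟨v, hv, hv1, hvy⟩ := B.repr y
  rw [hx] at hw hw1 hwx
  rw [hy] at hv hv1 hvy
  have e : s • x + t • y = ∑ p ∈ D, (s * w p + t * v p) • B.b p := by
    simp only [add_smul, Finset.sum_add_distrib, mul_smul]
    rw [← Finset.smul_sum, ← Finset.smul_sum, hwx, hvy]
  rw [e]
  refine B.uniq D _ hch ?_ ?_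
  · intro p hp
    have h1 := hw p hp
    have h2 := hv p hp
    rcases hs.eq_or_lt with h | h
    · subst h
      have : t = 1 := by linarith
      subst this; simpa using h2
    · have h3 := mul_pos h h1
      have h4 := mul_nonneg ht h2.le
      linarith
  · rw [Finset.sum_add_distrib, ← Finset.mul_sum, ← Finset.mul_sum, hw1, hv1]; simpa using hst

theorem open_cell {D : Finset P} (hc : D.card = d + 1) : IsOpen {y | B.C y = D} := by
  rw [isOpen_iff_mem_nhds]
  intro x hx
  simp only [Set.mem_ofPred_eq] at hx
  filter_upwards [B.star x] with y hy
  rw [hx] at hy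
  refine (Finset.eq_of_subset_of_card_le hy ?_).symm
  rw [hc]
  exact B.card_le (B.chain y)

theorem card_of_maximal (B : BC P d) {D : Finset P} (hD : IsChain (· ≤ ·) (D : Set P)) (hne : D.Nonempty)
    (hmax : ∀ D' : Finset P, IsChain (· ≤ ·) (D' : Set P) → D ⊆ D' → D' = D) :
    D.card = d + 1 := by
  by_contra hcard
  have hle : D.card ≤ d := by have := B.card_le hD; omega
  obtain ⟨x, hx⟩ := B.exists_cell hD hne
  obtain ⟨W, hW, hWo, hxW⟩ := mem_nhds_iff.1 (B.star x)
  obtain ⟨z, hz, hz'⟩ := gen (fun _ : Unit => D.image B.b)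
    (fun _ => (Finset.card_image_le).trans hle) W hWo ⟨x, hxW⟩
  have h1 := hW hz
  simp only [Set.mem_ofPred_eq, hx] at h1
  have h2 := hmax _ (B.chain z) h1
  have h3 := B.mem_span z
  rw [h2] at h3
  exact hz' () h3

theorem exists_flag (B : BC P d) {D : Finset P} (hD : IsChain (· ≤ ·) (D : Set P)) (hne : D.Nonempty) :
    ∃ D' : Finset P, IsChain (· ≤ ·) (D' : Set P) ∧ D ⊆ D' ∧ D'.card = d + 1 := by
  by_contra! hcon
  have : ∀ n, ∃ D' : Finset P, IsChain (· ≤ ·) (D' : Set P) ∧ D ⊆ D' ∧ n ≤ D'.card := by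
    intro n
    induction n with
    | zero => exact ⟨D, hD, subset_rfl, Nat.zero_le _⟩
    | succ n ih =>
      obtain ⟨D', h1, h2, h3⟩ := ih
      have h4 := hcon D' h1 h2
      have h5 : ∃ D'' : Finset P, IsChain (· ≤ ·) (D'' : Set P) ∧ D' ⊆ D'' ∧ D'' ≠ D' := by
        by_contra! h
        exact h4 (B.card_of_maximal h1 (hne.mono h2) h)
      obtain ⟨D'', a, b, c⟩ := h5
      refine ⟨D'', a, h2.trans b, ?_⟩
      have := Finset.card_lt_card (Finset.ssubset_iff_subset_ne.2 ⟨b, c.symm⟩)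
      omega
  obtain ⟨D', h1, -, h2⟩ := this (d + 2)
  have := B.card_le h1
  omega

end BC

/-- Complete flags. -/
def Fl (P : Type) [PartialOrder P] (d : ℕ) : Type :=
  {D : Finset P // IsChain (· ≤ ·) (D : Set P) ∧ D.card = d + 1}

namespace BC

/-- flags containing the carrier chain of `x` -/
def S (x : EucSp d) : Set (Fl P d) := {Φ | B.C x ⊆ Φ.1}

theorem S_nonempty (x : EucSp d) : (B.S x).Nonempty := by
  obtain ⟨D, h1, h2, h3⟩ := B.exists_flag (B.chain x) (B.C_nonempty x)
  exact ⟨⟨D, h1, h3⟩, h2⟩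

theorem S_star (x : EucSp d) : ∀ᶠ y in 𝓝 x, B.S y ⊆ B.S x := by
  filter_upwards [B.star x] with y hy Φ hΦ
  exact hy.trans hΦ

theorem S_eq_of_card {x : EucSp d} (hx : (B.C x).card = d + 1) {Φ : Fl P d} (h : Φ ∈ B.S x) :
    B.C x = Φ.1 :=
  Finset.eq_of_subset_of_card_le h (by rw [hx, Φ.2.2])

theorem seg_avoid {x0 y : EucSp d} {Q : Finset (EucSp d)}
    (hx0 : x0 ∉ affineSpan ℝ (Q : Set (EucSp d)))
    (hy : y ∉ affineSpan ℝ ((insert x0 Q : Finset (EucSp d)) : Set (EucSp d))) (t : ℝ) :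
    AffineMap.lineMap x0 y t ∉ affineSpan ℝ (Q : Set (EucSp d)) := by
  intro h
  by_cases ht : t = 0
  · subst ht; simp at h; exact hx0 h
  · apply hy
    have e : y = AffineMap.lineMap x0 (AffineMap.lineMap x0 y t) t⁻¹ := by
      simp only [AffineMap.lineMap_apply, vsub_eq_sub, vadd_eq_add, add_sub_cancel_right, smul_smul]
      rw [inv_mul_cancel₀ ht, one_smul, sub_add_cancel]
    rw [e]
    apply AffineMap.lineMap_mem
    · exact subset_affineSpan _ _ (by simp)
    · exact affineSpan_mono ℝ (by simp) h

theorem tri_avoid {x0 y z : EucSp d} {Q : Finset (EucSp d)}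
    (hx0 : x0 ∉ affineSpan ℝ (Q : Set (EucSp d)))
    (hy : y ∉ affineSpan ℝ ((insert x0 Q : Finset (EucSp d)) : Set (EucSp d)))
    (hz : z ∉ affineSpan ℝ ((insert y (insert x0 Q) : Finset (EucSp d)) : Set (EucSp d)))
    (s t : ℝ) :
    AffineMap.lineMap x0 (AffineMap.lineMap y z s) t ∉ affineSpan ℝ (Q : Set (EucSp d)) :=
  seg_avoid hx0 (seg_avoid hy hz s) t

theorem finset_countable (B : BC P d) : Countable (Finset P) := by
  have := B.countable
  infer_instance

/-- Connectivity. -/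
theorem conn {U : Set (EucSp d)} (hU : IsOpen U) (hUc : Convex ℝ U) (p : Fl P d → Prop)
    (hp : ∀ x ∈ U, d ≤ (B.C x).card → ∀ Φ ∈ B.S x, ∀ Φ' ∈ B.S x, p Φ → p Φ')
    {Φ Φ' : Fl P d} (hΦ : ∃ x ∈ U, B.C x = Φ.1) (hΦ' : ∃ x ∈ U, B.C x = Φ'.1) (h : p Φ) : p Φ' := by
  have hcount := B.finset_countable
  -- a generic point in each cell
  have hgood : ∀ Φ : Fl P d, (∃ x ∈ U, B.C x = Φ.1) → ∃ x ∈ U, B.C x = Φ.1 ∧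
      ∀ D : Finset P, D.card + 1 ≤ d → x ∉ affineSpan ℝ ((D.image B.b : Finset _) : Set (EucSp d)) := by
    intro Φ hΦ
    obtain ⟨x, hx, hx'⟩ := hΦ
    obtain ⟨z, hz, hz'⟩ := gen (fun D : {D : Finset P // D.card + 1 ≤ d} => D.1.image B.b)
      (fun D => (Finset.card_image_le).trans (by have := D.2; omega)) (U ∩ {y | B.C y = Φ.1})
      (hU.inter (B.open_cell Φ.2.2)) ⟨x, hx, hx'⟩
    exact ⟨z, hz.1, hz.2, fun D hD => hz' ⟨D, hD⟩⟩
  obtain ⟨y, hyU, hyΦ, hy⟩ := hgood Φ hΦ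
  obtain ⟨y', hyU', hyΦ', hy'⟩ := hgood Φ' hΦ'
  obtain ⟨z, hzU, hz⟩ := gen (fun D : {D : Finset P // D.card + 1 ≤ d} × Bool =>
      insert (if D.2 then y else y') (D.1.1.image B.b))
    (fun D => (Finset.card_insert_le _ _).trans (by
      have h1 := D.1.2; have h2 := Finset.card_image_le (s := D.1.1) (f := B.b); omega))
    U hU ⟨y, hyU⟩
  -- a general segment statement
  have hseg : ∀ y ∈ U, (∀ D : Finset P, D.card + 1 ≤ d →
      y ∉ affineSpan ℝ ((D.image B.b : Finset _) : Set (EucSp d))) →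
      (∀ D : Finset P, D.card + 1 ≤ d →
      z ∉ affineSpan ℝ ((insert y (D.image B.b) : Finset _) : Set (EucSp d))) →
      ((∀ Ψ ∈ B.S y, p Ψ) ↔ (∀ Ψ ∈ B.S z, p Ψ)) := by
    intro y hyU hy hz
    let c : unitInterval → EucSp d := fun t => AffineMap.lineMap y z (t : ℝ)
    have hc : Continuous c := by
      simp only [c, AffineMap.lineMap_apply]
      fun_prop
    have hcU : ∀ t, c t ∈ U := fun t => hUc.lineMap_mem hyU hzU t.2
    have hcard : ∀ t, d ≤ (B.C (c t)).card := by
      intro t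
      by_contra hlt
      exact seg_avoid (hy (B.C (c t)) (by omega)) (hz (B.C (c t)) (by omega)) t (B.mem_span _)
    have hlc : IsLocallyConstant (fun t => ∀ Ψ ∈ B.S (c t), p Ψ) := by
      rw [IsLocallyConstant.iff_eventually_eq]
      intro t
      filter_upwards [hc.tendsto t |>.eventually (B.S_star (c t))] with t' ht'
      obtain ⟨Ψ0, hΨ0⟩ := B.S_nonempty (c t')
      apply propext
      constructor
      · intro h1 Ψ hΨ
        exact hp (c t) (hcU t) (hcard t) Ψ0 (ht' hΨ0) Ψ hΨ (h1 Ψ0 hΨ0)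
      · intro h1 Ψ hΨ
        exact h1 Ψ (ht' hΨ)
    have := hlc.apply_eq_of_preconnectedSpace 0 1
    simp only [c, Set.Icc.coe_zero, Set.Icc.coe_one, AffineMap.lineMap_apply_zero,
      AffineMap.lineMap_apply_one] at this
    exact iff_of_eq this
  have h1 := hseg y hyU hy (fun D hD => hz (⟨D, hD⟩, true))
  have h2 := hseg y' hyU' hy' (fun D hD => by simpa using hz (⟨D, hD⟩, false))
  have hS : ∀ Ψ ∈ B.S y, p Ψ := by
    intro Ψ hΨ
    have : Ψ = Φ := Subtype.ext (by
      rw [← B.S_eq_of_card (by rw [hyΦ, Φ.2.2]) hΨ, hyΦ])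
    rw [this]; exact h
  exact h2.2 (h1.1 hS) Φ' (by change B.C y' ⊆ _; rw [hyΦ'])

end BC
end TVF

namespace TVF
open Topology Filter
variable {P : Type} [PartialOrder P] {d : ℕ} (B : BC P d)

theorem const_of_local {X Y : Type*} [TopologicalSpace X] {s : Set X} (hs : IsPreconnected s)
    (f : X → Y) (h : ∀ x ∈ s, ∀ᶠ y in 𝓝[s] x, f y = f x) {x y : X} (hx : x ∈ s) (hy : y ∈ s) :
    f x = f y := by
  have : PreconnectedSpace s := Subtype.preconnectedSpace hs
  have hlc : IsLocallyConstant (fun t : s => f t) := by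
    rw [IsLocallyConstant.iff_eventually_eq]
    rintro ⟨t, ht⟩
    have := h t ht
    rw [nhdsWithin_eq_map_subtype_coe ht] at this
    exact this
  exact hlc.apply_eq_of_preconnectedSpace ⟨x, hx⟩ ⟨y, hy⟩

namespace BC

theorem push_pos {φ : EucSp d →ₗ[ℝ] ℝ} (hφ : φ ≠ 0) {W : Set (EucSp d)} {y : EucSp d} (hW : W ∈ 𝓝 y) :
    ∃ z ∈ W, φ y < φ z := by
  obtain ⟨v, hv⟩ : ∃ v, 0 < φ v := by
    obtain ⟨v, hv⟩ : ∃ v, φ v ≠ 0 := by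
      by_contra! h
      exact hφ (LinearMap.ext h)
    rcases lt_or_gt_of_ne hv with h | h
    · exact ⟨-v, by rw [map_neg]; linarith⟩
    · exact ⟨v, h⟩
  have hc : Tendsto (fun t : ℝ => y + t • v) (𝓝[>] 0) (𝓝 y) := by
    have : Continuous (fun t : ℝ => y + t • v) := by fun_prop
    have h := this.tendsto 0
    simp only [zero_smul, add_zero] at h
    exact h.mono_left nhdsWithin_le_nhds
  obtain ⟨t, ht, ht0⟩ := ((hc.eventually hW).and (self_mem_nhdsWithin : ∀ᶠ t : ℝ in 𝓝[>] 0, 0 < t)).exists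
  refine ⟨_, ht, ?_⟩
  rw [map_add, map_smul, smul_eq_mul]
  have := mul_pos ht0 hv
  linarith

/-- value of a linear functional at a point of a cell -/
theorem phi_cell (φ : EucSp d →ₗ[ℝ] ℝ) (y : EucSp d) (c : ℝ) (h : ∀ p ∈ B.C y, φ (B.b p) = c) :
    φ y = c := by
  obtain ⟨w, hw, hw1, hwx⟩ := B.repr y
  have := congrArg φ hwx
  rw [map_sum] at this
  simp only [map_smul, smul_eq_mul] at this
  rw [← this, Finset.sum_congr rfl (fun p hp => by rw [h p hp]), ← Finset.sum_mul, hw1, one_mul]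

theorem half {D : Finset P} (hc : D.card = d) {x : EucSp d}
    (hx : B.C x = D) {φ : EucSp d →ₗ[ℝ] ℝ} (hφ : φ ≠ 0) (hD : ∀ p ∈ D, φ (B.b p) = φ x) :
    ∃ Φ : Fl P d, D ⊆ Φ.1 ∧ (∃ F ∈ Φ.1, φ x < φ (B.b F)) ∧
      ∀ Ψ : Fl P d, D ⊆ Ψ.1 → (∃ F ∈ Ψ.1, φ x < φ (B.b F)) → Ψ = Φ := by
  obtain ⟨r, hr, hball⟩ := Metric.mem_nhds_iff.1 (B.star x)
  let H : Set (EucSp d) := Metric.ball x r ∩ {y | φ x < φ y}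
  have hφc : Continuous φ := φ.continuous_of_finiteDimensional
  have hHc : Convex ℝ H := (convex_ball x r).inter (convex_halfSpace_gt φ.isLinear _)
  have hcard : ∀ y ∈ H, (B.C y).card = d + 1 := by
    intro y hy
    have h1 : D ⊆ B.C y := hx ▸ hball hy.1
    have h2 := B.card_le (B.chain y)
    have h3 := Finset.card_le_card h1
    by_contra h4
    have h5 : D = B.C y := Finset.eq_of_subset_of_card_le h1 (by omega)
    have h6 := B.phi_cell φ y (φ x) (h5 ▸ hD)
    have : φ x < φ y := hy.2
    linarith
  have hconst : ∀ y ∈ H, ∀ z ∈ H, B.C y = B.C z := by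
    intro y hy z hz
    refine const_of_local hHc.isPreconnected B.C ?_ hy hz
    intro u hu
    exact nhdsWithin_le_nhds ((B.open_cell (hcard u hu)).mem_nhds rfl)
  have hpos : ∀ y ∈ H, ∃ F ∈ B.C y, φ x < φ (B.b F) := by
    intro y hy
    by_contra! hcon
    obtain ⟨w, hw, hw1, hwx⟩ := B.repr y
    have h1 := congrArg φ hwx
    rw [map_sum] at h1
    simp only [map_smul, smul_eq_mul] at h1
    have h2 : ∑ p ∈ B.C y, w p * φ (B.b p) ≤ ∑ p ∈ B.C y, w p * φ x :=
      Finset.sum_le_sum (fun p hp => mul_le_mul_of_nonneg_left (hcon p hp) (hw p hp).le)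
    rw [← Finset.sum_mul, hw1, one_mul, h1] at h2
    have : φ x < φ y := hy.2
    linarith
  obtain ⟨y, hyb, hyφ⟩ := push_pos hφ (Metric.ball_mem_nhds x hr)
  have hyH : y ∈ H := ⟨hyb, hyφ⟩
  refine ⟨⟨B.C y, B.chain y, hcard y hyH⟩, hx ▸ hball hyb, hpos y hyH, ?_⟩
  rintro Ψ hΨ ⟨F, hF, hFp⟩
  obtain ⟨z, hz, hzΨ⟩ := B.near (x := x) Ψ.2.1 (by rw [hx]; exact hΨ) (Metric.ball_mem_nhds x hr)
  have hFD : F ∉ D := fun h => by have := hD F h; linarith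
  have hins : Ψ.1 = insert F D := by
    refine (Finset.eq_of_subset_of_card_le (Finset.insert_subset hF hΨ) ?_).symm
    rw [Ψ.2.2, Finset.card_insert_of_notMem hFD, hc]
  have hzH : z ∈ H := by
    refine ⟨hz, ?_⟩
    obtain ⟨w, hw, hw1, hwx⟩ := B.repr z
    have h1 := congrArg φ hwx
    rw [map_sum] at h1
    simp only [map_smul, smul_eq_mul] at h1
    change φ x < φ z
    rw [← h1, ← one_mul (φ x), ← hw1, Finset.sum_mul]
    refine Finset.sum_lt_sum (fun p hp => ?_) ⟨F, by rw [hzΨ]; exact hF, ?_⟩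
    · refine mul_le_mul_of_nonneg_left ?_ (hw p hp).le
      rw [hzΨ, hins, Finset.mem_insert] at hp
      rcases hp with rfl | hp
      · exact hFp.le
      · exact (hD p hp).ge
    · exact mul_lt_mul_of_pos_left hFp (hw F (by rw [hzΨ]; exact hF))
  exact Subtype.ext (by rw [← hzΨ]; exact hconst z hzH y hyH)

theorem diamond (B : BC P d) (hd : 1 ≤ d) {D : Finset P} (hD : IsChain (· ≤ ·) (D : Set P)) (hc : D.card = d) :
    ∃ Φ Φ' : Fl P d, Φ ≠ Φ' ∧ ∀ Ψ : Fl P d, D ⊆ Ψ.1 ↔ (Ψ = Φ ∨ Ψ = Φ') := by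
  have hne : D.Nonempty := Finset.card_pos.1 (by omega)
  obtain ⟨x, hx⟩ := B.exists_cell hD hne
  have hxs := B.mem_span x
  rw [hx] at hxs
  have hspan := affineSpan_ne_top (D.image B.b) (Finset.card_image_le.trans hc.le)
  have hdir : (affineSpan ℝ ((D.image B.b : Finset (EucSp d)) : Set (EucSp d))).direction < ⊤ := by
    rw [lt_top_iff_ne_top]
    intro h
    rw [AffineSubspace.direction_eq_top_iff_of_nonempty ⟨x, hxs⟩] at h
    exact hspan h
  obtain ⟨φ, hφ, hker⟩ := Submodule.exists_le_ker_of_lt_top _ hdir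
  have hDφ : ∀ p ∈ D, φ (B.b p) = φ x := by
    intro p hp
    have h1 : B.b p ∈ affineSpan ℝ ((D.image B.b : Finset (EucSp d)) : Set (EucSp d)) :=
      subset_affineSpan _ _ (by simpa using ⟨p, hp, rfl⟩)
    have h2 := hker (AffineSubspace.vsub_mem_direction h1 hxs)
    rw [LinearMap.mem_ker, vsub_eq_sub, map_sub] at h2
    linarith
  obtain ⟨Φ, h1, ⟨F, hF, hFp⟩, h3⟩ := B.half hc hx hφ hDφ
  obtain ⟨Φ', h1', ⟨F', hF', hFp'⟩, h3'⟩ := B.half hc hx (φ := -φ) (neg_ne_zero.2 hφ)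
    (fun p hp => by simp [hDφ p hp])
  simp only [LinearMap.neg_apply, neg_lt_neg_iff] at hFp' h3'
  have hFD : F ∉ D := fun h => by have := hDφ F h; linarith
  have hFD' : F' ∉ D := fun h => by have := hDφ F' h; linarith
  have hins : Φ.1 = insert F D := by
    refine (Finset.eq_of_subset_of_card_le (Finset.insert_subset hF h1) ?_).symm
    rw [Φ.2.2, Finset.card_insert_of_notMem hFD, hc]
  refine ⟨Φ, Φ', ?_, ?_⟩
  · intro h
    rw [← h, hins, Finset.mem_insert] at hF'
    rcases hF' with h' | h'
    · rw [h'] at hFp'; linarith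
    · exact hFD' h'
  · intro Ψ
    constructor
    · intro hΨ
      have : ∃ G ∈ Ψ.1, φ (B.b G) ≠ φ x := by
        by_contra! hcon
        obtain ⟨y, hy⟩ := B.exists_cell Ψ.2.1 (hne.mono hΨ)
        obtain ⟨z, hz, hlt⟩ := push_pos hφ ((B.open_cell Ψ.2.2).mem_nhds hy)
        have e1 := B.phi_cell φ y _ (by rw [hy]; exact hcon)
        have e2 := B.phi_cell φ z _ (by rw [show B.C z = Ψ.1 from hz]; exact hcon)
        linarith
      obtain ⟨G, hG, hne⟩ := this
      rcases lt_or_gt_of_ne hne with h | h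
      · exact Or.inr (h3' Ψ hΨ ⟨G, hG, h⟩)
      · exact Or.inl (h3 Ψ hΨ ⟨G, hG, h⟩)
    · rintro (rfl | rfl)
      · exact h1
      · exact h1'


theorem exists_el (Φ : Fl P d) {i : ℕ} (hi : i ≤ d) : ∃ F ∈ Φ.1, B.rk F = i := by
  have h : Φ.1.image B.rk = Finset.range (d + 1) := by
    refine Finset.eq_of_subset_of_card_le ?_ ?_
    · intro n hn
      obtain ⟨p, -, rfl⟩ := Finset.mem_image.1 hn
      exact Finset.mem_range.2 (Nat.lt_succ_of_le (B.rk_le p))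
    · rw [Finset.card_image_of_injOn (B.rk_injOn Φ.2.1), Φ.2.2, Finset.card_range]
  have : i ∈ Φ.1.image B.rk := by rw [h]; exact Finset.mem_range.2 (by omega)
  simpa using this

/-- the element of rank `i` of a flag -/
noncomputable def el (Φ : Fl P d) (i : ℕ) : P := (B.exists_el Φ (Nat.min_le_right i d)).choose

theorem el_mem (Φ : Fl P d) (i : ℕ) : B.el Φ i ∈ Φ.1 :=
  (B.exists_el Φ (Nat.min_le_right i d)).choose_spec.1

theorem rk_el (Φ : Fl P d) {i : ℕ} (hi : i ≤ d) : B.rk (B.el Φ i) = i := by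
  have := (B.exists_el Φ (Nat.min_le_right i d)).choose_spec.2
  exact this.trans (Nat.min_eq_left hi)

theorem eq_el (Φ : Fl P d) {F : P} (hF : F ∈ Φ.1) {i : ℕ} (hi : B.rk F = i) : F = B.el Φ i :=
  B.rk_injOn Φ.2.1 hF (B.el_mem Φ i) (by rw [B.rk_el Φ (hi ▸ B.rk_le F), hi])

theorem lt_of_rk (Φ : Fl P d) {F G : P} (hF : F ∈ Φ.1) (hG : G ∈ Φ.1) (h : B.rk F < B.rk G) :
    F < G := by
  have hne : F ≠ G := fun e => by rw [e] at h; exact lt_irrefl _ h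
  rcases Φ.2.1 hF hG hne with h' | h'
  · exact lt_of_le_of_ne h' hne
  · have := B.rk_strictMono (lt_of_le_of_ne h' hne.symm); omega

theorem el_lt (Φ : Fl P d) {i k : ℕ} (hik : i < k) (hk : k ≤ d) : B.el Φ i < B.el Φ k :=
  B.lt_of_rk Φ (B.el_mem Φ i) (B.el_mem Φ k) (by rw [B.rk_el Φ hk, B.rk_el Φ (by omega)]; exact hik)

theorem fl_ext {Φ Ψ : Fl P d} (h : ∀ i ≤ d, B.el Φ i = B.el Ψ i) : Φ = Ψ := by
  apply Subtype.ext
  refine Finset.eq_of_subset_of_card_le ?_ (by rw [Φ.2.2, Ψ.2.2])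
  intro F hF
  rw [B.eq_el Φ hF rfl, h _ (B.rk_le F)]
  exact B.el_mem _ _

theorem exists_fl (f : ℕ → P) (hr : ∀ i ≤ d, B.rk (f i) = i) (hlt : ∀ i < d, f i < f (i + 1)) :
    ∃ Φ : Fl P d, ∀ i ≤ d, B.el Φ i = f i := by
  have hmono : ∀ k ≤ d, ∀ i < k, f i < f k := by
    intro k
    induction k with
    | zero => intro _ i hi; omega
    | succ k ih =>
      intro hk i hi
      rcases Nat.lt_succ_iff_lt_or_eq.1 hi with h | rfl
      · exact (ih (by omega) i h).trans (hlt k (by omega))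
      · exact hlt _ (by omega)
  have hinj : Set.InjOn f (Finset.range (d + 1) : Set ℕ) := by
    intro i hi k hk h
    rw [Finset.mem_coe, Finset.mem_range] at hi hk
    have := congrArg B.rk h
    rwa [hr i (by omega), hr k (by omega)] at this
  have hch : IsChain (· ≤ ·) (((Finset.range (d + 1)).image f : Finset P) : Set P) := by
    intro x hx y hy hne
    simp only [Finset.coe_image, Set.mem_image, Finset.mem_coe, Finset.mem_range] at hx hy
    obtain ⟨i, hi, rfl⟩ := hx
    obtain ⟨k, hk, rfl⟩ := hy
    rcases lt_trichotomy i k with h | rfl | h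
    · exact Or.inl (hmono k (by omega) i h).le
    · exact (hne rfl).elim
    · exact Or.inr (hmono i (by omega) k h).le
  refine ⟨⟨_, hch, by rw [Finset.card_image_of_injOn hinj, Finset.card_range]⟩, ?_⟩
  intro i hi
  exact (B.eq_el _ (Finset.mem_image_of_mem f (Finset.mem_range.2 (by omega))) (hr i hi)).symm

/-- The adjacent flag. -/
noncomputable def sg (i : ℕ) (Φ : Fl P d) : Fl P d :=
  if h : ∃ Φ' : Fl P d, Φ' ≠ Φ ∧ ∀ k ≤ d, k ≠ i → B.el Φ' k = B.el Φ k then h.choose else Φ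

theorem el_sg (i : ℕ) (Φ : Fl P d) {k : ℕ} (hk : k ≤ d) (hki : k ≠ i) :
    B.el (B.sg i Φ) k = B.el Φ k := by
  unfold sg
  split_ifs with h
  · exact h.choose_spec.2 k hk hki
  · rfl

theorem sg_of_lt {i : ℕ} (hi : d < i) (Φ : Fl P d) : B.sg i Φ = Φ :=
  B.fl_ext (fun k hk => B.el_sg i Φ hk (by omega))

theorem adj_ex (hd : 1 ≤ d) {i : ℕ} (hi : i ≤ d) (Φ : Fl P d) :
    ∃ Φ' : Fl P d, Φ' ≠ Φ ∧ ∀ Ψ : Fl P d, (∀ k ≤ d, k ≠ i → B.el Ψ k = B.el Φ k) ↔ (Ψ = Φ' ∨ Ψ = Φ) := by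
  have hD : IsChain (· ≤ ·) ((Φ.1.erase (B.el Φ i) : Finset P) : Set P) :=
    Φ.2.1.mono (by intro p hp; exact Finset.mem_of_mem_erase hp)
  have hc : (Φ.1.erase (B.el Φ i)).card = d := by
    rw [Finset.card_erase_of_mem (B.el_mem Φ i), Φ.2.2]; rfl
  obtain ⟨Φ1, Φ2, hne, h⟩ := B.diamond hd hD hc
  have key : ∀ Ψ : Fl P d, (∀ k ≤ d, k ≠ i → B.el Ψ k = B.el Φ k) ↔ Φ.1.erase (B.el Φ i) ⊆ Ψ.1 := by
    intro Ψ
    constructor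
    · intro h F hF
      rw [Finset.mem_erase] at hF
      have h1 := B.eq_el Φ hF.2 rfl
      have h2 : B.rk F ≠ i := fun h2 => hF.1 (by rw [← h2]; exact h1)
      rw [h1, ← h _ (B.rk_le F) h2]
      exact B.el_mem _ _
    · intro h k hk hki
      refine (B.eq_el Ψ (h ?_) (B.rk_el Φ hk)).symm
      rw [Finset.mem_erase]
      refine ⟨fun e => hki ?_, B.el_mem _ _⟩
      rw [← B.rk_el Φ hk, e, B.rk_el Φ hi]
  have hΦ := (h Φ).1 (Finset.erase_subset _ _)
  rcases hΦ with e | e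
  · refine ⟨Φ2, by rw [e]; exact hne.symm, fun Ψ => ?_⟩
    rw [key, h, e, or_comm]
  · refine ⟨Φ1, by rw [e]; exact hne, fun Ψ => ?_⟩
    rw [key, h, e]

theorem sg_ne (hd : 1 ≤ d) {i : ℕ} (hi : i ≤ d) (Φ : Fl P d) : B.sg i Φ ≠ Φ := by
  obtain ⟨Φ', hne, h⟩ := B.adj_ex hd hi Φ
  have hex : ∃ Φ' : Fl P d, Φ' ≠ Φ ∧ ∀ k ≤ d, k ≠ i → B.el Φ' k = B.el Φ k :=
    ⟨Φ', hne, (h Φ').2 (Or.inl rfl)⟩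
  unfold sg
  rw [dif_pos hex]
  exact hex.choose_spec.1

theorem sg_unique (hd : 1 ≤ d) {i : ℕ} {Φ Ψ : Fl P d} (hne : Ψ ≠ Φ)
    (h : ∀ k ≤ d, k ≠ i → B.el Ψ k = B.el Φ k) : Ψ = B.sg i Φ := by
  by_cases hi : i ≤ d
  · obtain ⟨Φ', hne', h'⟩ := B.adj_ex hd hi Φ
    have h1 := (h' (B.sg i Φ)).1 (fun k hk hki => B.el_sg i Φ hk hki)
    have h2 := (h' Ψ).1 h
    rw [h2.resolve_right hne, h1.resolve_right (B.sg_ne hd hi Φ)]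
  · exact (hne (B.fl_ext fun k hk => h k hk (by omega))).elim

theorem sg_sg (hd : 1 ≤ d) (i : ℕ) (Φ : Fl P d) : B.sg i (B.sg i Φ) = Φ := by
  by_cases hi : i ≤ d
  · exact (B.sg_unique hd (B.sg_ne hd hi Φ).symm (fun k hk hki => (B.el_sg i Φ hk hki).symm)).symm
  · rw [B.sg_of_lt (by omega), B.sg_of_lt (by omega)]

theorem el_sg_ne (hd : 1 ≤ d) {i : ℕ} (hi : i ≤ d) (Φ : Fl P d) : B.el (B.sg i Φ) i ≠ B.el Φ i := by
  intro h
  refine B.sg_ne hd hi Φ (B.fl_ext fun k hk => ?_)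
  by_cases hki : k = i
  · rw [hki, h]
  · exact B.el_sg i Φ hk hki

theorem sg_comm (hd : 1 ≤ d) {i k : ℕ} (hik : i + 2 ≤ k) (Φ : Fl P d) :
    B.sg i (B.sg k Φ) = B.sg k (B.sg i Φ) := by
  by_cases hk : k ≤ d
  swap
  · rw [B.sg_of_lt (i := k) (by omega), B.sg_of_lt (i := k) (by omega)]
  obtain ⟨Ψ, hΨ⟩ := B.exists_fl (fun n => if n = i then B.el (B.sg i Φ) i else B.el (B.sg k Φ) n)
    (by
      intro n hn
      split_ifs with h
      · rw [h]; exact B.rk_el _ (by omega)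
      · exact B.rk_el _ hn)
    (by
      intro n hn
      split_ifs with h h' h'
      · omega
      · subst h
        rw [B.el_sg k Φ (by omega) (by omega), ← B.el_sg n Φ (k := n + 1) (by omega) (by omega)]
        exact B.el_lt _ (by omega) (by omega)
      · subst h'
        rw [B.el_sg k Φ (by omega) (by omega), ← B.el_sg (n + 1) Φ (k := n) (by omega) (by omega)]
        exact B.el_lt _ (by omega) (by omega)
      · exact B.el_lt _ (by omega) (by omega))
  have e1 : Ψ = B.sg i (B.sg k Φ) := by
    refine B.sg_unique hd ?_ ?_
    · intro h
      have h1 := hΨ i (by omega)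
      rw [if_pos rfl, h, B.el_sg k Φ (by omega) (by omega)] at h1
      exact B.el_sg_ne hd (by omega) Φ h1.symm
    · intro n hn hni
      rw [hΨ n hn, if_neg hni]
  have e2 : Ψ = B.sg k (B.sg i Φ) := by
    refine B.sg_unique hd ?_ ?_
    · intro h
      have h1 := hΨ k hk
      rw [if_neg (by omega), h, B.el_sg i Φ (by omega) (by omega)] at h1
      exact B.el_sg_ne hd (by omega) Φ h1.symm
    · intro n hn hnk
      rw [hΨ n hn]
      split_ifs with h
      · rw [h]
      · rw [B.el_sg k Φ hn hnk, B.el_sg i Φ hn h]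
  rw [← e1, e2]

end BC
end TVF

namespace TVF
open Topology Filter
variable {P : Type} [PartialOrder P] {d : ℕ} (B : BC P d)

namespace BC

/-- ranks occurring in the carrier chain of `x` -/
noncomputable def rks (x : EucSp d) : Finset ℕ := (B.C x).image B.rk

theorem card_rks (x : EucSp d) : (B.rks x).card = (B.C x).card :=
  Finset.card_image_of_injOn (B.rk_injOn (B.chain x))

theorem rks_le {x : EucSp d} {k : ℕ} (h : k ∈ B.rks x) : k ≤ d := by
  obtain ⟨p, -, rfl⟩ := Finset.mem_image.1 h
  exact B.rk_le p

theorem mem_S_iff {x : EucSp d} {Φ : Fl P d} (hΦ : Φ ∈ B.S x) (Ψ : Fl P d) :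
    Ψ ∈ B.S x ↔ ∀ k ∈ B.rks x, B.el Ψ k = B.el Φ k := by
  constructor
  · intro hΨ k hk
    obtain ⟨p, hp, rfl⟩ := Finset.mem_image.1 hk
    rw [← B.eq_el Φ (hΦ hp) rfl, ← B.eq_el Ψ (hΨ hp) rfl]
  · intro h p hp
    rw [B.eq_el Φ (hΦ hp) rfl, ← h _ (Finset.mem_image_of_mem _ hp)]
    exact B.el_mem _ _

theorem sg_mem_S {x : EucSp d} {Φ : Fl P d} (hΦ : Φ ∈ B.S x) {i : ℕ} (hi : i ∉ B.rks x) :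
    B.sg i Φ ∈ B.S x :=
  (B.mem_S_iff hΦ _).2 fun _ hk => B.el_sg i Φ (B.rks_le hk) (fun e => hi (e ▸ hk))

theorem sg_mem_S_iff (hd : 1 ≤ d) {x : EucSp d} {Φ : Fl P d} (hΦ : Φ ∈ B.S x) {i : ℕ} (hid : i ≤ d) :
    B.sg i Φ ∈ B.S x ↔ i ∉ B.rks x :=
  ⟨fun h hi => B.el_sg_ne hd hid Φ ((B.mem_S_iff hΦ _).1 h i hi), B.sg_mem_S hΦ⟩

theorem sconn (hd : 1 ≤ d) (x : EucSp d) (p : Fl P d → Prop)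
    (h : ∀ Φ ∈ B.S x, ∀ i ≤ d, i ∉ B.rks x → p Φ → p (B.sg i Φ)) {Φ Φ' : Fl P d}
    (hΦ : Φ ∈ B.S x) (hΦ' : Φ' ∈ B.S x) (hp : p Φ) : p Φ' := by
  obtain ⟨r, hr, hball⟩ := Metric.mem_nhds_iff.1 (B.S_star x)
  refine B.conn (U := Metric.ball x r) Metric.isOpen_ball (convex_ball x r) p ?_
    (B.near Φ.2.1 hΦ (Metric.ball_mem_nhds x hr))
    (B.near Φ'.2.1 hΦ' (Metric.ball_mem_nhds x hr)) hp
  intro y hy hc Ψ hΨ Ψ' hΨ' hpΨ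
  by_cases e : Ψ' = Ψ
  · rw [e]; exact hpΨ
  -- find the missing rank
  have hsub : B.rks y ⊆ Finset.range (d + 1) := fun k hk =>
    Finset.mem_range.2 (Nat.lt_succ_of_le (B.rks_le hk))
  have hcard := B.card_rks y
  have hmiss : ∃ i ≤ d, ∀ k ≤ d, k ≠ i → k ∈ B.rks y := by
    by_cases hfull : (B.rks y).card = d + 1
    · have := Finset.eq_of_subset_of_card_le hsub (by simp [hfull])
      exact ⟨0, Nat.zero_le _, fun k hk _ => by rw [this]; exact Finset.mem_range.2 (by omega)⟩
    · have h2 : (B.rks y).card ≤ d + 1 := by simpa using Finset.card_le_card hsub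
      have h1 : (Finset.range (d + 1) \ B.rks y).card = 1 := by
        rw [Finset.card_sdiff_of_subset hsub, Finset.card_range]; omega
      obtain ⟨i, hi⟩ := Finset.card_eq_one.1 h1
      have hi' : i ∈ Finset.range (d + 1) \ B.rks y := by rw [hi]; simp
      refine ⟨i, ?_, ?_⟩
      · have := (Finset.mem_sdiff.1 hi').1
        rw [Finset.mem_range] at this; omega
      · intro k hk hki
        by_contra hk'
        have : k ∈ Finset.range (d + 1) \ B.rks y :=
          Finset.mem_sdiff.2 ⟨Finset.mem_range.2 (by omega), hk'⟩
        rw [hi, Finset.mem_singleton] at this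
        exact hki this
  obtain ⟨i, hid, hi⟩ := hmiss
  have hΨs : Ψ' = B.sg i Ψ :=
    B.sg_unique hd e (fun k hk hki => (B.mem_S_iff hΨ Ψ').1 hΨ' k (hi k hk hki))
  have hΨx : Ψ ∈ B.S x := hball hy hΨ
  have hΨx' : Ψ' ∈ B.S x := hball hy hΨ'
  rw [hΨs]
  refine h Ψ hΨx i hid ?_ hpΨ
  rw [hΨs] at hΨx'
  exact (B.sg_mem_S_iff hd hΨx hid).1 hΨx'

section machine
variable {Y : Type} (ρ : ℕ → Fl P d → Y → Y)

/-- the transport relation -/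
def Rel (Φ Φ' : Fl P d) (v v' : Y) : Prop := ∀ i ≤ d, Φ' = B.sg i Φ → v' = ρ i Φ v

theorem huq (hd : 1 ≤ d) (x : EucSp d) (g g' : Fl P d → Y) (hg : Compat (B.Rel ρ) (B.S x) g)
    (hg' : Compat (B.Rel ρ) (B.S x) g') (Φ : Fl P d) (hΦ : Φ ∈ B.S x) (e : g Φ = g' Φ)
    (Φ' : Fl P d) (hΦ' : Φ' ∈ B.S x) : g Φ' = g' Φ' := by
  refine B.sconn hd x (fun Φ => g Φ = g' Φ) ?_ hΦ hΦ' e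
  intro Ψ hΨ i hid hi h
  have hm := B.sg_mem_S hΨ hi
  rw [hg Ψ hΨ _ hm i hid rfl, hg' Ψ hΨ _ hm i hid rfl, h]

/-- sections along a map -/
def IsSec {X : Type} [TopologicalSpace X] (c : X → EucSp d) (s : X → Fl P d → Y) : Prop :=
  (∀ x, Compat (B.Rel ρ) (B.S (c x)) (s x)) ∧
    ∀ x, ∀ᶠ y in 𝓝 x, ∀ Φ ∈ B.S (c y), s y Φ = s x Φ

variable {ρ} {B}

theorem IsSec.comp {X X' : Type} [TopologicalSpace X] [TopologicalSpace X'] {c : X → EucSp d}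
    {s : X → Fl P d → Y} (hs : B.IsSec ρ c s) {h : X' → X} (hh : Continuous h) :
    B.IsSec ρ (fun t => c (h t)) (fun t => s (h t)) :=
  ⟨fun x => hs.1 (h x), fun x => hh.continuousAt.eventually (hs.2 (h x))⟩

theorem isSec_const {X : Type} [TopologicalSpace X] {c : X → EucSp d} {g : Fl P d → Y}
    {x : EucSp d} (hg : Compat (B.Rel ρ) (B.S x) g) (hc : ∀ t, B.C x ⊆ B.C (c t)) :
    B.IsSec ρ c (fun _ => g) :=
  ⟨fun t => hg.mono (fun Φ hΦ => (hc t).trans hΦ), fun _ => Filter.Eventually.of_forall fun _ _ _ => rfl⟩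

theorem IsSec.agree {X : Type} [TopologicalSpace X] [PreconnectedSpace X] (hd : 1 ≤ d)
    {c : X → EucSp d} (hc : Continuous c) {s s' : X → Fl P d → Y}
    (hs : B.IsSec ρ c s) (hs' : B.IsSec ρ c s') (x y : X)
    (h : ∀ Φ ∈ B.S (c x), s x Φ = s' x Φ) : ∀ Φ ∈ B.S (c y), s y Φ = s' y Φ := by
  have hlc : IsLocallyConstant (fun t => ∀ Φ ∈ B.S (c t), s t Φ = s' t Φ) := by
    rw [IsLocallyConstant.iff_eventually_eq]
    intro t
    filter_upwards [hc.continuousAt.eventually (B.S_star (c t)), hs.2 t, hs'.2 t] with u h1 h2 h3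
    apply propext
    constructor
    · intro h Φ hΦ
      obtain ⟨Ψ, hΨ⟩ := B.S_nonempty (c u)
      refine B.huq ρ hd (c t) _ _ (hs.1 t) (hs'.1 t) Ψ (h1 hΨ) ?_ Φ hΦ
      rw [← h2 Ψ hΨ, ← h3 Ψ hΨ, h Ψ hΨ]
    · intro h Φ hΦ
      rw [h2 Φ hΦ, h3 Φ hΦ, h Φ (h1 hΦ)]
  exact cast (hlc.apply_eq_of_preconnectedSpace x y) h

/-- clipping to the unit interval -/
noncomputable def clip (t : ℝ) : ℝ := max 0 (min 1 t)

theorem continuous_clip : Continuous clip := by unfold clip; fun_prop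
theorem clip_mem (t : ℝ) : clip t ∈ Set.Icc (0 : ℝ) 1 := by
  unfold clip; constructor <;> simp
@[simp] theorem clip_zero : clip 0 = 0 := by simp [clip]
@[simp] theorem clip_one : clip 1 = 1 := by simp [clip]

variable (B) in
theorem machine (hd : 1 ≤ d) {U : Set (EucSp d)} (hU : IsOpen U) (hUc : Convex ℝ U)
    (hex : ∀ x ∈ U, d ≤ (B.C x).card + 1 → ∀ Φ ∈ B.S x, ∀ v : Y,
      ∃ g : Fl P d → Y, g Φ = v ∧ Compat (B.Rel ρ) (B.S x) g)
    (Φ0 : Fl P d) (hΦ0 : ∃ x ∈ U, B.C x = Φ0.1) (v0 : Y) :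
    ∃ f : Fl P d → Y, f Φ0 = v0 ∧ ∀ x ∈ U, d ≤ (B.C x).card + 1 → Compat (B.Rel ρ) (B.S x) f := by
  have hcount := B.finset_countable
  let J := {D : Finset P // D.card + 2 ≤ d}
  let Q : J → Finset (EucSp d) := fun D => D.1.image B.b
  have hQ : ∀ D, (Q D).card + 2 ≤ d := fun D => by
    have := D.2; have := Finset.card_image_le (s := D.1) (f := B.b); simp only [Q]; omega
  have hU' : ∀ x, (∀ D, x ∉ affineSpan ℝ (Q D : Set (EucSp d))) → d ≤ (B.C x).card + 1 := by
    intro x hx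
    by_contra hlt
    exact hx ⟨B.C x, by omega⟩ (B.mem_span x)
  -- base point
  obtain ⟨x0, ⟨hx0U, hx0C⟩, hx0⟩ : ∃ x0 ∈ U ∩ {y | B.C y = Φ0.1},
      ∀ D, x0 ∉ affineSpan ℝ (Q D : Set (EucSp d)) := by
    obtain ⟨x, hx, hx'⟩ := hΦ0
    exact gen Q (fun D => by have := hQ D; omega) _ (hU.inter (B.open_cell Φ0.2.2)) ⟨x, hx, hx'⟩
  replace hx0C : B.C x0 = Φ0.1 := hx0C
  have hS0 : Φ0 ∈ B.S x0 := by change B.C x0 ⊆ _; rw [hx0C]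
  have hS0' : ∀ Φ ∈ B.S x0, Φ = Φ0 := fun Φ hΦ => Subtype.ext (by
    rw [← B.S_eq_of_card (by rw [hx0C, Φ0.2.2]) hΦ, hx0C])
  let Q1 : J → Finset (EucSp d) := fun D => insert x0 (Q D)
  let Q2 : EucSp d → J → Finset (EucSp d) := fun y D => insert y (Q1 D)
  have hQ1 : ∀ D, (Q1 D).card ≤ d := fun D => by
    have := hQ D; have := Finset.card_insert_le x0 (Q D); simp only [Q1]; omega
  have hQ2 : ∀ y D, (Q2 y D).card ≤ d := fun y D => by
    have := hQ D; have := Finset.card_insert_le x0 (Q D)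
    have := Finset.card_insert_le y (Q1 D); simp only [Q2]; simp only [Q1] at this ⊢; omega
  let G : Set (EucSp d) := {y | y ∈ U ∧ ∀ D, y ∉ affineSpan ℝ (Q1 D : Set (EucSp d))}
  let c1 : EucSp d → ℝ → EucSp d := fun y t => AffineMap.lineMap x0 y (clip t)
  let c2 : EucSp d → EucSp d → ℝ × ℝ → EucSp d := fun y z q =>
    AffineMap.lineMap x0 (AffineMap.lineMap y z (clip q.1) : EucSp d) (clip q.2)
  have hclip := continuous_clip
  have hc2 : ∀ y z, Continuous (c2 y z) := by
    intro y z
    simp only [c2, AffineMap.lineMap_apply]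
    fun_prop
  have hc1 : ∀ y, Continuous (c1 y) := by
    intro y
    simp only [c1, AffineMap.lineMap_apply]
    fun_prop
  have hc1U : ∀ y ∈ G, ∀ t, c1 y t ∈ U := fun y hy t => hUc.lineMap_mem hx0U hy.1 (clip_mem t)
  have hc1Q : ∀ y ∈ G, ∀ t, d ≤ (B.C (c1 y t)).card + 1 := fun y hy t =>
    hU' _ (fun D => seg_avoid (hx0 D) (hy.2 D) _)
  -- sections along segments
  have hsec1 : ∀ y, ∃ s : ℝ → Fl P d → Y, y ∈ G → B.IsSec ρ (c1 y) s ∧ s 0 Φ0 = v0 := by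
    intro y
    by_cases hy : y ∈ G
    · obtain ⟨s, h1, h2, h3⟩ := machine_local (X := ℝ) (B.Rel ρ) (fun t => B.S (c1 y t))
        (fun t => B.S_nonempty _) (fun t => (hc1 y).continuousAt.eventually (B.S_star _))
        (fun t => hex _ (hc1U y hy t) (hc1Q y hy t)) (fun t => B.huq ρ hd _) 0 Φ0
        (by simpa [c1] using hS0) v0
      exact ⟨s, fun _ => ⟨⟨h1, h3⟩, h2⟩⟩
    · exact ⟨fun _ _ => v0, fun h => (hy h).elim⟩
  choose sec hsec using hsec1
  have htri : ∀ y ∈ G, ∀ z ∈ U, (∀ D, z ∉ affineSpan ℝ (Q2 y D : Set (EucSp d))) → z ∈ G ∧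
      ∃ r : ℝ → Fl P d → Y, B.IsSec ρ (fun t => AffineMap.lineMap y z (clip t)) r ∧
        (∀ Φ ∈ B.S y, r 0 Φ = sec y 1 Φ) ∧ (∀ Φ ∈ B.S z, r 1 Φ = sec z 1 Φ) := by
    intro y hy z hz hzQ
    have hzG : z ∈ G := ⟨hz, fun D h => hzQ D (affineSpan_mono ℝ (by simp [Q2]) h)⟩
    refine ⟨hzG, ?_⟩
    have hcU : ∀ q, c2 y z q ∈ U := fun q => hUc.lineMap_mem hx0U
      (hUc.lineMap_mem hy.1 hz (clip_mem _)) (clip_mem _)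
    have hcQ : ∀ q, d ≤ (B.C (c2 y z q)).card + 1 := fun q =>
      hU' _ (fun D => tri_avoid (hx0 D) (hy.2 D) (hzQ D) _ _)
    obtain ⟨s, h1, h2, h3⟩ := machine_local (X := ℝ × ℝ) (B.Rel ρ) (fun t => B.S (c2 y z t))
        (fun t => B.S_nonempty _) (fun t => (hc2 y z).continuousAt.eventually (B.S_star _))
        (fun t => hex _ (hcU t) (hcQ t)) (fun t => B.huq ρ hd _) (0, 0) Φ0
        (by simpa [c2] using hS0) v0
    have hs : B.IsSec ρ (c2 y z) s := ⟨h1, h3⟩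
    have hbase : ∀ u : ℝ, s (u, 0) Φ0 = v0 := by
      intro u
      rw [← h2]
      refine const_of_local (s := Set.univ) isPreconnected_univ (fun u : ℝ => s (u, 0) Φ0) ?_
        (Set.mem_univ _) (Set.mem_univ _)
      intro u _
      rw [nhdsWithin_univ]
      have hcont : Continuous (fun u : ℝ => (u, (0 : ℝ))) := by fun_prop
      filter_upwards [hcont.continuousAt.eventually (h3 (u, 0))] with u' hu'
      exact hu' Φ0 (by simpa [c2] using hS0)
    refine ⟨fun t => s (t, 1), ?_, ?_, ?_⟩
    · have := hs.comp (h := fun t : ℝ => (t, (1 : ℝ))) (by fun_prop)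
      simpa [c2] using this
    · have h4 := hs.comp (h := fun t : ℝ => ((0 : ℝ), t)) (by fun_prop)
      have e : (fun t : ℝ => c2 y z (0, t)) = c1 y := by ext t; simp [c2, c1]
      rw [e] at h4
      have := h4.agree hd (hc1 y) (hsec y hy).1 0 1 (fun Φ hΦ => by
        have : Φ = Φ0 := hS0' Φ (by simpa [c1] using hΦ)
        rw [this, (hsec y hy).2]; exact hbase 0)
      simpa [c1] using this
    · have h4 := hs.comp (h := fun t : ℝ => ((1 : ℝ), t)) (by fun_prop)
      have e : (fun t : ℝ => c2 y z (1, t)) = c1 z := by ext t; simp [c2, c1]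
      rw [e] at h4
      have := h4.agree hd (hc1 z) (hsec z hzG).1 0 1 (fun Φ hΦ => by
        have : Φ = Φ0 := hS0' Φ (by simpa [c1] using hΦ)
        rw [this, (hsec z hzG).2]; exact hbase 1)
      simpa [c1] using this
  have hmove0 : ∀ x : EucSp d, ∀ W ⊆ U, Convex ℝ W → (∀ w ∈ W, B.C x ⊆ B.C w) →
      ∀ g, Compat (B.Rel ρ) (B.S x) g → ∀ y ∈ G, y ∈ W → ∀ z ∈ W,
      (∀ D, z ∉ affineSpan ℝ (Q2 y D : Set (EucSp d))) →
      ((∀ Φ ∈ B.S y, sec y 1 Φ = g Φ) ↔ (∀ Φ ∈ B.S z, sec z 1 Φ = g Φ)) := by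
    intro x W hWU hW hCW g hg y hy hyW z hzW hzQ
    obtain ⟨hzG, r, hr, hr0, hr1⟩ := htri y hy z (hWU hzW) hzQ
    have hcont : Continuous (fun t : ℝ => (AffineMap.lineMap y z (clip t) : EucSp d)) := by
      simp only [AffineMap.lineMap_apply]; fun_prop
    have hg' : B.IsSec ρ (fun t : ℝ => (AffineMap.lineMap y z (clip t) : EucSp d)) (fun _ => g) :=
      isSec_const hg (fun t => hCW _ (hW.lineMap_mem hyW hzW (clip_mem t)))
    constructor
    · intro h
      have := hr.agree hd hcont hg' 0 1 (by
        simp only [clip_zero, AffineMap.lineMap_apply_zero]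
        intro Φ hΦ; rw [hr0 Φ hΦ, h Φ hΦ])
      simp only [clip_one, AffineMap.lineMap_apply_one] at this
      intro Φ hΦ; rw [← hr1 Φ hΦ, this Φ hΦ]
    · intro h
      have := hr.agree hd hcont hg' 1 0 (by
        simp only [clip_one, AffineMap.lineMap_apply_one]
        intro Φ hΦ; rw [hr1 Φ hΦ, h Φ hΦ])
      simp only [clip_zero, AffineMap.lineMap_apply_zero] at this
      intro Φ hΦ; rw [← hr0 Φ hΦ, this Φ hΦ]
  have hmove : ∀ x : EucSp d, ∀ W ⊆ U, IsOpen W → Convex ℝ W → (∀ w ∈ W, B.C x ⊆ B.C w) →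
      ∀ g, Compat (B.Rel ρ) (B.S x) g → ∀ y ∈ G, y ∈ W → ∀ z ∈ G, z ∈ W →
      (∀ Φ ∈ B.S y, sec y 1 Φ = g Φ) → (∀ Φ ∈ B.S z, sec z 1 Φ = g Φ) := by
    intro x W hWU hWo hW hCW g hg y hy hyW z hz hzW h
    obtain ⟨u, huW, hu⟩ := gen (fun D : J × Bool => Q2 (if D.2 then y else z) D.1)
      (fun D => hQ2 _ _) W hWo ⟨y, hyW⟩
    have hyu := hmove0 x W hWU hW hCW g hg y hy hyW u huW (fun D => hu (D, true))
    have hzu := hmove0 x W hWU hW hCW g hg z hz hzW u huW (fun D => by simpa using hu (D, false))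
    exact hzu.2 (hyu.1 h)
  have hstar : ∀ x ∈ U, d ≤ (B.C x).card + 1 → ∀ W ⊆ U, IsOpen W → Convex ℝ W →
      (∀ w ∈ W, B.C x ⊆ B.C w) → ∃ g, Compat (B.Rel ρ) (B.S x) g ∧
      ∀ z ∈ G, z ∈ W → ∀ Φ ∈ B.S z, sec z 1 Φ = g Φ := by
    intro x hx hxc W hWU hWo hW hCW
    by_cases hy : ∃ y ∈ G, y ∈ W
    · obtain ⟨y, hy, hyW⟩ := hy
      have hSyx : B.S y ⊆ B.S x := fun Φ hΦ => (hCW y hyW).trans hΦ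
      obtain ⟨Ψ, hΨ⟩ := B.S_nonempty y
      obtain ⟨g, hg1, hg⟩ := hex x hx hxc Ψ (hSyx hΨ) (sec y 1 Ψ)
      refine ⟨g, hg, fun z hz hzW => hmove x W hWU hWo hW hCW g hg y hy hyW z hz hzW ?_⟩
      have h1 := (hsec y hy).1.1 1
      simp only [c1, clip_one, AffineMap.lineMap_apply_one] at h1
      exact B.huq ρ hd y _ _ h1 (hg.mono hSyx) Ψ hΨ hg1.symm
    · obtain ⟨Ψ, hΨ⟩ := B.S_nonempty x
      obtain ⟨g, hg1, hg⟩ := hex x hx hxc Ψ hΨ v0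
      exact ⟨g, hg, fun z hz hzW => (hy ⟨z, hz, hzW⟩).elim⟩
  -- the function
  let f : Fl P d → Y := fun Φ => if h : ∃ y ∈ G, B.C y = Φ.1 then sec h.choose 1 Φ else v0
  have hf : ∀ Φ : Fl P d, ∀ y ∈ G, B.C y = Φ.1 → f Φ = sec y 1 Φ := by
    intro Φ y hy hyC
    have hex' : ∃ y ∈ G, B.C y = Φ.1 := ⟨y, hy, hyC⟩
    obtain ⟨h1, h2⟩ := hex'.choose_spec
    have e : f Φ = sec hex'.choose 1 Φ := by simp only [f]; rw [dif_pos hex']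
    rw [e]
    obtain ⟨g, -, hg⟩ := hstar y hy.1 (by rw [hyC, Φ.2.2]; omega) (U ∩ {w | B.C w = Φ.1})
      Set.inter_subset_left (hU.inter (B.open_cell Φ.2.2)) (hUc.inter (B.convex_cell _))
      (fun w hw => by rw [hyC, show B.C w = Φ.1 from hw.2])
    rw [hg _ h1 ⟨h1.1, h2⟩ Φ (by change B.C _ ⊆ _; rw [h2]),
      hg _ hy ⟨hy.1, hyC⟩ Φ (by change B.C _ ⊆ _; rw [hyC])]
  refine ⟨f, ?_, ?_⟩
  · obtain ⟨y, hyW, hyQ⟩ := gen Q1 hQ1 _ (hU.inter (B.open_cell Φ0.2.2)) ⟨x0, hx0U, hx0C⟩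
    have hyG : y ∈ G := ⟨hyW.1, hyQ⟩
    have hyC : B.C y = Φ0.1 := hyW.2
    rw [hf Φ0 y hyG hyC]
    have hSt : ∀ t, Φ0 ∈ B.S (c1 y t) := fun t => by
      have : B.C (c1 y t) = Φ0.1 := (B.convex_cell Φ0.1).lineMap_mem hx0C hyC (clip_mem t)
      change B.C _ ⊆ _
      rw [this]
    rw [← (hsec y hyG).2]
    refine const_of_local (s := Set.univ) isPreconnected_univ (fun u : ℝ => sec y u Φ0) ?_
        (Set.mem_univ _) (Set.mem_univ _)
    intro u _
    rw [nhdsWithin_univ]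
    filter_upwards [(hsec y hyG).1.2 u] with u' hu'
    exact hu' Φ0 (hSt u')
  · intro x hx hxc
    obtain ⟨r, hr, hball⟩ := Metric.mem_nhds_iff.1 (Filter.inter_mem (hU.mem_nhds hx) (B.star x))
    obtain ⟨g, hg, hgz⟩ := hstar x hx hxc (Metric.ball x r) (fun w hw => (hball hw).1)
      Metric.isOpen_ball (convex_ball x r) (fun w hw => (hball hw).2)
    have hfg : ∀ Φ ∈ B.S x, f Φ = g Φ := by
      intro Φ hΦ
      obtain ⟨y, hyb, hyC⟩ := B.near Φ.2.1 hΦ (Metric.ball_mem_nhds x hr)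
      obtain ⟨z, hz, hzQ⟩ := gen Q1 hQ1 _ (Metric.isOpen_ball.inter (B.open_cell Φ.2.2))
        ⟨y, hyb, hyC⟩
      have hzG : z ∈ G := ⟨(hball hz.1).1, hzQ⟩
      rw [hf Φ z hzG hz.2]
      exact hgz z hzG hz.1 Φ (by change B.C _ ⊆ _; rw [show B.C z = Φ.1 from hz.2])
    intro Φ hΦ Φ' hΦ'
    rw [hfg Φ hΦ, hfg Φ' hΦ']
    exact hg Φ hΦ Φ' hΦ'

end machine

end BC
end TVF

namespace TVF
open Topology Filter

section dihedral
open Equiv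

theorem mul_self_inv {G : Type*} [Group G] {s : G} (h : s * s = 1) : s⁻¹ = s :=
  inv_eq_of_mul_eq_one_left h

theorem dih_conj {G : Type*} [Group G] {s t : G} (hs : s * s = 1) (ht : t * t = 1) (n : ℤ) :
    s * (s * t) ^ n = (s * t) ^ (-n) * s := by
  have h1 : s * (s * t) * s⁻¹ = (s * t)⁻¹ := by
    rw [mul_inv_rev, mul_self_inv hs, mul_self_inv ht, ← mul_assoc, hs, one_mul]
  have h2 := conj_zpow (a := s) (b := s * t) (i := n)
  rw [h1] at h2
  rw [zpow_neg, ← inv_zpow, h2, inv_mul_cancel_right]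

theorem dih_mem {G : Type*} [Group G] {s t : G} (hs : s * s = 1) (ht : t * t = 1) {h : G}
    (hh : h ∈ Subgroup.closure {s, t}) : ∃ n : ℤ, h = (s * t) ^ n ∨ h = (s * t) ^ n * s := by
  induction hh using Subgroup.closure_induction_right with
  | one => exact ⟨0, Or.inl (by simp)⟩
  | mul_right x hx y hy ih =>
    obtain ⟨n, rfl | rfl⟩ := ih
    · rcases hy with rfl | hy
      · exact ⟨n, Or.inr rfl⟩
      · rw [Set.mem_singleton_iff] at hy
        subst hy
        refine ⟨n - 1, Or.inr ?_⟩
        rw [zpow_sub_one, mul_inv_rev, mul_self_inv hs, mul_self_inv ht, mul_assoc, mul_assoc, hs,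
          mul_one]
    · rcases hy with rfl | hy
      · exact ⟨n, Or.inl (by rw [mul_assoc, hs, mul_one])⟩
      · rw [Set.mem_singleton_iff] at hy
        subst hy
        exact ⟨n + 1, Or.inl (by rw [zpow_add_one, mul_assoc])⟩
  | mul_inv_cancel x hx y hy ih =>
    obtain ⟨n, rfl | rfl⟩ := ih
    · rcases hy with rfl | hy
      · exact ⟨n, Or.inr (by rw [mul_self_inv hs])⟩
      · rw [Set.mem_singleton_iff] at hy
        subst hy
        refine ⟨n - 1, Or.inr ?_⟩
        rw [zpow_sub_one, mul_inv_rev, mul_self_inv hs, mul_self_inv ht, mul_assoc, mul_assoc, hs,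
          mul_one]
    · rcases hy with rfl | hy
      · exact ⟨n, Or.inl (by rw [mul_inv_cancel_right])⟩
      · rw [Set.mem_singleton_iff] at hy
        subst hy
        exact ⟨n + 1, Or.inl (by rw [zpow_add_one, mul_assoc, mul_self_inv ht])⟩

theorem dih_nofix {X : Type*} {s t : Perm X} (hs : s * s = 1) (ht : t * t = 1)
    (fs : ∀ x, s x ≠ x) (ft : ∀ x, t x ≠ x) (n : ℤ) (x : X) : ((s * t) ^ n * s) x ≠ x := by
  intro h
  rcases Int.even_or_odd' n with ⟨m, rfl | rfl⟩
  · have e : (s * t) ^ (2 * m) * s = (s * t) ^ m * s * ((s * t) ^ m)⁻¹ := by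
      rw [two_mul, zpow_add, mul_assoc, ← zpow_neg]
      conv_rhs => rw [mul_assoc, dih_conj hs ht]
      rw [neg_neg]
    rw [e, Perm.mul_apply, Perm.mul_apply] at h
    refine fs (((s * t) ^ m)⁻¹ x) ?_
    rw [← Perm.eq_inv_iff_eq] at h
    exact h
  · have e : (s * t) ^ (2 * m + 1) * s = (s * t) ^ m * (s * t * s) * ((s * t) ^ m)⁻¹ := by
      have : (2 * m + 1) = m + 1 + m := by ring
      rw [this, zpow_add, mul_assoc, ← zpow_neg, zpow_add_one]
      have h3 : (s * t) ^ m * s = s * (s * t) ^ (-m) := by rw [dih_conj hs ht, neg_neg]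
      rw [h3]; simp only [mul_assoc]
    rw [e, Perm.mul_apply, Perm.mul_apply, ← Perm.eq_inv_iff_eq] at h
    set y := ((s * t) ^ m)⁻¹ x
    have h' : s (t (s y)) = y := h
    refine ft (s y) ?_
    have := congrArg s h'
    rwa [← Perm.mul_apply, hs, Perm.one_apply] at this

theorem covers_mul {X Y : Type*} {s t : Perm X} {a b : Perm (X × Y)} (ca : ∀ q, (a q).1 = s q.1)
    (cb : ∀ q, (b q).1 = t q.1) : ∀ q, ((a * b) q).1 = (s * t) q.1 := by
  intro q; rw [Perm.mul_apply, ca, cb, Perm.mul_apply]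

theorem covers_inv {X Y : Type*} {s : Perm X} {a : Perm (X × Y)} (ca : ∀ q, (a q).1 = s q.1) :
    ∀ q, (a⁻¹ q).1 = s⁻¹ q.1 := by
  intro q
  rw [Perm.eq_inv_iff_eq, ← ca, ← Perm.mul_apply, mul_inv_cancel, Perm.one_apply]

theorem covers_zpow {X Y : Type*} {s : Perm X} {a : Perm (X × Y)} (ca : ∀ q, (a q).1 = s q.1)
    (n : ℤ) : ∀ q, ((a ^ n) q).1 = (s ^ n) q.1 := by
  have hnat : ∀ n : ℕ, ∀ q, ((a ^ n) q).1 = (s ^ n) q.1 := by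
    intro n
    induction n with
    | zero => intro q; simp
    | succ n ih => rw [pow_succ, pow_succ]; exact covers_mul ih ca
  cases n with
  | ofNat n => simpa using hnat n
  | negSucc n => rw [zpow_negSucc, zpow_negSucc]; exact covers_inv (hnat _)

theorem dev {X Y : Type*} {s t : Perm X} (hs : s * s = 1) (ht : t * t = 1)
    (fs : ∀ x, s x ≠ x) (ft : ∀ x, t x ≠ x) {a b : Perm (X × Y)} (ha : a * a = 1) (hb : b * b = 1)
    (ca : ∀ q, (a q).1 = s q.1) (cb : ∀ q, (b q).1 = t q.1) (q : X × Y)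
    (hK : ∀ n : ℤ, ((s * t) ^ n) q.1 = q.1 → ((a * b) ^ n) q = q) :
    ∃ g : X → Y, ∀ h ∈ Subgroup.closure {a, b}, g (h q).1 = (h q).2 := by
  have hcov : ∀ h ∈ Subgroup.closure {a, b}, ∃ π : Perm X, ∀ q, (h q).1 = π q.1 := by
    intro h hh
    obtain ⟨n, rfl | rfl⟩ := dih_mem ha hb hh
    · exact ⟨_, covers_zpow (covers_mul ca cb) n⟩
    · exact ⟨_, covers_mul (covers_zpow (covers_mul ca cb) n) ca⟩
  have hfix : ∀ h ∈ Subgroup.closure {a, b}, (h q).1 = q.1 → h q = q := by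
    intro h hh e
    obtain ⟨n, rfl | rfl⟩ := dih_mem ha hb hh
    · rw [covers_zpow (covers_mul ca cb)] at e
      exact hK n e
    · rw [covers_mul (covers_zpow (covers_mul ca cb) n) ca] at e
      exact (dih_nofix hs ht fs ft n _ e).elim
  have hwd : ∀ h ∈ Subgroup.closure {a, b}, ∀ h' ∈ Subgroup.closure {a, b},
      (h q).1 = (h' q).1 → h q = h' q := by
    intro h hh h' hh' e
    obtain ⟨π, hπ⟩ := hcov _ (Subgroup.inv_mem _ hh')
    have h1 := hfix (h'⁻¹ * h) (Subgroup.mul_mem _ (Subgroup.inv_mem _ hh') hh) (by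
      rw [Perm.mul_apply, hπ, e, ← hπ, ← Perm.mul_apply, inv_mul_cancel, Perm.one_apply])
    rw [Perm.mul_apply, Perm.inv_eq_iff_eq] at h1
    exact h1
  refine ⟨fun x => if hx : ∃ h ∈ Subgroup.closure {a, b}, (h q).1 = x then (hx.choose q).2 else q.2, ?_⟩
  intro h hh
  have hx : ∃ h' ∈ Subgroup.closure {a, b}, (h' q).1 = (h q).1 := ⟨h, hh, rfl⟩
  simp only
  rw [dif_pos hx]
  obtain ⟨h1, h2⟩ := hx.choose_spec
  rw [hwd _ h1 _ hh h2]

end dihedral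

variable {P : Type} [PartialOrder P] {d : ℕ} (B : BC P d)
namespace BC
open Equiv

/-- adjacency as a permutation -/
noncomputable def sp (hd : 1 ≤ d) (i : ℕ) : Perm (Fl P d) :=
  Function.Involutive.toPerm (B.sg i) (B.sg_sg hd i)

@[simp] theorem sp_apply (hd : 1 ≤ d) (i : ℕ) (Φ : Fl P d) : B.sp hd i Φ = B.sg i Φ := rfl

theorem sp_mul_self (hd : 1 ≤ d) (i : ℕ) : B.sp hd i * B.sp hd i = 1 := by
  ext1 Φ; simp [B.sg_sg hd]

/-- lift of adjacency to pairs -/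
noncomputable def lp (hd : 1 ≤ d) {Y : Type} (ρ : ℕ → Fl P d → Y → Y)
    (hρ : ∀ i Φ v, ρ i (B.sg i Φ) (ρ i Φ v) = v) (i : ℕ) : Perm (Fl P d × Y) :=
  Function.Involutive.toPerm (fun q => (B.sg i q.1, ρ i q.1 q.2))
    (fun q => Prod.ext (B.sg_sg hd i q.1) (hρ i q.1 q.2))

theorem lp_apply (hd : 1 ≤ d) {Y : Type} (ρ : ℕ → Fl P d → Y → Y)
    (hρ : ∀ i Φ v, ρ i (B.sg i Φ) (ρ i Φ v) = v) (i : ℕ) (q : Fl P d × Y) :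
    B.lp hd ρ hρ i q = (B.sg i q.1, ρ i q.1 q.2) := rfl

theorem lp_mul_self (hd : 1 ≤ d) {Y : Type} (ρ : ℕ → Fl P d → Y → Y)
    (hρ : ∀ i Φ v, ρ i (B.sg i Φ) (ρ i Φ v) = v) (i : ℕ) :
    B.lp hd ρ hρ i * B.lp hd ρ hρ i = 1 := by
  ext1 q
  rw [Perm.mul_apply, lp_apply, lp_apply, Perm.one_apply]
  exact Prod.ext (B.sg_sg hd i q.1) (hρ i q.1 q.2)

theorem hex_of (hd : 1 ≤ d) {Y : Type} (ρ : ℕ → Fl P d → Y → Y)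
    (hρ : ∀ i Φ v, ρ i (B.sg i Φ) (ρ i Φ v) = v) {x : EucSp d} {i k : ℕ} (hi : i ≤ d) (hk : k ≤ d)
    (hM : ∀ l ≤ d, l ∉ B.rks x → l = i ∨ l = k)
    {Φ : Fl P d} (hΦ : Φ ∈ B.S x) (v : Y)
    (hK : ∀ n : ℤ, ((B.sp hd i * B.sp hd k) ^ n) Φ = Φ →
      ((B.lp hd ρ hρ i * B.lp hd ρ hρ k) ^ n) (Φ, v) = (Φ, v)) :
    ∃ g : Fl P d → Y, g Φ = v ∧ Compat (B.Rel ρ) (B.S x) g := by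
  obtain ⟨g, hg⟩ := dev (B.sp_mul_self hd i) (B.sp_mul_self hd k) (B.sg_ne hd hi) (B.sg_ne hd hk)
    (B.lp_mul_self hd ρ hρ i) (B.lp_mul_self hd ρ hρ k) (fun _ => rfl) (fun _ => rfl) (Φ, v) hK
  have hmemi : B.lp hd ρ hρ i ∈ Subgroup.closure {B.lp hd ρ hρ i, B.lp hd ρ hρ k} :=
    Subgroup.subset_closure (by simp)
  have hmemk : B.lp hd ρ hρ k ∈ Subgroup.closure {B.lp hd ρ hρ i, B.lp hd ρ hρ k} :=
    Subgroup.subset_closure (by simp)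
  refine ⟨g, by simpa using hg 1 (Subgroup.one_mem _), ?_⟩
  have hreach : ∀ Ψ ∈ B.S x, ∃ h ∈ Subgroup.closure {B.lp hd ρ hρ i, B.lp hd ρ hρ k},
      (h (Φ, v)).1 = Ψ := by
    intro Ψ hΨ
    refine B.sconn hd x (fun Ψ => ∃ h ∈ Subgroup.closure {B.lp hd ρ hρ i, B.lp hd ρ hρ k},
      (h (Φ, v)).1 = Ψ) ?_ hΦ hΨ ⟨1, Subgroup.one_mem _, rfl⟩
    rintro Ψ' - l hl hlx ⟨h, hh, rfl⟩
    rcases hM l hl hlx with rfl | rfl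
    · exact ⟨_, Subgroup.mul_mem _ hmemi hh, rfl⟩
    · exact ⟨_, Subgroup.mul_mem _ hmemk hh, rfl⟩
  intro Ψ hΨ Ψ' hΨ' l hl e
  rw [e] at hΨ' ⊢
  have hlx := (B.sg_mem_S_iff hd hΨ hl).1 hΨ'
  obtain ⟨h, hh, rfl⟩ := hreach Ψ hΨ
  rcases hM l hl hlx with rfl | rfl
  · have h1 := hg _ (Subgroup.mul_mem _ hmemi hh)
    rw [Perm.mul_apply, lp_apply] at h1
    rw [hg h hh]; exact h1
  · have h1 := hg _ (Subgroup.mul_mem _ hmemk hh)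
    rw [Perm.mul_apply, lp_apply] at h1
    rw [hg h hh]; exact h1

/-- missing ranks at a codimension at most two point -/
theorem missing (x : EucSp d) (hx : d ≤ (B.C x).card + 1) (M : Finset ℕ)
    (hM : ∀ l ≤ d, l ∉ M → l ∈ B.rks x) (hc : 2 ≤ M.card) :
    ∃ i ∈ M, ∃ k ∈ M, i ≠ k ∧ ∀ l ≤ d, l ∉ B.rks x → l = i ∨ l = k := by
  have hsub : B.rks x ⊆ Finset.range (d + 1) := fun k hk =>
    Finset.mem_range.2 (Nat.lt_succ_of_le (B.rks_le hk))
  let N := Finset.range (d + 1) \ B.rks x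
  have hN : N.card ≤ 2 := by
    simp only [N]
    rw [Finset.card_sdiff_of_subset hsub, Finset.card_range, B.card_rks]; omega
  have hNM : N ⊆ M := by
    intro l hl
    rw [Finset.mem_sdiff, Finset.mem_range] at hl
    by_contra h
    exact hl.2 (hM l (by omega) h)
  obtain ⟨N', h1, h2, h3⟩ := Finset.exists_subsuperset_card_eq hNM hN hc
  obtain ⟨i, k, hik, rfl⟩ := Finset.card_eq_two.1 h3
  refine ⟨i, h2 (by simp), k, h2 (by simp), hik, ?_⟩
  intro l hl hlx
  have : l ∈ ({i, k} : Finset ℕ) := h1 (Finset.mem_sdiff.2 ⟨Finset.mem_range.2 (by omega), hlx⟩)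
  simpa using this

end BC
end TVF

namespace TVF
open Topology Filter
variable {P : Type} [PartialOrder P] {d : ℕ} (B : BC P d)
open Equiv

/-- image of a flag under an automorphism -/
def mapFl (γ : P ≃o P) (Φ : Fl P d) : Fl P d :=
  ⟨Φ.1.map γ.toEquiv.toEmbedding, by
    rw [Finset.coe_map]
    rintro _ ⟨x, hx, rfl⟩ _ ⟨y, hy, rfl⟩ hne
    rcases Φ.2.1.total hx hy with h | h
    · exact Or.inl (γ.monotone h)
    · exact Or.inr (γ.monotone h), by rw [Finset.card_map, Φ.2.2]⟩

theorem mem_mapFl {γ : P ≃o P} {Φ : Fl P d} {F : P} (h : F ∈ Φ.1) : γ F ∈ (mapFl γ Φ).1 :=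
  Finset.mem_map_of_mem _ h

/-- orbit relation -/
def O (Φ Ψ : Fl P d) : Prop := ∃ γ : P ≃o P, mapFl γ Φ = Ψ

theorem O.symm {Φ Ψ : Fl P d} (h : O Φ Ψ) : O Ψ Φ := by
  obtain ⟨γ, rfl⟩ := h
  refine ⟨γ.symm, Subtype.ext ?_⟩
  ext F
  simp [mapFl]

theorem O.trans {Φ Ψ Ω : Fl P d} (h : O Φ Ψ) (h' : O Ψ Ω) : O Φ Ω := by
  obtain ⟨γ, rfl⟩ := h
  obtain ⟨δ, rfl⟩ := h'
  refine ⟨γ.trans δ, Subtype.ext ?_⟩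
  ext F
  simp [mapFl]

theorem O.refl (Φ : Fl P d) : O Φ Φ := ⟨OrderIso.refl P, Subtype.ext (by ext F; simp [mapFl])⟩

namespace BC

theorem rk_map (γ : P ≃o P) (F : P) : B.rk (γ F) = B.rk F := by
  obtain ⟨D, hD, hF, hc⟩ := B.exists_flag (D := {F}) (by simp) (by simp)
  let Φ : Fl P d := ⟨D, hD, hc⟩
  have hlo : ∀ i ≤ d, i ≤ B.rk (γ (B.el Φ i)) := by
    intro i
    induction i with
    | zero => intro _; exact Nat.zero_le _
    | succ i ih =>
      intro hi
      have h1 := B.rk_strictMono (γ.strictMono (B.el_lt Φ (Nat.lt_succ_self i) hi))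
      have := ih (by omega)
      simp only [Nat.succ_eq_add_one] at h1
      omega
  have hhi : ∀ m i, i + m = d → B.rk (γ (B.el Φ i)) ≤ i := by
    intro m
    induction m with
    | zero => intro i hi; have := B.rk_le (γ (B.el Φ i)); omega
    | succ m ih =>
      intro i hi
      have h1 := B.rk_strictMono (γ.strictMono (B.el_lt Φ (Nat.lt_succ_self i) (by omega)))
      have := ih (i + 1) (by omega)
      simp only [Nat.succ_eq_add_one] at h1
      omega
  have hFe : F = B.el Φ (B.rk F) := B.eq_el Φ (hF (by simp)) rfl
  have h1 := hlo (B.rk F) (B.rk_le F)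
  have h2 := hhi (d - B.rk F) (B.rk F) (by have := B.rk_le F; omega)
  rw [← hFe] at h1 h2
  omega

theorem el_map (γ : P ≃o P) (Φ : Fl P d) {i : ℕ} (hi : i ≤ d) :
    B.el (mapFl γ Φ) i = γ (B.el Φ i) :=
  (B.eq_el _ (mem_mapFl (B.el_mem Φ i)) (by rw [B.rk_map, B.rk_el Φ hi])).symm

theorem sg_map (hd : 1 ≤ d) (γ : P ≃o P) (Φ : Fl P d) (i : ℕ) :
    B.sg i (mapFl γ Φ) = mapFl γ (B.sg i Φ) := by
  by_cases hi : i ≤ d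
  · refine (B.sg_unique hd ?_ ?_).symm
    · intro h
      have := congrArg (fun Ψ => B.el Ψ i) h
      simp only [B.el_map γ _ hi] at this
      exact B.el_sg_ne hd hi Φ (γ.injective this)
    · intro k hk hki
      rw [B.el_map γ _ hk, B.el_map γ _ hk, B.el_sg i Φ hk hki]
  · rw [B.sg_of_lt (by omega), B.sg_of_lt (by omega)]

theorem gconn (hd : 1 ≤ d) (p : Fl P d → Prop) (h : ∀ Φ, ∀ i ≤ d, p Φ → p (B.sg i Φ))
    {Φ Φ' : Fl P d} (hp : p Φ) : p Φ' := by
  have hcell : ∀ Φ : Fl P d, ∃ x ∈ (Set.univ : Set (EucSp d)), B.C x = Φ.1 := fun Φ => by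
    obtain ⟨x, hx⟩ := B.exists_cell Φ.2.1 (Finset.card_pos.1 (by rw [Φ.2.2]; omega))
    exact ⟨x, Set.mem_univ _, hx⟩
  exact B.conn isOpen_univ convex_univ p
    (fun x _ _ Ψ hΨ Ψ' hΨ' => B.sconn hd x p (fun Φ _ i hi _ => h Φ i hi) hΨ hΨ')
    (hcell Φ) (hcell Φ') hp

/-- a self map of flags commuting with adjacencies -/
def Equi (f : Fl P d → Fl P d) : Prop := ∀ i ≤ d, ∀ Φ, f (B.sg i Φ) = B.sg i (f Φ)

theorem equi_wd (hd : 1 ≤ d) {f : Fl P d → Fl P d} (hf : B.Equi f) {F : P} {Φ Φ' : Fl P d}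
    (h : F ∈ Φ.1) (h' : F ∈ Φ'.1) : B.el (f Φ) (B.rk F) = B.el (f Φ') (B.rk F) := by
  obtain ⟨x, hx⟩ := B.exists_cell (D := {F}) (by simp) (by simp)
  have hr : B.rks x = {B.rk F} := by simp [rks, hx]
  refine B.sconn hd x (fun Ψ => B.el (f Φ) (B.rk F) = B.el (f Ψ) (B.rk F)) ?_
    (show B.C x ⊆ Φ.1 by rw [hx]; simpa using h) (show B.C x ⊆ Φ'.1 by rw [hx]; simpa using h') rfl
  intro Ψ _ i hi hix e
  rw [hr, Finset.mem_singleton] at hix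
  rw [e, hf i hi, B.el_sg i _ (B.rk_le F) (fun e => hix e.symm)]

theorem exists_flag_mem (B : BC P d) (F : P) : ∃ Φ : Fl P d, F ∈ Φ.1 := by
  obtain ⟨D, hD, hF, hc⟩ := B.exists_flag (D := {F}) (by simp) (by simp)
  exact ⟨⟨D, hD, hc⟩, hF (by simp)⟩

/-- induced map on faces -/
noncomputable def pm (f : Fl P d → Fl P d) (F : P) : P :=
  B.el (f (B.exists_flag_mem F).choose) (B.rk F)

theorem pm_eq (hd : 1 ≤ d) {f : Fl P d → Fl P d} (hf : B.Equi f) {F : P} {Φ : Fl P d}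
    (h : F ∈ Φ.1) : B.pm f F = B.el (f Φ) (B.rk F) :=
  B.equi_wd hd hf (B.exists_flag_mem F).choose_spec h

theorem rk_pm (f : Fl P d → Fl P d) (F : P) : B.rk (B.pm f F) = B.rk F :=
  B.rk_el _ (B.rk_le F)

theorem pm_mono (hd : 1 ≤ d) {f : Fl P d → Fl P d} (hf : B.Equi f) : Monotone (B.pm f) := by
  intro F G hFG
  rcases hFG.eq_or_lt with rfl | hlt
  · exact le_rfl
  · obtain ⟨D, hD, hFG, hc⟩ := B.exists_flag (D := {F, G})
      (by rw [Finset.coe_pair]; exact IsChain.pair hlt.le) (by simp)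
    let Φ : Fl P d := ⟨D, hD, hc⟩
    rw [B.pm_eq hd hf (Φ := Φ) (hFG (by simp)), B.pm_eq hd hf (Φ := Φ) (hFG (by simp))]
    exact (B.el_lt _ (B.rk_strictMono hlt) (B.rk_le G)).le

theorem pm_pm (hd : 1 ≤ d) {f f' : Fl P d → Fl P d} (hf : B.Equi f) (hf' : B.Equi f')
    (h : ∀ Φ, f' (f Φ) = Φ) (F : P) : B.pm f' (B.pm f F) = F := by
  obtain ⟨Φ, hΦ⟩ := B.exists_flag_mem F
  rw [B.pm_eq hd hf' (Φ := f Φ) (by rw [B.pm_eq hd hf hΦ]; exact B.el_mem _ _), B.rk_pm, h]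
  exact (B.eq_el Φ hΦ rfl).symm

theorem O_of_equi (hd : 1 ≤ d) {f f' : Fl P d → Fl P d} (hf : B.Equi f) (hf' : B.Equi f')
    {Φ Ψ : Fl P d} (h : f Φ = Ψ) (h' : f' Ψ = Φ) : O Φ Ψ := by
  have e1 : ∀ Ω, f' (f Ω) = Ω := fun Ω =>
    B.gconn hd (fun Ω => f' (f Ω) = Ω) (fun Ω i hi e => by rw [hf i hi, hf' i hi, e])
      (Φ := Φ) (by rw [h, h'])
  have e2 : ∀ Ω, f (f' Ω) = Ω := fun Ω =>
    B.gconn hd (fun Ω => f (f' Ω) = Ω) (fun Ω i hi e => by rw [hf' i hi, hf i hi, e])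
      (Φ := Ψ) (by rw [h', h])
  let γ : P ≃o P :=
    { toFun := B.pm f
      invFun := B.pm f'
      left_inv := B.pm_pm hd hf hf' e1
      right_inv := B.pm_pm hd hf' hf e2
      map_rel_iff' := by
        intro F G
        refine ⟨fun hFG => ?_, fun hFG => B.pm_mono hd hf hFG⟩
        have := B.pm_mono hd hf' hFG
        simp only [Equiv.coe_fn_mk] at this
        rwa [B.pm_pm hd hf hf' e1, B.pm_pm hd hf hf' e1] at this }
  refine ⟨γ, B.fl_ext fun i hi => ?_⟩
  rw [B.el_map γ _ hi, ← h]
  change B.pm f (B.el Φ i) = _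
  rw [B.pm_eq hd hf (B.el_mem Φ i), B.rk_el Φ hi]

/-- period condition -/
def per (hd : 1 ≤ d) (i k : ℕ) (n : ℤ) (Φ : Fl P d) : Prop := ((B.sp hd i * B.sp hd k) ^ n) Φ = Φ

theorem equi_ex (hd : 1 ≤ d) (hper : ∀ i ≤ d, ∀ k ≤ d, i ≠ k → ∀ n Φ Ψ, B.per hd i k n Φ → B.per hd i k n Ψ)
    (Φ0 Ψ0 : Fl P d) : ∃ f : Fl P d → Fl P d, B.Equi f ∧ f Φ0 = Ψ0 := by
  let ρ : ℕ → Fl P d → Fl P d → Fl P d := fun i _ v => B.sg i v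
  have hρ : ∀ i Φ v, ρ i (B.sg i Φ) (ρ i Φ v) = v := fun i _ v => B.sg_sg hd i v
  obtain ⟨x0, hx0⟩ := B.exists_cell Φ0.2.1 (Finset.card_pos.1 (by rw [Φ0.2.2]; omega))
  obtain ⟨f, h1, h2⟩ := B.machine (ρ := ρ) hd isOpen_univ convex_univ (by
    intro x _ hxc Φ hΦ v
    obtain ⟨i, hi, k, hk, hik, hM⟩ := B.missing x hxc (Finset.range (d + 1))
      (fun l hl hl' => (hl' (Finset.mem_range.2 (by omega))).elim) (by simp; omega)
    rw [Finset.mem_range] at hi hk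
    refine B.hex_of hd ρ hρ (i := i) (k := k) (by omega) (by omega) hM hΦ v ?_
    intro n hn
    have hsnd : ∀ (n : ℕ) q, (((B.lp hd ρ hρ i * B.lp hd ρ hρ k) ^ n) q).2 =
        ((B.sp hd i * B.sp hd k) ^ n) q.2 := by
      intro n
      induction n with
      | zero => intro q; simp
      | succ n ih => intro q; rw [pow_succ, pow_succ, Perm.mul_apply, ih]; rfl
    have hsnd' : ∀ (n : ℤ) q, (((B.lp hd ρ hρ i * B.lp hd ρ hρ k) ^ n) q).2 =
        ((B.sp hd i * B.sp hd k) ^ n) q.2 := by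
      intro n q
      cases n with
      | ofNat n => simpa using hsnd n q
      | negSucc n =>
        rw [zpow_negSucc, zpow_negSucc, Perm.eq_inv_iff_eq, ← hsnd, ← Perm.mul_apply,
          mul_inv_cancel, Perm.one_apply]
    refine Prod.ext ?_ ?_
    · rw [covers_zpow (covers_mul (s := B.sp hd i) (t := B.sp hd k) (fun _ => rfl) (fun _ => rfl))]
      exact hn
    · rw [hsnd']
      exact hper i (by omega) k (by omega) hik n Φ v hn) Φ0 ⟨x0, Set.mem_univ _, hx0⟩ Ψ0
  refine ⟨f, ?_, h1⟩
  intro i hi Φ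
  have hc : (Φ.1.erase (B.el Φ i)).card = d := by
    rw [Finset.card_erase_of_mem (B.el_mem Φ i), Φ.2.2]; rfl
  obtain ⟨x, hx⟩ := B.exists_cell (D := Φ.1.erase (B.el Φ i))
    (Φ.2.1.mono (by intro p hp; exact Finset.mem_of_mem_erase hp)) (Finset.card_pos.1 (by omega))
  have hΦ : Φ ∈ B.S x := by change B.C x ⊆ _; rw [hx]; exact Finset.erase_subset _ _
  refine h2 x (Set.mem_univ _) (by rw [hx]; omega) Φ hΦ _ (B.sg_mem_S hΦ ?_) i hi rfl
  intro hir
  obtain ⟨p, hp, hpr⟩ := Finset.mem_image.1 hir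
  rw [hx, Finset.mem_erase] at hp
  exact hp.1 (B.eq_el Φ hp.2 hpr)

theorem per_comm (hd : 1 ≤ d) {i k : ℕ} {n : ℤ} {π : Perm (Fl P d)}
    (h : π * (B.sp hd i * B.sp hd k) = (B.sp hd i * B.sp hd k) * π) (Φ : Fl P d)
    (hp : B.per hd i k n Φ) : B.per hd i k n (π Φ) := by
  have h1 : Commute π (B.sp hd i * B.sp hd k) := h
  have h2 := (h1.zpow_right n).eq
  unfold per at hp ⊢
  rw [← Perm.mul_apply, ← h2, Perm.mul_apply, hp]

theorem per_inv (hd : 1 ≤ d) {i k : ℕ} {n : ℤ} {π : Perm (Fl P d)}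
    (h : π * (B.sp hd i * B.sp hd k) = (B.sp hd i * B.sp hd k)⁻¹ * π) (Φ : Fl P d)
    (hp : B.per hd i k n Φ) : B.per hd i k n (π Φ) := by
  have h1 : SemiconjBy π (B.sp hd i * B.sp hd k) (B.sp hd i * B.sp hd k)⁻¹ := h
  have h2 := (h1.zpow_right n).eq
  unfold per at hp ⊢
  have h3 : ((B.sp hd i * B.sp hd k)⁻¹ ^ n) (π Φ) = π Φ := by
    rw [← Perm.mul_apply, ← h2, Perm.mul_apply, hp]
  rw [inv_zpow, Perm.inv_eq_iff_eq] at h3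
  exact h3.symm

theorem per_map (hd : 1 ≤ d) {i k : ℕ} {n : ℤ} (γ : P ≃o P) (Φ : Fl P d)
    (hp : B.per hd i k n Φ) : B.per hd i k n (mapFl γ Φ) := by
  have hnat : ∀ (n : ℕ) Φ, ((B.sp hd i * B.sp hd k) ^ n) (mapFl γ Φ) =
      mapFl γ (((B.sp hd i * B.sp hd k) ^ n) Φ) := by
    intro n
    induction n with
    | zero => intro Φ; simp
    | succ n ih =>
      intro Φ
      rw [pow_succ, Perm.mul_apply, Perm.mul_apply, Perm.mul_apply, sp_apply, sp_apply, B.sg_map hd,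
        B.sg_map hd, ih]; rfl
  have hintr : ∀ (n : ℤ) Φ, ((B.sp hd i * B.sp hd k) ^ n) (mapFl γ Φ) =
      mapFl γ (((B.sp hd i * B.sp hd k) ^ n) Φ) := by
    intro n Φ
    cases n with
    | ofNat n => simpa using hnat n Φ
    | negSucc n =>
      rw [zpow_negSucc, Perm.inv_eq_iff_eq, hnat, ← Perm.mul_apply, mul_inv_cancel, Perm.one_apply]
  unfold per at hp ⊢
  rw [hintr, hp]

theorem per_O (hd : 1 ≤ d) {i k : ℕ} {n : ℤ} {Φ Ψ : Fl P d} (h : O Φ Ψ) (hp : B.per hd i k n Φ) :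
    B.per hd i k n Ψ := by
  obtain ⟨γ, rfl⟩ := h
  exact B.per_map hd γ Φ hp

theorem sp_comm (hd : 1 ≤ d) {i k : ℕ} (h : i + 2 ≤ k ∨ k + 2 ≤ i) :
    B.sp hd i * B.sp hd k = B.sp hd k * B.sp hd i := by
  ext1 Φ
  rw [Perm.mul_apply, Perm.mul_apply]
  rcases h with h | h
  · exact B.sg_comm hd h Φ
  · exact (B.sg_comm hd h Φ).symm

/-- the two-orbit hypotheses -/
structure TO (I : Set ℕ) : Prop where
  ex : ∃ Φ Ψ : Fl P d, ¬ O Φ Ψ ∧ ∀ Ω, O Ω Φ ∨ O Ω Ψ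
  cls : ∀ Φ : Fl P d, ∀ i ≤ d, O Φ (B.sg i Φ) ↔ i ∈ I

variable {B}

theorem TO.two {I : Set ℕ} (h : B.TO I) {Φ Ψ : Fl P d} (hn : ¬ O Φ Ψ) (Ω : Fl P d) : O Φ Ω ∨ O Ψ Ω := by
  obtain ⟨Φ0, Ψ0, h0, h1⟩ := h.ex
  rcases h1 Φ with a | a <;> rcases h1 Ψ with b | b <;> rcases h1 Ω with c | c
  · exact Or.inl (a.trans c.symm)
  · exact (hn (a.trans b.symm)).elim
  · exact Or.inl (a.trans c.symm)
  · exact Or.inr (b.trans c.symm)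
  · exact Or.inr (b.trans c.symm)
  · exact Or.inl (a.trans c.symm)
  · exact (hn (a.trans b.symm)).elim
  · exact (hn (a.trans b.symm)).elim

theorem TO.per_all (hd : 1 ≤ d) {I : Set ℕ} (h : B.TO I) {i k l : ℕ} (hl : l ≤ d) (hlI : l ∉ I)
    (hinv : ∀ n Φ, B.per hd i k n Φ → B.per hd i k n (B.sg l Φ)) (n : ℤ) (Φ Ψ : Fl P d)
    (hp : B.per hd i k n Φ) : B.per hd i k n Ψ := by
  have hn : ¬ O Φ (B.sg l Φ) := fun h' => hlI ((h.cls Φ l hl).1 h')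
  rcases h.two hn Ψ with a | a
  · exact B.per_O hd a hp
  · exact B.per_O hd a (hinv n Φ hp)

theorem per_far (hd : 1 ≤ d) {i k : ℕ} (hi : i ≤ d) (hk : k ≤ d) (h : i + 2 ≤ k) (n : ℤ)
    (Φ Ψ : Fl P d) (hp : B.per hd i k n Φ) : B.per hd i k n Ψ := by
  have hsq : (B.sp hd i * B.sp hd k) ^ (2 : ℤ) = 1 := by
    rw [zpow_two]
    calc B.sp hd i * B.sp hd k * (B.sp hd i * B.sp hd k)
        = B.sp hd i * B.sp hd k * (B.sp hd k * B.sp hd i) := by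
          congr 1; exact B.sp_comm hd (Or.inl h)
      _ = 1 := by
          rw [mul_assoc, ← mul_assoc (B.sp hd k), B.sp_mul_self, one_mul, B.sp_mul_self]
  unfold per at hp ⊢
  rcases Int.even_or_odd' n with ⟨m, rfl | rfl⟩
  · rw [zpow_mul, hsq, one_zpow, Perm.one_apply]
  · exfalso
    rw [zpow_add_one, zpow_mul, hsq, one_zpow, one_mul, Perm.mul_apply, sp_apply, sp_apply] at hp
    have := congrArg (fun Ψ => B.el Ψ k) hp
    rw [B.el_sg i _ hk (by omega)] at this
    exact B.el_sg_ne hd hk Φ this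

theorem TO.caseB (hd : 1 ≤ d) {I : Set ℕ} (h : B.TO I)
    (hI : ∀ i, i + 1 ≤ d → ∃ l ≤ d, l ∉ I ∧ (l = i ∨ l = i + 1 ∨ l + 2 ≤ i ∨ i + 3 ≤ l)) : False := by
  have hlt : ∀ i k, i < k → k ≤ d → ∀ n Φ Ψ, B.per hd i k n Φ → B.per hd i k n Ψ := by
    intro i k hik hk n Φ Ψ hp
    by_cases hk' : i + 2 ≤ k
    · exact per_far hd (by omega) hk hk' n Φ Ψ hp
    obtain rfl : k = i + 1 := by omega
    obtain ⟨l, hl, hlI, hc⟩ := hI i hk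
    refine h.per_all hd hl hlI ?_ n Φ Ψ hp
    intro n Φ hp
    have hinv : (B.sp hd i * B.sp hd (i + 1))⁻¹ = B.sp hd (i + 1) * B.sp hd i := by
      rw [mul_inv_rev, mul_self_inv (B.sp_mul_self hd _), mul_self_inv (B.sp_mul_self hd _)]
    rcases hc with rfl | rfl | hc | hc
    · refine B.per_inv hd (π := B.sp hd l) ?_ Φ hp
      rw [hinv, ← mul_assoc, B.sp_mul_self, one_mul, mul_assoc, B.sp_mul_self, mul_one]
    · refine B.per_inv hd (π := B.sp hd (i + 1)) ?_ Φ hp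
      rw [hinv, ← mul_assoc]
    · refine B.per_comm hd (π := B.sp hd l) ?_ Φ hp
      rw [← mul_assoc, B.sp_comm hd (i := l) (k := i) (by omega), mul_assoc,
        B.sp_comm hd (i := l) (k := i + 1) (by omega), mul_assoc]
    · refine B.per_comm hd (π := B.sp hd l) ?_ Φ hp
      rw [← mul_assoc, B.sp_comm hd (i := l) (k := i) (by omega), mul_assoc,
        B.sp_comm hd (i := l) (k := i + 1) (by omega), mul_assoc]
  have hswap : ∀ i k n Φ, B.per hd i k n Φ → B.per hd k i n Φ := by
    intro i k n Φ hp
    unfold per at hp ⊢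
    have : B.sp hd k * B.sp hd i = (B.sp hd i * B.sp hd k)⁻¹ := by
      rw [mul_inv_rev, mul_self_inv (B.sp_mul_self hd _), mul_self_inv (B.sp_mul_self hd _)]
    rw [this, inv_zpow, Perm.inv_eq_iff_eq]
    exact hp.symm
  have hall : ∀ i ≤ d, ∀ k ≤ d, i ≠ k → ∀ n Φ Ψ, B.per hd i k n Φ → B.per hd i k n Ψ := by
    intro i hi k hk hik n Φ Ψ hp
    rcases lt_or_gt_of_ne hik with h1 | h1
    · exact hlt i k h1 hk n Φ Ψ hp
    · exact hswap _ _ _ _ (hlt k i h1 hi n Φ Ψ (hswap _ _ _ _ hp))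
  obtain ⟨Φ0, Ψ0, h0, -⟩ := h.ex
  obtain ⟨f, hf, hf0⟩ := B.equi_ex hd hall Φ0 Ψ0
  obtain ⟨f', hf', hf0'⟩ := B.equi_ex hd hall Ψ0 Φ0
  exact h0 (B.O_of_equi hd hf hf' hf0 hf0')

end BC
end TVF

namespace TVF
open Topology Filter
open Equiv

section comb
variable {X : Type}

/-- equivalence relation generated by two permutations -/
def cs (s t : Perm X) : Setoid X where
  r x y := ∃ h ∈ Subgroup.closure {s, t}, h x = y
  iseqv :=
    { refl := fun x => ⟨1, Subgroup.one_mem _, rfl⟩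
      symm := by
        rintro x y ⟨h, hh, rfl⟩
        exact ⟨h⁻¹, Subgroup.inv_mem _ hh, by rw [← Perm.mul_apply, inv_mul_cancel, Perm.one_apply]⟩
      trans := by
        rintro x y z ⟨h, hh, rfl⟩ ⟨h', hh', rfl⟩
        exact ⟨h' * h, Subgroup.mul_mem _ hh' hh, rfl⟩ }

theorem cs_inv {Y : Type} {s t : Perm X} {f : X → Y} (hs : ∀ x, f (s x) = f x) (ht : ∀ x, f (t x) = f x)
    {x y : X} (h : (cs s t).r x y) : f x = f y := by
  obtain ⟨h, hh, rfl⟩ := h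
  have key : ∀ x, f (h x) = f x := by
    induction hh using Subgroup.closure_induction with
    | mem g hg =>
      rcases hg with rfl | hg
      · exact hs
      · rw [Set.mem_singleton_iff] at hg; subst hg; exact ht
    | one => intro x; rfl
    | mul g g' _ _ h1 h2 => intro x; rw [Perm.mul_apply, h1, h2]
    | inv g _ h1 =>
      intro x
      rw [← h1 (g⁻¹ x), ← Perm.mul_apply, mul_inv_cancel, Perm.one_apply]
  exact (key x).symm

variable [Fintype X]

theorem cs_big {s t : Perm X} (hs : s * s = 1) (ht : t * t = 1)
    (fs : ∀ x, s x ≠ x) (ft : ∀ x, t x ≠ x)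
    (hev : ∀ (n : ℤ) x, ((s * t) ^ n) x = x → Even n) (h2 : ∀ x, ((s * t) ^ (2 : ℤ)) x ≠ x) :
    8 * Fintype.card (Quotient (cs s t)) ≤ Fintype.card X := by
  have hsm : s ∈ Subgroup.closure {s, t} := Subgroup.subset_closure (by simp)
  have htm : t ∈ Subgroup.closure {s, t} := Subgroup.subset_closure (by simp)
  have hinj : ∀ (k l : ℕ) x, k < 4 → l < 4 → ((s * t) ^ (k : ℤ)) x = ((s * t) ^ (l : ℤ)) x → k = l := by
    intro k l x hk hl h
    have key : ∀ k l : ℕ, ((s * t) ^ (k : ℤ)) x = ((s * t) ^ (l : ℤ)) x →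
        ((s * t) ^ ((k : ℤ) - l)) x = x := by
      intro k l h
      rw [sub_eq_neg_add, zpow_add, Perm.mul_apply, h, ← Perm.mul_apply, ← zpow_add]
      simp
    have h1 := key k l h
    have h3 := key l k h.symm
    obtain ⟨m, hm⟩ := hev _ _ h1
    have : (k : ℤ) - l ≠ 2 := fun e => h2 x (by rw [e] at h1; exact h1)
    have : (l : ℤ) - k ≠ 2 := fun e => h2 x (by rw [e] at h3; exact h3)
    omega
  have himg : Finset.univ.image (Quotient.mk (cs s t)) = Finset.univ :=
    Finset.image_univ_of_surjective Quotient.mk_surjective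
  have := Finset.mul_card_image_le_card (s := (Finset.univ : Finset X)) (f := Quotient.mk (cs s t)) (n := 8) ?_
  · rw [himg] at this
    simpa using this
  · intro q _
    obtain ⟨x, rfl⟩ := Quotient.mk_surjective q
    let g : Fin 4 × Bool → X := fun p => ((s * t) ^ ((p.1 : ℕ) : ℤ)) (if p.2 then s x else x)
    have gi : Function.Injective g := by
      have mix : ∀ k l : ℕ, ((s * t) ^ (k : ℤ)) (s x) ≠ ((s * t) ^ (l : ℤ)) x := by
        intro k l h
        refine dih_nofix hs ht fs ft ((k : ℤ) - l) x ?_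
        rw [sub_eq_neg_add, zpow_add, Perm.mul_apply, Perm.mul_apply, h, ← Perm.mul_apply, ← zpow_add]
        simp
      rintro ⟨k, a⟩ ⟨l, b⟩ h
      cases a <;> cases b <;> simp only [g, if_true] at h
      · exact Prod.ext (Fin.ext (hinj _ _ _ k.2 l.2 (by simpa using h))) rfl
      · exact (mix _ _ (by simpa using h.symm)).elim
      · exact (mix _ _ (by simpa using h)).elim
      · exact Prod.ext (Fin.ext (hinj _ _ _ k.2 l.2 (by simpa using h))) rfl
    calc 8 = (Finset.univ.image g).card := by
          rw [Finset.card_image_of_injective _ gi]; simp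
      _ ≤ _ := by
          apply Finset.card_le_card
          intro y hy
          obtain ⟨⟨k, a⟩, -, rfl⟩ := Finset.mem_image.1 hy
          simp only [Finset.mem_filter, Finset.mem_univ, true_and]
          refine Quotient.sound ((cs s t).symm' ?_)
          have hp : (s * t) ^ ((k : ℕ) : ℤ) ∈ Subgroup.closure {s, t} :=
            Subgroup.zpow_mem _ (Subgroup.mul_mem _ hsm htm) _
          cases a
          · exact ⟨_, hp, by simp [g]⟩
          · exact ⟨_, Subgroup.mul_mem _ hp hsm, by simp [g]⟩

theorem cs_small {s t : Perm X} (hs : s * s = 1) (ht : t * t = 1) (hc : s * t = t * s) :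
    Fintype.card X ≤ 4 * Fintype.card (Quotient (cs s t)) := by
  have himg : Finset.univ.image (Quotient.mk (cs s t)) = Finset.univ :=
    Finset.image_univ_of_surjective Quotient.mk_surjective
  have hsq : (s * t) ^ (2 : ℤ) = 1 := by
    rw [zpow_two]
    calc s * t * (s * t) = s * t * (t * s) := by rw [hc]
      _ = 1 := by rw [mul_assoc, ← mul_assoc t, ht, one_mul, hs]
  have := Finset.card_le_mul_card_image (s := (Finset.univ : Finset X)) (f := Quotient.mk (cs s t)) 4 ?_
  · rw [himg] at this
    simpa using this
  · intro q _
    obtain ⟨x, rfl⟩ := Quotient.mk_surjective q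
    calc _ ≤ ({x, (s * t) x, s x, (s * t) (s x)} : Finset X).card := by
          apply Finset.card_le_card
          intro y hy
          simp only [Finset.mem_filter, Finset.mem_univ, true_and] at hy
          obtain ⟨h, hh, rfl⟩ := (cs s t).symm' (Quotient.exact hy)
          obtain ⟨n, rfl | rfl⟩ := dih_mem hs ht hh
          · rcases Int.even_or_odd' n with ⟨m, rfl | rfl⟩
            · rw [zpow_mul, hsq, one_zpow]; simp
            · rw [zpow_add_one, zpow_mul, hsq, one_zpow]; simp
          · rcases Int.even_or_odd' n with ⟨m, rfl | rfl⟩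
            · rw [zpow_mul, hsq, one_zpow]; simp
            · rw [zpow_add_one, zpow_mul, hsq, one_zpow]; simp
      _ ≤ 4 := Finset.card_le_four

theorem z2a : ∀ u v : ZMod 2, u + v + u = v := by decide
theorem z2b : (1 : ZMod 2) + 1 = 0 := by decide

theorem euler [Nonempty X] {a b c : Perm X}
    (ha : a * a = 1) (hb : b * b = 1) (hc : c * c = 1) (hac : a * c = c * a)
    (fa : ∀ x, a x ≠ x) (fb : ∀ x, b x ≠ x) (fc : ∀ x, c x ≠ x)
    (hab : ∀ (n : ℤ) x, ((a * b) ^ n) x = x → Even n) (hab2 : ∀ x, ((a * b) ^ (2 : ℤ)) x ≠ x)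
    (hbc : ∀ (n : ℤ) x, ((b * c) ^ n) x = x → Even n) (hbc2 : ∀ x, ((b * c) ^ (2 : ℤ)) x ≠ x)
    (H : ∀ e : X → ZMod 2, (∀ x, e (a x) = e x) → (∀ x, e (c x) = e x) →
      (∀ q : Quotient (cs b c),
        ∑ k ∈ Finset.range (Function.minimalPeriod (b * c) q.out), e (((b * c) ^ k) q.out) = 0) →
      ∃ f : X → ZMod 2, (∀ x, f (a x) = f x) ∧ (∀ x, f (b x) = f x) ∧ ∀ x, f (c x) = f x + e x) :
    False := by
  have h1 := cs_big ha hb fa fb hab hab2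
  have h2 := cs_big hb hc fb fc hbc hbc2
  have h3 := cs_small ha hc hac
  have : Fact (Nat.Prime 2) := ⟨Nat.prime_two⟩
  let V := Quotient (cs a b)
  let F := Quotient (cs b c)
  let E := Quotient (cs a c)
  let del : (V → ZMod 2) →ₗ[ZMod 2] (E → ZMod 2) :=
    { toFun := fun f q => f ⟦c q.out⟧ + f ⟦q.out⟧
      map_add' := by intro f g; ext q; simp only [Pi.add_apply]; ring
      map_smul' := by intro r f; ext q; simp [mul_add] }
  let bd : (E → ZMod 2) →ₗ[ZMod 2] (F → ZMod 2) :=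
    { toFun := fun e q => ∑ k ∈ Finset.range (Function.minimalPeriod (b * c) q.out),
        e ⟦((b * c) ^ k) q.out⟧
      map_add' := by intro f g; ext q; simp [Finset.sum_add_distrib]
      map_smul' := by intro r f; ext q; simp [Finset.mul_sum] }
  have hsub : LinearMap.ker bd ≤ LinearMap.range del := by
    intro e he
    have he' : bd e = 0 := he
    have e1 : ∀ x, (⟦a x⟧ : E) = ⟦x⟧ := fun x => Quotient.sound ((cs a c).symm'
      ⟨a, Subgroup.subset_closure (by simp), rfl⟩)
    have e2 : ∀ x, (⟦c x⟧ : E) = ⟦x⟧ := fun x => Quotient.sound ((cs a c).symm'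
      ⟨c, Subgroup.subset_closure (by simp), rfl⟩)
    obtain ⟨f, f1, f2, f3⟩ := H (fun x => e ⟦x⟧) (fun x => by rw [e1]) (fun x => by rw [e2])
      (fun q => congrFun he' q)
    refine ⟨fun q => f q.out, ?_⟩
    have hf : ∀ x, f (Quotient.out (⟦x⟧ : V)) = f x := fun x => cs_inv f1 f2 (Quotient.mk_out x)
    ext q
    change f (Quotient.out (⟦c q.out⟧ : V)) + f (Quotient.out (⟦q.out⟧ : V)) = e q
    rw [hf, hf, f3, Quotient.out_eq]
    exact z2a _ _
  have k1 := LinearMap.finrank_range_add_finrank_ker del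
  have k2 := LinearMap.finrank_range_add_finrank_ker bd
  have k3 := Submodule.finrank_mono hsub
  have k4 := Submodule.finrank_le (LinearMap.range bd)
  have k5 : 0 < Module.finrank (ZMod 2) (LinearMap.ker del) := by
    have hm : (fun _ => 1 : V → ZMod 2) ∈ LinearMap.ker del := by
      rw [LinearMap.mem_ker]
      ext q
      exact z2b
    have hne : (⟨_, hm⟩ : LinearMap.ker del) ≠ 0 := by
      intro h
      have h' := congrFun (congrArg Subtype.val h) ⟦Classical.arbitrary X⟧
      exact one_ne_zero (α := ZMod 2) h'
    have := nontrivial_of_ne _ _ hne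
    exact Module.finrank_pos
  rw [Module.finrank_fintype_fun_eq_card] at k1 k2 k4
  have : Fintype.card X ≤ 4 * Fintype.card E := h3
  have : 8 * Fintype.card V ≤ Fintype.card X := h1
  have : 8 * Fintype.card F ≤ Fintype.card X := h2
  omega

end comb
end TVF

namespace TVF
open Topology Filter
open Equiv

theorem dih_conj' {G : Type*} [Group G] {s t : G} (hs : s * s = 1) (ht : t * t = 1) (n : ℤ) :
    t * (s * t) ^ n = (s * t) ^ (-n) * t := by
  have h := dih_conj ht hs (-n)
  have e : t * s = (s * t)⁻¹ := by rw [mul_inv_rev, mul_self_inv hs, mul_self_inv ht]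
  rw [e, inv_zpow, inv_zpow, zpow_neg, inv_inv, ← zpow_neg, neg_neg] at h
  rw [h, zpow_neg]

theorem semi_zpow {X Y : Type*} {π : Perm X} {σ : Perm Y} {φ : X → Y} (h : ∀ x, φ (π x) = σ (φ x))
    (n : ℤ) (x : X) : φ ((π ^ n) x) = (σ ^ n) (φ x) := by
  have hnat : ∀ (n : ℕ) x, φ ((π ^ n) x) = (σ ^ n) (φ x) := by
    intro n
    induction n with
    | zero => intro x; simp
    | succ n ih => intro x; rw [pow_succ, pow_succ, Perm.mul_apply, Perm.mul_apply, ih, h]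
  cases n with
  | ofNat n => simpa using hnat n x
  | negSucc n =>
    rw [zpow_negSucc, zpow_negSucc, Perm.eq_inv_iff_eq, ← hnat, ← Perm.mul_apply, mul_inv_cancel,
      Perm.one_apply]

/-- holonomy triviality is invariant along dihedral orbits -/
theorem hol_inv {X Y : Type} {s t : Perm X} {a b : Perm (X × Y)} (hs : s * s = 1) (ht : t * t = 1)
    (ha : a * a = 1) (hb : b * b = 1)
    (ca : ∀ q, (a q).1 = s q.1) (cb : ∀ q, (b q).1 = t q.1) {x y : X} (hxy : (cs s t).r x y)
    (hx : ∀ (v : Y) (n : ℤ), ((s * t) ^ n) x = x → ((a * b) ^ n) (x, v) = (x, v)) (v : Y) (n : ℤ)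
    (hn : ((s * t) ^ n) y = y) : ((a * b) ^ n) (y, v) = (y, v) := by
  let p : X → Prop := fun x => ∀ (v : Y) (n : ℤ), ((s * t) ^ n) x = x → ((a * b) ^ n) (x, v) = (x, v)
  have key : ∀ {r : Perm X} {c : Perm (X × Y)}, r * r = 1 → c * c = 1 → (∀ q, (c q).1 = r q.1) →
      (∀ n : ℤ, r * (s * t) ^ n = (s * t) ^ (-n) * r) →
      (∀ n : ℤ, c * (a * b) ^ n = (a * b) ^ (-n) * c) → ∀ x, p x → p (r x) := by
    intro r c hr hc hcr h1 h2 x hp v n hn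
    have e1 : ((s * t) ^ (-n)) x = x := by
      have := h1 (-n)
      rw [neg_neg] at this
      have h3 : r (((s * t) ^ (-n)) x) = r x := by
        rw [← Perm.mul_apply, this, Perm.mul_apply, hn]
      exact r.injective h3
    set w := (c (r x, v)).2
    have e0 : c (r x, v) = (x, w) := by
      refine Prod.ext ?_ rfl
      rw [hcr]; simp only
      rw [← Perm.mul_apply, hr, Perm.one_apply]
    have e2 := hp w (-n) e1
    have e3 : c (x, w) = (r x, v) := by rw [← e0, ← Perm.mul_apply, hc, Perm.one_apply]
    rw [← e3, ← Perm.mul_apply]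
    have := h2 (-n)
    rw [neg_neg] at this
    rw [← this, Perm.mul_apply, e2]
  have k1 := key hs ha ca (dih_conj hs ht) (dih_conj ha hb)
  have k2 := key ht hb cb (dih_conj' hs ht) (dih_conj' ha hb)
  have := cs_inv (f := p) (s := s) (t := t)
    (fun x => propext ⟨fun h => by
      have := k1 _ h; rwa [← Perm.mul_apply, hs, Perm.one_apply] at this, k1 x⟩)
    (fun x => propext ⟨fun h => by
      have := k2 _ h; rwa [← Perm.mul_apply, ht, Perm.one_apply] at this, k2 x⟩) hxy
  have hy : p y := this ▸ hx
  exact hy v n hn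

variable {P : Type} [PartialOrder P] {d : ℕ} (B : BC P d)
namespace BC

theorem H1 (hd : 1 ≤ d) (x0 : EucSp d) {m : ℕ} (hm : m + 2 ≤ d)
    (hr : ∀ l ≤ d, l ∉ B.rks x0 → l = m ∨ l = m + 1 ∨ l = m + 2)
    (e : Fl P d → ZMod 2) (ea : ∀ Φ, e (B.sg m Φ) = e Φ) (ec : ∀ Φ, e (B.sg (m + 2) Φ) = e Φ)
    (hrep : ∀ Φ ∈ B.S x0, ∃ Ψ, (cs (B.sp hd (m + 1)) (B.sp hd (m + 2))).r Ψ Φ ∧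
      ∑ k ∈ Finset.range (Function.minimalPeriod (B.sp hd (m + 1) * B.sp hd (m + 2)) Ψ),
        e (((B.sp hd (m + 1) * B.sp hd (m + 2)) ^ k) Ψ) = 0) :
    ∃ f : Fl P d → ZMod 2, ∀ Φ ∈ B.S x0, ∀ i ≤ d, i ∉ B.rks x0 →
      f (B.sg i Φ) = if i = m + 2 then f Φ + e Φ else f Φ := by
  let ρ : ℕ → Fl P d → ZMod 2 → ZMod 2 := fun i Φ v => if i = m + 2 then v + e Φ else v
  have hρ : ∀ i Φ v, ρ i (B.sg i Φ) (ρ i Φ v) = v := by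
    intro i Φ v
    simp only [ρ]
    split_ifs with h
    · subst h
      rw [ec]
      have : ∀ u v : ZMod 2, u + v + v = u := by decide
      exact this _ _
    · rfl
  obtain ⟨r, hr0, hball⟩ := Metric.mem_nhds_iff.1 (B.star x0)
  have hsub : ∀ x ∈ Metric.ball x0 r, B.rks x0 ⊆ B.rks x := fun x hx =>
    Finset.image_subset_image (hball hx)
  obtain ⟨Φ0, hΦ0⟩ := B.S_nonempty x0
  have hba : Metric.ball x0 r ∈ 𝓝 x0 := Metric.ball_mem_nhds x0 hr0
  obtain ⟨y0, hy0, hy0'⟩ := B.near Φ0.2.1 hΦ0 hba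
  obtain ⟨f, -, hf⟩ := B.machine (ρ := ρ) hd Metric.isOpen_ball (convex_ball x0 r) (by
    intro x hx hxc Φ hΦ v
    have hΦ0 : Φ ∈ B.S x0 := Finset.Subset.trans (show B.C x0 ⊆ B.C x from hball hx) hΦ
    obtain ⟨i, hi, k, hk, hik, hM⟩ := B.missing x hxc {m, m + 1, m + 2} (by
      intro l hl hlM
      simp only [Finset.mem_insert, Finset.mem_singleton] at hlM
      by_contra hc
      exact hlM (hr l hl (fun h => hc (hsub x hx h)))) (by
        rw [Finset.card_insert_of_notMem (by simp), Finset.card_insert_of_notMem (by simp)]; simp)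
    simp only [Finset.mem_insert, Finset.mem_singleton] at hi hk
    have hcases : (∀ l ≤ d, l ∉ B.rks x → l = m ∨ l = m + 1) ∨ (∀ l ≤ d, l ∉ B.rks x → l = m + 1 ∨ l = m + 2)
        ∨ (∀ l ≤ d, l ∉ B.rks x → l = m ∨ l = m + 2) := by
      rcases hi with rfl | rfl | rfl <;> rcases hk with rfl | rfl | rfl <;>
        first
        | exact (hik rfl).elim
        | exact Or.inl fun l h1 h2 => by have := hM l h1 h2; omega
        | exact Or.inr (Or.inl fun l h1 h2 => by have := hM l h1 h2; omega)
        | exact Or.inr (Or.inr fun l h1 h2 => by have := hM l h1 h2; omega)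
    rcases hcases with hM | hM | hM
    · refine B.hex_of hd ρ hρ (i := m) (k := m + 1) (by omega) (by omega) hM hΦ v ?_
      intro n hn
      refine Prod.ext ?_ ?_
      · rw [covers_zpow (covers_mul (s := B.sp hd m) (t := B.sp hd (m + 1)) (fun _ => rfl) (fun _ => rfl))]
        exact hn
      · have := semi_zpow (π := B.lp hd ρ hρ m * B.lp hd ρ hρ (m + 1)) (σ := 1)
          (φ := fun q : Fl P d × ZMod 2 => q.2) (by
            intro q
            rw [Perm.mul_apply, lp_apply, lp_apply]
            simp [ρ]) n (Φ, v)
        rw [this]; simp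
    · refine B.hex_of hd ρ hρ (i := m + 1) (k := m + 2) (by omega) (by omega) hM hΦ v ?_
      obtain ⟨Ψ, hΨ, hsum⟩ := hrep Φ hΦ0
      refine hol_inv (B.sp_mul_self hd _) (B.sp_mul_self hd _) (B.lp_mul_self hd ρ hρ _)
        (B.lp_mul_self hd ρ hρ _) (fun _ => rfl) (fun _ => rfl) hΨ ?_ v
      intro v n hn
      set σ := B.sp hd (m + 1) * B.sp hd (m + 2) with hσ
      set L := B.lp hd ρ hρ (m + 1) * B.lp hd ρ hρ (m + 2) with hL
      have hLn : ∀ n : ℕ, (L ^ n) (Ψ, v) = ((σ ^ n) Ψ, v + ∑ k ∈ Finset.range n, e ((σ ^ k) Ψ)) := by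
        intro n
        induction n with
        | zero => simp
        | succ n ih =>
          rw [pow_succ', Perm.mul_apply, ih, pow_succ' σ, Perm.mul_apply, lp_apply,
            lp_apply, Finset.sum_range_succ]
          simp [ρ, hσ, add_assoc]
      have hdvd : ((Function.minimalPeriod σ Ψ : ℕ) : ℤ) ∣ n := by
        have := MulAction.zpow_smul_eq_iff_minimalPeriod_dvd (a := σ) (b := Ψ) (n := n)
        exact this.1 hn
      have hp : (L ^ (Function.minimalPeriod σ Ψ)) (Ψ, v) = (Ψ, v) := by
        rw [hLn, hsum, add_zero]
        congr 1
        have := Function.iterate_minimalPeriod (f := σ) (x := Ψ)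
        rwa [← Perm.coe_pow] at this
      obtain ⟨k, rfl⟩ := hdvd
      rw [zpow_mul, zpow_natCast]
      exact Perm.zpow_apply_eq_self_of_apply_eq_self hp k
    · refine B.hex_of hd ρ hρ (i := m) (k := m + 2) (by omega) (by omega) hM hΦ v ?_
      intro n hn
      have hsq : (B.lp hd ρ hρ m * B.lp hd ρ hρ (m + 2)) ^ (2 : ℤ) = 1 := by
        have hc : B.lp hd ρ hρ m * B.lp hd ρ hρ (m + 2) = B.lp hd ρ hρ (m + 2) * B.lp hd ρ hρ m := by
          ext1 q
          rw [Perm.mul_apply, Perm.mul_apply, lp_apply, lp_apply, lp_apply, lp_apply]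
          refine Prod.ext (B.sg_comm hd le_rfl q.1) ?_
          simp [ρ, ea]
        rw [zpow_two]
        calc _ = B.lp hd ρ hρ m * B.lp hd ρ hρ (m + 2) * (B.lp hd ρ hρ (m + 2) * B.lp hd ρ hρ m) := by
              rw [← hc]
          _ = 1 := by
            rw [mul_assoc, ← mul_assoc (B.lp hd ρ hρ (m + 2)), B.lp_mul_self, one_mul, B.lp_mul_self]
      rcases Int.even_or_odd' n with ⟨k, rfl | rfl⟩
      · rw [zpow_mul, hsq, one_zpow, Perm.one_apply]
      · exfalso
        have hsq' : (B.sp hd m * B.sp hd (m + 2)) ^ (2 : ℤ) = 1 := by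
          rw [zpow_two]
          calc _ = B.sp hd m * B.sp hd (m + 2) * (B.sp hd (m + 2) * B.sp hd m) := by
                rw [← B.sp_comm hd (Or.inl le_rfl)]
            _ = 1 := by
              rw [mul_assoc, ← mul_assoc (B.sp hd (m + 2)), B.sp_mul_self, one_mul, B.sp_mul_self]
        rw [zpow_add_one, zpow_mul, hsq', one_zpow, one_mul, Perm.mul_apply, sp_apply, sp_apply] at hn
        have := congrArg (fun Ψ => B.el Ψ (m + 2)) hn
        rw [B.el_sg m _ hm (by omega)] at this
        exact B.el_sg_ne hd hm Φ this) Φ0 ⟨y0, hy0, hy0'⟩ 0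
  refine ⟨f, ?_⟩
  intro Φ hΦ i hi hir
  have hc : (Φ.1.erase (B.el Φ i)).card = d := by
    rw [Finset.card_erase_of_mem (B.el_mem Φ i), Φ.2.2]; rfl
  obtain ⟨x, hxU, hx⟩ := B.near (D := Φ.1.erase (B.el Φ i))
    (Φ.2.1.mono (by intro p hp; exact Finset.mem_of_mem_erase hp)) (x := x0) (by
      intro p hp
      refine Finset.mem_erase.2 ⟨?_, hΦ hp⟩
      intro h
      exact hir (Finset.mem_image.2 ⟨p, hp, by rw [h, B.rk_el Φ hi]⟩)) hba
  have hΦ : Φ ∈ B.S x := by change B.C x ⊆ _; rw [hx]; exact Finset.erase_subset _ _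
  refine hf x hxU (by rw [hx]; omega) Φ hΦ _ (B.sg_mem_S hΦ ?_) i hi rfl
  intro hir
  obtain ⟨p, hp, hpr⟩ := Finset.mem_image.1 hir
  rw [hx, Finset.mem_erase] at hp
  exact hp.1 (B.eq_el Φ hp.2 hpr)

end BC
end TVF

namespace TVF
open Topology Filter
open Equiv

theorem even_of_flip {X : Type*} {π : Perm X} {φ : X → Bool} (h : ∀ x, φ (π x) = !φ x) (n : ℤ) (x : X)
    (hn : (π ^ n) x = x) : Even n := by
  have h1 := semi_zpow (σ := Equiv.boolNot) (φ := φ) h n x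
  rw [hn] at h1
  have hsq : (Equiv.boolNot : Perm Bool) ^ (2 : ℤ) = 1 := by
    rw [zpow_two]; ext b; simp
  rcases Int.even_or_odd' n with ⟨m, rfl | rfl⟩
  · simp
  · rw [zpow_add_one, zpow_mul, hsq, one_zpow, one_mul] at h1
    simp at h1

variable {P : Type} [PartialOrder P] {d : ℕ} (B : BC P d)
namespace BC

theorem sg_sq_ne (hd : 1 ≤ d) {i : ℕ} (hi : i + 1 ≤ d) (Φ : Fl P d) :
    B.sg i (B.sg (i + 1) Φ) ≠ B.sg (i + 1) (B.sg i Φ) := by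
  intro h
  set Ψ := B.sg i (B.sg (i + 1) Φ) with hΨ
  have e1 : B.el Ψ (i + 1) = B.el (B.sg (i + 1) Φ) (i + 1) := B.el_sg i _ hi (by omega)
  have e2 : B.el Ψ i = B.el (B.sg i Φ) i := by rw [h]; exact B.el_sg (i + 1) _ (by omega) (by omega)
  have l0 := B.el_lt Φ (Nat.lt_succ_self i) hi
  have l1 := B.el_lt (B.sg (i + 1) Φ) (Nat.lt_succ_self i) hi
  have l2 := B.el_lt (B.sg i Φ) (Nat.lt_succ_self i) hi
  have l3 := B.el_lt Ψ (Nat.lt_succ_self i) hi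
  simp only [Nat.succ_eq_add_one] at l0 l1 l2 l3
  rw [B.el_sg (i + 1) _ (by omega) (by omega)] at l1
  rw [B.el_sg i _ hi (by omega)] at l2
  rw [e1, e2] at l3
  refine B.nodigon (B.el Φ (i + 1)) (B.el (B.sg (i + 1) Φ) (i + 1)) (B.el Φ i) (B.el (B.sg i Φ) i)
    (B.el_sg_ne hd hi Φ).symm (B.el_sg_ne hd (by omega) Φ).symm ?_ ?_ ?_ l0 l1 l2 l3
  · rw [B.rk_el _ hi, B.rk_el _ hi]
  · rw [B.rk_el _ (by omega), B.rk_el _ (by omega)]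
  · rw [B.rk_el _ (by omega), B.rk_el _ (by omega)]

theorem sp_sq_ne (hd : 1 ≤ d) {i : ℕ} (hi : i + 1 ≤ d) (Φ : Fl P d) :
    ((B.sp hd i * B.sp hd (i + 1)) ^ (2 : ℤ)) Φ ≠ Φ := by
  intro h
  rw [zpow_two] at h
  simp only [Perm.mul_apply, sp_apply] at h
  refine B.sg_sq_ne hd hi Φ ?_
  have h1 := congrArg (fun Ψ => B.sg (i + 1) (B.sg i Ψ)) h
  simp only [B.sg_sg hd] at h1
  exact h1

theorem finite_S (x : EucSp d) : (B.S x).Finite := by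
  obtain ⟨F, hF⟩ := B.C_nonempty x
  have hfin := B.fin_comp F
  refine Set.Finite.of_finite_image (f := Subtype.val) ?_ Subtype.val_injective.injOn
  refine (Finset.finite_toSet hfin.toFinset.powerset).subset ?_
  rintro _ ⟨Φ, hΦ, rfl⟩
  rw [Finset.mem_coe, Finset.mem_powerset]
  intro G hG
  rw [Set.Finite.mem_toFinset]
  exact Φ.2.1.total hG (hΦ hF)

variable {B}

theorem TO.caseA (hd3 : 3 ≤ d) {I : Set ℕ} (h : B.TO I) {m : ℕ} (hm : m + 2 ≤ d) (h0 : m ∈ I)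
    (h1 : m + 1 ∉ I) (h2 : m + 2 ∈ I) : False := by
  have hd : 1 ≤ d := by omega
  obtain ⟨Φ1, -, -, -⟩ := h.ex
  let D : Finset P := Φ1.1.filter (fun F => B.rk F ≠ m ∧ B.rk F ≠ m + 1 ∧ B.rk F ≠ m + 2)
  have hDmem : ∀ l ≤ d, l ≠ m ∧ l ≠ m + 1 ∧ l ≠ m + 2 → B.el Φ1 l ∈ D := by
    intro l hl hlm
    refine Finset.mem_filter.2 ⟨B.el_mem Φ1 l, ?_⟩
    rw [B.rk_el Φ1 hl]; exact hlm
  have hDne : D.Nonempty := by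
    rcases Nat.eq_zero_or_pos m with rfl | hm0
    · exact ⟨_, hDmem 3 hd3 (by omega)⟩
    · exact ⟨_, hDmem 0 (by omega) (by omega)⟩
  have hDc : IsChain (· ≤ ·) (D : Set P) :=
    Φ1.2.1.mono (by intro p hp; exact (Finset.mem_filter.1 hp).1)
  obtain ⟨x0, hx0⟩ := B.exists_cell hDc hDne
  have hr : ∀ l ≤ d, (l ∉ B.rks x0 ↔ (l = m ∨ l = m + 1 ∨ l = m + 2)) := by
    intro l hl
    constructor
    · intro hl'
      by_contra hc
      push Not at hc
      exact hl' (Finset.mem_image.2 ⟨_, by rw [hx0]; exact hDmem l hl hc, B.rk_el Φ1 hl⟩)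
    · intro hlm hl'
      obtain ⟨p, hp, rfl⟩ := Finset.mem_image.1 hl'
      rw [hx0] at hp
      have := (Finset.mem_filter.1 hp).2
      omega
  let X := {Φ : Fl P d // Φ ∈ B.S x0}
  have hX : Finite X := (B.finite_S x0).to_subtype
  let _ : Fintype X := Fintype.ofFinite X
  have hXne : Nonempty X := ⟨⟨Φ1, by
    change B.C x0 ⊆ _; rw [hx0]; exact Finset.filter_subset _ _⟩⟩
  have hcl : ∀ i, (i = m ∨ i = m + 1 ∨ i = m + 2) → ∀ Φ, (B.sp hd i Φ ∈ B.S x0 ↔ Φ ∈ B.S x0) := by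
    intro i hi Φ
    have hi' : i ∉ B.rks x0 := (hr i (by omega)).2 hi
    refine ⟨fun hh => ?_, fun hh => B.sg_mem_S hh hi'⟩
    have := B.sg_mem_S hh hi'
    rwa [sp_apply, B.sg_sg hd] at this
  let pp : ∀ i, (i = m ∨ i = m + 1 ∨ i = m + 2) → Perm X := fun i hi => (B.sp hd i).subtypePerm (hcl i hi)
  have ppv : ∀ i hi (x : X), (pp i hi x).1 = B.sg i x.1 := fun i hi x => rfl
  have ppsq : ∀ i hi, pp i hi * pp i hi = 1 := by
    intro i hi; ext1 x; exact Subtype.ext (B.sg_sg hd i x.1)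
  have ppf : ∀ i hi x, pp i hi x ≠ x := by
    intro i hi x e
    exact B.sg_ne hd (i := i) (by omega) x.1 (congrArg Subtype.val e)
  have ppz : ∀ i hi k hk (n : ℤ) (x : X), (((pp i hi * pp k hk) ^ n) x).1 =
      ((B.sp hd i * B.sp hd k) ^ n) x.1 := fun i hi k hk n x =>
    semi_zpow (φ := Subtype.val) (fun x => rfl) n x
  let φ : Fl P d → Bool := fun Φ => decide (O Φ1 Φ)
  have hφ0 : ∀ i ≤ d, i ∈ I → ∀ Φ, φ (B.sg i Φ) = φ Φ := by
    intro i hi hiI Φ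
    have := (h.cls Φ i hi).2 hiI
    simp only [φ, decide_eq_decide]
    exact ⟨fun hh => hh.trans this.symm, fun hh => hh.trans this⟩
  have hφ1 : ∀ i ≤ d, i ∉ I → ∀ Φ, φ (B.sg i Φ) = !φ Φ := by
    intro i hi hiI Φ
    have hn : ¬ O Φ (B.sg i Φ) := fun hh => hiI ((h.cls Φ i hi).1 hh)
    have h3 := h.two hn Φ1
    simp only [φ]
    rw [← decide_not, decide_eq_decide]
    constructor
    · intro hh h4
      exact hn (h4.symm.trans hh)
    · intro h4
      rcases h3 with h3 | h3
      · exact (h4 h3.symm).elim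
      · exact h3.symm
  have ia : m = m ∨ m = m + 1 ∨ m = m + 2 := by omega
  have ib : m + 1 = m ∨ m + 1 = m + 1 ∨ m + 1 = m + 2 := by omega
  have ic : m + 2 = m ∨ m + 2 = m + 1 ∨ m + 2 = m + 2 := by omega
  refine euler (X := X) (a := pp m ia) (b := pp (m + 1) ib) (c := pp (m + 2) ic) (ppsq _ ia) (ppsq _ ib)
    (ppsq _ ic) ?_ (ppf _ ia) (ppf _ ib) (ppf _ ic) ?_ ?_ ?_ ?_ ?_
  · ext1 x
    exact Subtype.ext (B.sg_comm hd le_rfl x.1)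
  · intro n x hn
    refine even_of_flip (φ := fun x : X => φ x.1) ?_ n x hn
    intro x
    change φ (B.sg m (B.sg (m + 1) x.1)) = _
    rw [hφ0 _ (by omega) h0, hφ1 _ (by omega) h1]
  · intro x hx
    exact B.sp_sq_ne hd (i := m) (by omega) x.1 (by rw [← ppz m ia (m + 1) ib, hx])
  · intro n x hn
    refine even_of_flip (φ := fun x : X => φ x.1) ?_ n x hn
    intro x
    change φ (B.sg (m + 1) (B.sg (m + 2) x.1)) = _
    rw [hφ1 _ (by omega) h1, hφ0 _ (by omega) h2]
  · intro x hx
    exact B.sp_sq_ne hd (i := m + 1) (by omega) x.1 (by rw [← ppz (m + 1) ib (m + 2) ic, hx])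
  · intro e ea ec hsum
    let e' : Fl P d → ZMod 2 := fun Φ => if hΦ : Φ ∈ B.S x0 then e ⟨Φ, hΦ⟩ else 0
    have he' : ∀ x : X, e' x.1 = e x := fun x => dif_pos x.2
    have hinv : ∀ i (hi : i = m ∨ i = m + 1 ∨ i = m + 2), (∀ x, e (pp i hi x) = e x) →
        ∀ Φ, e' (B.sg i Φ) = e' Φ := by
      intro i hi hh Φ
      by_cases hΦ : Φ ∈ B.S x0
      · have h3 := hh ⟨Φ, hΦ⟩
        rw [← he', ← he'] at h3
        exact h3
      · have : B.sg i Φ ∉ B.S x0 := fun h4 => hΦ ((hcl i hi Φ).1 h4)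
        simp only [e']
        rw [dif_neg hΦ, dif_neg this]
    obtain ⟨f, hf⟩ := B.H1 hd x0 hm (fun l hl => (hr l hl).1) e' (hinv m ia ea) (hinv (m + 2) ic ec) (by
      intro Φ hΦ
      let q : Quotient (cs (pp (m + 1) ib) (pp (m + 2) ic)) := ⟦⟨Φ, hΦ⟩⟧
      refine ⟨q.out.1, ?_, ?_⟩
      · have hq : (cs (pp (m + 1) ib) (pp (m + 2) ic)).r q.out ⟨Φ, hΦ⟩ := Quotient.mk_out _
        have := cs_inv (f := fun x : X => (⟦x.1⟧ : Quotient (cs (B.sp hd (m + 1)) (B.sp hd (m + 2)))))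
          (by
            intro x
            exact Quotient.sound ((cs _ _).symm' ⟨_, Subgroup.subset_closure (by simp), rfl⟩))
          (by
            intro x
            exact Quotient.sound ((cs _ _).symm' ⟨B.sp hd (m + 2), Subgroup.subset_closure (by simp), rfl⟩)) hq
        exact Quotient.exact this
      · have h3 := hsum q
        have hz : ∀ k : ℕ, (((pp (m + 1) ib * pp (m + 2) ic) ^ k) q.out).1 =
            ((B.sp hd (m + 1) * B.sp hd (m + 2)) ^ k) q.out.1 := by
          intro k
          have := ppz (m + 1) ib (m + 2) ic k q.out
          rwa [zpow_natCast, zpow_natCast] at this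
        have hper : Function.minimalPeriod (B.sp hd (m + 1) * B.sp hd (m + 2)) q.out.1 =
            Function.minimalPeriod (pp (m + 1) ib * pp (m + 2) ic) q.out := by
          refine Function.minimalPeriod_eq_minimalPeriod_iff.2 fun n => ?_
          unfold Function.IsPeriodicPt Function.IsFixedPt
          rw [← Perm.coe_pow, ← Perm.coe_pow, ← hz, Subtype.ext_iff]
        rw [hper, ← h3]
        refine Finset.sum_congr rfl fun k _ => ?_
        rw [← hz, he'])
    refine ⟨fun x => f x.1, ?_, ?_, ?_⟩
    · intro x
      have := hf x.1 x.2 m (by omega) ((hr m (by omega)).2 ia)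
      rw [if_neg (by omega)] at this
      exact this
    · intro x
      have := hf x.1 x.2 (m + 1) (by omega) ((hr (m + 1) (by omega)).2 ib)
      rw [if_neg (by omega)] at this
      exact this
    · intro x
      have := hf x.1 x.2 (m + 2) (by omega) ((hr (m + 2) (by omega)).2 ic)
      rw [if_pos rfl, he'] at this
      exact this

theorem TO.main {I : Set ℕ} (h : B.TO I) {j : ℕ} (hj0 : 0 < j) (hjd : j < d) (hj : j ∉ I) : False := by
  have hd : 1 ≤ d := by omega
  by_cases hc : 3 ≤ d ∧ j - 1 ∈ I ∧ j + 1 ∈ I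
  · obtain ⟨m, rfl⟩ : ∃ m, j = m + 1 := ⟨j - 1, by omega⟩
    exact h.caseA hc.1 (by omega) hc.2.1 hj hc.2.2
  · refine h.caseB hd ?_
    intro i hi
    by_cases h1 : j = i ∨ j = i + 1 ∨ j + 2 ≤ i ∨ i + 3 ≤ j
    · exact ⟨j, by omega, hj, h1⟩
    · have h3 : 3 ≤ d := by omega
      by_cases h4 : j - 1 ∈ I
      · have h5 : j + 1 ∉ I := fun h5 => hc ⟨h3, h4, h5⟩
        exact ⟨j + 1, by omega, h5, by omega⟩
      · exact ⟨j - 1, by omega, h4, by omega⟩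

end BC
end TVF

namespace TVF
open Topology Filter

section Geo
variable {d : ℕ}

theorem ext_or {F : Set (EucSp d)} (hF : Convex ℝ F) {x : EucSp d} (hx : x ∈ F) :
    (∀ y ∈ F, ∃ ε : ℝ, 0 < ε ∧ x + ε • (x - y) ∈ F) ∨
    ∃ l : StrongDual ℝ (EucSp d), (∀ z ∈ F, l z ≤ l x) ∧ ∃ z ∈ F, l z < l x := by
  obtain ⟨c, hc⟩ := Set.Nonempty.intrinsicInterior hF ⟨x, hx⟩
  obtain ⟨c', hc', rfl⟩ := mem_intrinsicInterior.1 hc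
  rw [mem_interior_iff_mem_nhds, Metric.mem_nhds_iff] at hc'
  obtain ⟨r, hr, hball⟩ := hc'
  have hball' : ∀ z : EucSp d, z ∈ affineSpan ℝ F → dist z c' < r → z ∈ F := by
    intro z hz hd
    exact hball (show (⟨z, hz⟩ : affineSpan ℝ F) ∈ Metric.ball c' r from hd)
  set c : EucSp d := (c' : EucSp d) with hcdef
  have hcA : c ∈ affineSpan ℝ F := c'.2
  have hcF : c ∈ F := hball' c hcA (by simpa using hr)
  have hA : ∀ z ∈ F, z ∈ affineSpan ℝ F := fun z hz => subset_affineSpan ℝ F hz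
  set W := (affineSpan ℝ F).direction with hW
  have hsub : ∀ y ∈ F, ∀ z ∈ F, y - z ∈ W := fun y hy z hz =>
    AffineSubspace.vsub_mem_direction (hA y hy) (hA z hz)
  have hfix : ∀ w ∈ W, W.starProjection w = w := fun w hw =>
    Submodule.starProjection_eq_self_iff.2 hw
  set F' : Set (EucSp d) := {z | x + W.starProjection (z - x) ∈ F} with hF'
  have hFF' : ∀ z ∈ F, z ∈ F' := by
    intro z hz
    show x + W.starProjection (z - x) ∈ F
    rw [hfix _ (hsub z hz x hx)]
    simpa using hz
  have hconv : Convex ℝ F' := by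
    intro y hy z hz a b ha hb hab
    show x + W.starProjection (a • y + b • z - x) ∈ F
    have h1 : a • y + b • z - x = a • (y - x) + b • (z - x) := by
      have : x = (a + b) • x := by rw [hab, one_smul]
      nth_rw 1 [this]
      module
    have h2 : x + W.starProjection (a • y + b • z - x) =
        a • (x + W.starProjection (y - x)) + b • (x + W.starProjection (z - x)) := by
      rw [h1, map_add, map_smul, map_smul]
      have : x = (a + b) • x := by rw [hab, one_smul]
      nth_rw 1 [this]
      module
    rw [h2]
    exact hF hy hz ha hb hab
  have hcball : Metric.ball c r ⊆ F' := by
    intro z hz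
    show x + W.starProjection (z - x) ∈ F
    have h1 : x + W.starProjection (z - x) = c + W.starProjection (z - c) := by
      have : z - x = (z - c) + (c - x) := by abel
      rw [this, map_add, hfix _ (hsub c hcF x hx)]
      abel
    rw [h1]
    refine hball' _ ?_ ?_
    · rw [add_comm]
      exact AffineSubspace.vadd_mem_of_mem_direction (Submodule.starProjection_apply_mem W _) hcA
    · rw [dist_eq_norm, add_sub_cancel_left]
      refine lt_of_le_of_lt (Submodule.norm_starProjection_apply_le W _) ?_
      rw [← dist_eq_norm]
      exact hz
  by_cases hxi : x ∈ interior F'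
  · left
    intro y hy
    rw [mem_interior_iff_mem_nhds] at hxi
    have ht : Tendsto (fun ε : ℝ => x + ε • (x - y)) (𝓝[>] 0) (𝓝 x) := by
      have : Tendsto (fun ε : ℝ => x + ε • (x - y)) (𝓝 0) (𝓝 (x + (0:ℝ) • (x - y))) := by
        apply Continuous.tendsto
        fun_prop
      simp only [zero_smul, add_zero] at this
      exact this.mono_left nhdsWithin_le_nhds
    obtain ⟨ε, h1, h2⟩ := ((ht.eventually hxi).and self_mem_nhdsWithin).exists
    refine ⟨ε, h2, ?_⟩
    have h1' : x + W.starProjection (x + ε • (x - y) - x) ∈ F := h1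
    rw [add_sub_cancel_left, map_smul, hfix _ (hsub x hx y hy)] at h1'
    exact h1'
  · right
    obtain ⟨l, hl0, hl⟩ := geometric_hahn_banach_of_nonempty_interior_point hconv hxi
      ⟨c, interior_maximal hcball Metric.isOpen_ball (by simpa using hr)⟩
    refine ⟨l, fun z hz => hl z (hFF' z hz), c, hcF, ?_⟩
    obtain ⟨v, hv⟩ : ∃ v, 0 < l v := by
      by_contra! hcon
      apply hl0
      ext v
      have h1 := hcon v
      have h2 := hcon (-v)
      rw [map_neg] at h2
      simp only [zero_apply]
      linarith
    have ht : Tendsto (fun ε : ℝ => c + ε • v) (𝓝[>] 0) (𝓝 c) := by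
      have : Tendsto (fun ε : ℝ => c + ε • v) (𝓝 0) (𝓝 (c + (0:ℝ) • v)) := by
        apply Continuous.tendsto
        fun_prop
      simp only [zero_smul, add_zero] at this
      exact this.mono_left nhdsWithin_le_nhds
    obtain ⟨ε, h1, h2⟩ := ((ht.eventually (Metric.ball_mem_nhds c hr)).and
      self_mem_nhdsWithin).exists
    have h3 := hl _ (hcball h1)
    rw [map_add, map_smul, smul_eq_mul] at h3
    have : 0 < ε * l v := mul_pos h2 hv
    linarith

/-- In a positive combination lying in an exposed face, all the points lie in that face. -/
theorem wl {ι : Type*} {A F : Set (EucSp d)} (hF : IsExposed ℝ A F) {D : Finset ι} {w : ι → ℝ}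
    {v : ι → EucSp d} (hw : ∀ i ∈ D, 0 < w i) (hv : ∀ i ∈ D, v i ∈ A) (h1 : ∑ i ∈ D, w i = 1)
    (hx : ∑ i ∈ D, w i • v i ∈ F) : ∀ i ∈ D, v i ∈ F := by
  obtain ⟨l, hl⟩ := hF ⟨_, hx⟩
  have hx' := hx
  rw [hl] at hx'
  have hle : ∀ i ∈ D, l (v i) ≤ l (∑ i ∈ D, w i • v i) := fun i hi => hx'.2 _ (hv i hi)
  set m := l (∑ i ∈ D, w i • v i) with hm
  have hs : ∑ i ∈ D, w i * (m - l (v i)) = 0 := by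
    simp only [mul_sub, Finset.sum_sub_distrib]
    rw [← Finset.sum_mul, h1, one_mul, hm, map_sum]
    simp
  have h0 := (Finset.sum_eq_zero_iff_of_nonneg (fun i hi =>
    mul_nonneg (hw i hi).le (sub_nonneg.2 (hle i hi)))).1 hs
  intro i hi
  have h2 : l (v i) = m := by
    rcases mul_eq_zero.1 (h0 i hi) with h | h
    · exact absurd h (hw i hi).ne'
    · linarith
  rw [hl]
  refine ⟨hv i hi, fun y hy => ?_⟩
  rw [h2]
  exact hx'.2 y hy

theorem g1 {A F : Set (EucSp d)} {S : Finset (EucSp d)} (hA : A = convexHull ℝ (S : Set (EucSp d)))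
    (hF : IsExposed ℝ A F) :
    F = convexHull ℝ ((S.filter (· ∈ F) : Finset (EucSp d)) : Set (EucSp d)) := by
  have hAc : Convex ℝ A := hA ▸ convex_convexHull ℝ _
  apply Set.Subset.antisymm
  · intro x hx
    have hxA := hF.subset hx
    rw [hA, Finset.mem_convexHull'] at hxA
    obtain ⟨w, hw, hw1, hwx⟩ := hxA
    have hz : ∀ y ∈ S, y ∉ S.filter (fun y => w y ≠ 0) → w y = 0 := by
      intro y hy h
      by_contra h0
      exact h (Finset.mem_filter.2 ⟨hy, h0⟩)
    have hs1 : ∑ y ∈ S.filter (fun y => w y ≠ 0), w y = 1 := by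
      rw [Finset.sum_subset (Finset.filter_subset _ _) hz, hw1]
    have hs2 : ∑ y ∈ S.filter (fun y => w y ≠ 0), w y • y = x := by
      rw [Finset.sum_subset (Finset.filter_subset _ _), hwx]
      intro y hy h
      rw [hz y hy h, zero_smul]
    have hpos : ∀ y ∈ S.filter (fun y => w y ≠ 0), 0 < w y := by
      intro y hy
      rw [Finset.mem_filter] at hy
      exact lt_of_le_of_ne (hw y hy.1) (Ne.symm hy.2)
    have hin := wl (v := fun y => y) hF hpos (fun y hy => by
      rw [hA]; exact subset_convexHull ℝ _ (Finset.mem_filter.1 hy).1) hs1 (by rw [hs2]; exact hx)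
    rw [← hs2]
    refine (convex_convexHull ℝ _).sum_mem (fun y hy => (hpos y hy).le) hs1 ?_
    intro y hy
    exact subset_convexHull ℝ _ (Finset.mem_coe.2
      (Finset.mem_filter.2 ⟨(Finset.mem_filter.1 hy).1, hin y hy⟩))
  · refine convexHull_min ?_ (hF.convex hAc)
    intro y hy
    exact (Finset.mem_filter.1 (Finset.mem_coe.1 hy)).2

theorem g2 {A F G : Set (EucSp d)} {S : Finset (EucSp d)}
    (hA : A = convexHull ℝ (S : Set (EucSp d)))
    (hF : IsExposed ℝ A F) (hG : IsExposed ℝ F G) : IsExposed ℝ A G := by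
  intro hGne
  have hAc : Convex ℝ A := hA ▸ convex_convexHull ℝ _
  have hGc : Convex ℝ G := hG.convex (hF.convex hAc)
  have hSA : ∀ s ∈ S, s ∈ A := fun s hs => hA ▸ subset_convexHull ℝ _ hs
  obtain ⟨g, hg⟩ := hGne
  have hgF := hG.subset hg
  obtain ⟨l, hl⟩ := hF ⟨g, hgF⟩
  obtain ⟨l', hl'⟩ := hG ⟨g, hg⟩
  have hg1 : ∀ y ∈ A, l y ≤ l g := by
    have := hgF
    rw [hl] at this
    exact this.2
  have hg2 : ∀ y ∈ F, l' y ≤ l' g := by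
    have := hg
    rw [hl'] at this
    exact this.2
  have hF1 : ∀ y ∈ A, l g ≤ l y → y ∈ F := by
    intro y hy h
    rw [hl]
    exact ⟨hy, fun z hz => (hg1 z hz).trans h⟩
  have hF2 : ∀ y ∈ F, l' g ≤ l' y → y ∈ G := by
    intro y hy h
    rw [hl']
    exact ⟨hy, fun z hz => (hg2 z hz).trans h⟩
  obtain ⟨ε, hε, hS⟩ : ∃ ε : ℝ, 0 < ε ∧ ∀ s ∈ S, s ∉ F → ε * (l' s - l' g) < l g - l s := by
    have hev : ∀ᶠ ε : ℝ in 𝓝[>] 0, ∀ s ∈ S, s ∉ F → ε * (l' s - l' g) < l g - l s := by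
      rw [Filter.eventually_all_finset]
      intro s hs
      by_cases hsF : s ∈ F
      · exact Filter.Eventually.of_forall fun _ h => absurd hsF h
      · have h0 : 0 < l g - l s := by
          by_contra! h
          exact hsF (hF1 s (hSA s hs) (by linarith))
        have ht : Tendsto (fun ε : ℝ => ε * (l' s - l' g)) (𝓝[>] 0) (𝓝 0) := by
          have : Tendsto (fun ε : ℝ => ε * (l' s - l' g)) (𝓝 0) (𝓝 (0 * (l' s - l' g))) := by
            apply Continuous.tendsto
            fun_prop
          rw [zero_mul] at this
          exact this.mono_left nhdsWithin_le_nhds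
        filter_upwards [ht.eventually (gt_mem_nhds h0)] with ε hε _
        exact hε
    obtain ⟨ε, h1, h2⟩ := (hev.and self_mem_nhdsWithin).exists
    exact ⟨ε, h2, h1⟩
  set L : StrongDual ℝ (EucSp d) := l + ε • l' with hL
  have hLa : ∀ y, L y = l y + ε * l' y := fun y => by simp [hL]
  have hSL : ∀ s ∈ S, L s ≤ L g := by
    intro s hs
    rw [hLa, hLa]
    by_cases hsF : s ∈ F
    · have h1 := hg1 s (hSA s hs)
      have h2 := mul_le_mul_of_nonneg_left (hg2 s hsF) hε.le
      linarith
    · have := hS s hs hsF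
      nlinarith
  have hAL : ∀ y ∈ A, L y ≤ L g := by
    intro y hy
    have : A ⊆ {y | L y ≤ L g} := by
      rw [hA]
      exact convexHull_min (fun s hs => hSL s hs) (convex_halfSpace_le L.toLinearMap.isLinear _)
    exact this hy
  refine ⟨L, ?_⟩
  apply Set.Subset.antisymm
  · intro x hx
    have hxF := hG.subset hx
    refine ⟨hF.subset hxF, fun y hy => (hAL y hy).trans ?_⟩
    have h1 : l g ≤ l x := by
      rw [hl] at hxF
      exact hxF.2 g (hF.subset hgF)
    have h2 : l' g ≤ l' x := by
      rw [hl'] at hx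
      exact hx.2 g hgF
    rw [hLa, hLa]
    have := mul_le_mul_of_nonneg_left h2 hε.le
    linarith
  · have hexp : IsExposed ℝ A {x ∈ A | ∀ y ∈ A, L y ≤ L x} := fun _ => ⟨L, rfl⟩
    generalize hH : {x ∈ A | ∀ y ∈ A, L y ≤ L x} = H at hexp
    have := g1 hA hexp
    rw [this]
    refine convexHull_min ?_ hGc
    intro s hs
    rw [Finset.mem_coe, Finset.mem_filter] at hs
    rw [← hH] at hs
    obtain ⟨hsS, hsA, hsL⟩ := hs
    have h1 := hsL g (hF.subset hgF)
    rw [hLa, hLa] at h1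
    by_cases hsF : s ∈ F
    · refine hF2 s hsF ?_
      have h2 := hg1 s hsA
      have : ε * l' g ≤ ε * l' s := by linarith
      exact le_of_mul_le_mul_left this hε
    · have := hS s hsS hsF
      nlinarith

theorem faces_finite {A : Set (EucSp d)} {S : Finset (EucSp d)}
    (hA : A = convexHull ℝ (S : Set (EucSp d))) : {F | IsExposed ℝ A F}.Finite := by
  refine Set.Finite.subset ((S.powerset.finite_toSet).image
    (fun Q : Finset (EucSp d) => convexHull ℝ (Q : Set (EucSp d)))) ?_
  intro F hF
  exact ⟨S.filter (· ∈ F), Finset.mem_coe.2 (Finset.mem_powerset.2 (Finset.filter_subset _ _)), (g1 hA hF).symm⟩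

theorem finrank_lt {F G : Set (EucSp d)} (hF : IsExposed ℝ G F) (hne : F.Nonempty) (h : F ≠ G) :
    Module.finrank ℝ (affineSpan ℝ F).direction < Module.finrank ℝ (affineSpan ℝ G).direction := by
  obtain ⟨x, hx⟩ := hne
  obtain ⟨l, hl⟩ := hF ⟨x, hx⟩
  have hsub := hF.subset
  have hx' : ∀ y ∈ G, l y ≤ l x := by
    have := hx
    rw [hl] at this
    exact this.2
  obtain ⟨z, hz, hzF⟩ : ∃ z ∈ G, z ∉ F := by
    by_contra! hcon
    exact h (Set.Subset.antisymm hsub hcon)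
  have hconst : ∀ y ∈ F, l y = l x := by
    intro y hy
    refine le_antisymm (hx' y (hsub hy)) ?_
    rw [hl] at hy
    exact hy.2 x (hsub hx)
  apply Submodule.finrank_lt_finrank_of_lt
  rw [direction_affineSpan, direction_affineSpan]
  refine lt_of_le_of_ne (vectorSpan_mono ℝ hsub) ?_
  intro heq
  have h1 : vectorSpan ℝ F ≤ LinearMap.ker l.toLinearMap := by
    rw [vectorSpan_def, Submodule.span_le]
    rintro _ ⟨a, ha, b, hb, rfl⟩
    simp [hconst a ha, hconst b hb]
  have h2 : z -ᵥ x ∈ vectorSpan ℝ G := vsub_mem_vectorSpan ℝ hz (hsub hx)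
  rw [← heq] at h2
  have h3 := h1 h2
  simp only [vsub_eq_sub, LinearMap.mem_ker, ContinuousLinearMap.coe_coe, map_sub] at h3
  apply hzF
  rw [hl]
  refine ⟨hz, fun y hy => ?_⟩
  have := hx' y hy
  linarith

end Geo
end TVF

namespace TVF
open Topology Filter

section Til
variable {d : ℕ} {T : Set (Set (EucSp d))}

def IsF (T : Set (Set (EucSp d))) (F : Set (EucSp d)) : Prop := ∃ t ∈ T, IsExposed ℝ t F

theorem IsF.of_sub (hT : IsLFCTiling T) {F s : Set (EucSp d)} (hF : IsF T F) (hs : s ∈ T)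
    (h : F ⊆ s) : IsExposed ℝ s F := by
  obtain ⟨t, ht, hF⟩ := hF
  obtain ⟨⟨S, hS⟩, -⟩ := hT.polytope s hs
  exact g2 hS (hT.face_to_face t ht s hs).2
    (hF.mono Set.inter_subset_left (Set.subset_inter hF.subset h))

theorem IsF.inter (hT : IsLFCTiling T) {F G : Set (EucSp d)} (hF : IsF T F) (hG : IsF T G) :
    IsF T (F ∩ G) := by
  obtain ⟨t, ht, hF⟩ := hF
  obtain ⟨s, hs, hG⟩ := hG
  have h1 : IsF T (F ∩ (t ∩ s)) := ⟨t, ht, hF.inter (hT.face_to_face t ht s hs).1⟩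
  have h2 := h1.of_sub hT hs (fun x hx => hx.2.2)
  have h3 := h2.inter hG
  have : F ∩ (t ∩ s) ∩ G = F ∩ G := by
    ext x
    constructor
    · rintro ⟨⟨h, -⟩, h'⟩; exact ⟨h, h'⟩
    · rintro ⟨h, h'⟩; exact ⟨⟨h, hF.subset h, hG.subset h'⟩, h'⟩
  rw [this] at h3
  exact ⟨s, hs, h3⟩

theorem IsF.exposed (hT : IsLFCTiling T) {F G : Set (EucSp d)} (hF : IsF T F) (hG : IsF T G)
    (h : G ⊆ F) : IsExposed ℝ F G := by
  obtain ⟨t, ht, hF⟩ := hF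
  exact (hG.of_sub hT ht (h.trans hF.subset)).mono hF.subset h

theorem IsF.trans (hT : IsLFCTiling T) {F G : Set (EucSp d)} (hF : IsF T F)
    (h : IsExposed ℝ F G) : IsF T G := by
  obtain ⟨t, ht, hF⟩ := hF
  obtain ⟨⟨S, hS⟩, -⟩ := hT.polytope t ht
  exact ⟨t, ht, g2 hS hF h⟩

theorem IsF.hull (hT : IsLFCTiling T) {F : Set (EucSp d)} (hF : IsF T F) :
    ∃ S : Finset (EucSp d), F = convexHull ℝ (S : Set (EucSp d)) := by
  obtain ⟨t, ht, hF⟩ := hF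
  obtain ⟨⟨S, hS⟩, -⟩ := hT.polytope t ht
  exact ⟨_, g1 hS hF⟩

theorem IsF.convex (hT : IsLFCTiling T) {F : Set (EucSp d)} (hF : IsF T F) : Convex ℝ F := by
  obtain ⟨S, rfl⟩ := hF.hull hT
  exact convex_convexHull ℝ _

theorem IsF.compact (hT : IsLFCTiling T) {F : Set (EucSp d)} (hF : IsF T F) : IsCompact F := by
  obtain ⟨S, rfl⟩ := hF.hull hT
  exact S.finite_toSet.isCompact_convexHull ℝ

theorem exists_tile (hT : IsLFCTiling T) (x : EucSp d) : ∃ t ∈ T, x ∈ t := by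
  have : x ∈ ⋃₀ T := by rw [hT.covers]; trivial
  exact this

/-- The carrier of a point: the smallest face containing it. -/
def car (T : Set (Set (EucSp d))) (x : EucSp d) : Set (EucSp d) := ⋂₀ {G | IsF T G ∧ x ∈ G}

theorem mem_car (x : EucSp d) : x ∈ car T x := fun _ hG => hG.2

theorem car_sub {x : EucSp d} {G : Set (EucSp d)} (hG : IsF T G) (hx : x ∈ G) : car T x ⊆ G :=
  fun _ hy => hy G ⟨hG, hx⟩

theorem isF_car (hT : IsLFCTiling T) (x : EucSp d) : IsF T (car T x) := by
  obtain ⟨t, ht, hxt⟩ := exists_tile hT x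
  obtain ⟨⟨S, hS⟩, -⟩ := hT.polytope t ht
  have hfin : {G | IsExposed ℝ t G ∧ x ∈ G}.Finite :=
    (faces_finite hS).subset fun G hG => hG.1
  have hne : hfin.toFinset.Nonempty := ⟨t, by simp [hxt, IsExposed.refl]⟩
  have hexp : IsExposed ℝ t (⋂₀ (hfin.toFinset : Set (Set (EucSp d)))) := by
    refine IsExposed.sInter hne ?_
    intro G hG
    exact ((Set.Finite.mem_toFinset hfin).1 hG).1
  have heq : car T x = ⋂₀ (hfin.toFinset : Set (Set (EucSp d))) := by
    rw [Set.Finite.coe_toFinset]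
    apply Set.Subset.antisymm
    · intro y hy G hG
      exact hy G ⟨⟨t, ht, hG.1⟩, hG.2⟩
    · intro y hy G hG
      have h1 : IsF T (G ∩ t) := hG.1.inter hT ⟨t, ht, IsExposed.refl t⟩
      exact (hy (G ∩ t) ⟨h1.of_sub hT ht Set.inter_subset_right, hG.2, hxt⟩).1
  rw [heq]
  exact ⟨t, ht, hexp⟩

theorem car_ext (hT : IsLFCTiling T) {x y : EucSp d} (hy : y ∈ car T x) :
    ∃ ε : ℝ, 0 < ε ∧ x + ε • (x - y) ∈ car T x := by
  rcases ext_or ((isF_car hT x).convex hT) (mem_car x) with h | ⟨l, hl, z, hz, hlt⟩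
  · exact h y hy
  · exfalso
    have hexp : IsExposed ℝ (car T x) {v ∈ car T x | ∀ u ∈ car T x, l u ≤ l v} :=
      fun _ => ⟨l, rfl⟩
    have h1 := car_sub ((isF_car hT x).trans hT hexp) ⟨mem_car x, hl⟩ hz
    have := h1.2 x (mem_car x)
    linarith

theorem exists_bary (hT : IsLFCTiling T) {F : Set (EucSp d)} (hF : IsF T F) (hne : F.Nonempty) :
    ∃ x ∈ F, car T x = F := by
  obtain ⟨S, hS⟩ := hF.hull hT
  have hSne : S.Nonempty := by
    rw [hS, convexHull_nonempty_iff] at hne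
    exact_mod_cast hne
  have hSF : ∀ s ∈ S, s ∈ F := fun s hs => hS ▸ subset_convexHull ℝ _ hs
  have hpos : (0:ℝ) < S.card := by exact_mod_cast hSne.card_pos
  have hw1 : ∑ s ∈ S, (1 / (S.card : ℝ)) = 1 := by
    rw [Finset.sum_const, nsmul_eq_mul]
    field_simp
  set x : EucSp d := ∑ s ∈ S, (1 / (S.card : ℝ)) • s with hx
  have hxF : x ∈ F := (hF.convex hT).sum_mem (fun _ _ => by positivity) hw1 hSF
  refine ⟨x, hxF, Set.Subset.antisymm (car_sub hF hxF) ?_⟩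
  have hin := wl (w := fun _ => 1 / (S.card : ℝ)) (v := fun s => s)
    (hF.exposed hT (isF_car hT x) (car_sub hF hxF)) (fun _ _ => by positivity) hSF hw1
    (mem_car (T := T) x)
  rw [hS]
  exact convexHull_min hin ((isF_car hT x).convex hT)

/-- The nonempty faces of the tiling. -/
abbrev NF (T : Set (Set (EucSp d))) : Type := {F : TFace T // F.1.Nonempty}

theorem NF.isF (p : NF T) : IsF T p.1.1 := p.1.2

theorem NF.le_iff (p q : NF T) : p ≤ q ↔ p.1.1 ⊆ q.1.1 := Iff.rfl

theorem NF.ext' {p q : NF T} (h : p.1.1 = q.1.1) : p = q := Subtype.ext (Subtype.ext h)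

def NF.mk' {F : Set (EucSp d)} (h : IsF T F) (hne : F.Nonempty) : NF T := ⟨⟨F, h⟩, hne⟩

noncomputable def frk (p : NF T) : ℕ := Module.finrank ℝ (affineSpan ℝ p.1.1).direction

theorem frk_lt (hT : IsLFCTiling T) {p q : NF T} (h : p < q) : frk p < frk q :=
  finrank_lt (q.isF.exposed hT p.isF h.le) p.2 (fun h' => h.ne (NF.ext' h'))

noncomputable def bar (hT : IsLFCTiling T) (p : NF T) : EucSp d :=
  (exists_bary hT p.isF p.2).choose

theorem bar_mem (hT : IsLFCTiling T) (p : NF T) : bar hT p ∈ p.1.1 :=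
  (exists_bary hT p.isF p.2).choose_spec.1

theorem car_bar (hT : IsLFCTiling T) (p : NF T) : car T (bar hT p) = p.1.1 :=
  (exists_bary hT p.isF p.2).choose_spec.2

theorem car_sum (hT : IsLFCTiling T) {D : Finset (NF T)} {w : NF T → ℝ} (hw : ∀ p ∈ D, 0 < w p)
    (h1 : ∑ p ∈ D, w p = 1) {M : NF T} (hM : M ∈ D) (hmax : ∀ p ∈ D, p ≤ M) :
    car T (∑ p ∈ D, w p • bar hT p) = M.1.1 := by
  have hb : ∀ p ∈ D, bar hT p ∈ M.1.1 := fun p hp => hmax p hp (bar_mem hT p)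
  have hx : ∑ p ∈ D, w p • bar hT p ∈ M.1.1 :=
    (M.isF.convex hT).sum_mem (fun p hp => (hw p hp).le) h1 hb
  have hsub := car_sub M.isF hx
  refine Set.Subset.antisymm hsub ?_
  have hin := wl (M.isF.exposed hT (isF_car hT _) hsub) hw hb h1 (mem_car _) M hM
  have := car_sub (isF_car hT _) hin
  rwa [car_bar] at this

theorem chain_max {D : Finset (NF T)} (hD : IsChain (· ≤ ·) (D : Set (NF T))) (hne : D.Nonempty) :
    ∃ M ∈ D, ∀ p ∈ D, p ≤ M := by
  obtain ⟨M, hM⟩ := D.exists_maximal hne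
  refine ⟨M, hM.1, fun p hp => ?_⟩
  by_cases h : p = M
  · exact h.le
  · rcases hD hp hM.1 h with h' | h'
    · exact h'
    · exact hM.2 hp h'

theorem exit_pt (hT : IsLFCTiling T) {x c : EucSp d} (hc : c ∈ car T x) (hne : x ≠ c)
    : ∃ τ : ℝ, 1 < τ ∧ c + τ • (x - c) ∈ car T x ∧
      car T (c + τ • (x - c)) ≠ car T x := by
  set K : Set ℝ := {τ | 1 ≤ τ ∧ c + τ • (x - c) ∈ car T x} with hK
  have hcomp := (isF_car hT x).compact hT
  have hclosed : IsClosed K := by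
    apply IsClosed.inter (isClosed_Ici (a := (1:ℝ)))
    exact hcomp.isClosed.preimage (by fun_prop : Continuous fun τ : ℝ => c + τ • (x - c))
  have hbd : Bornology.IsBounded K := by
    obtain ⟨R, hR⟩ := hcomp.isBounded.exists_norm_le
    have hpos : 0 < ‖x - c‖ := norm_pos_iff.2 (sub_ne_zero.2 hne)
    rw [isBounded_iff_forall_norm_le]
    refine ⟨(R + ‖c‖) / ‖x - c‖, fun τ hτ => ?_⟩
    rw [le_div_iff₀ hpos, ← norm_smul]
    have h1 := hR _ hτ.2
    have h2 : τ • (x - c) = (c + τ • (x - c)) - c := by abel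
    rw [h2]
    exact (norm_sub_le _ _).trans (by linarith)
  have hKc : IsCompact K := Metric.isCompact_of_isClosed_isBounded hclosed hbd
  have h1K : (1:ℝ) ∈ K := ⟨le_rfl, by simpa using mem_car x⟩
  obtain ⟨τ, hτ, hmax⟩ := hKc.exists_isGreatest ⟨1, h1K⟩
  obtain ⟨ε, hε, hεx⟩ := car_ext hT hc
  have hτ1 : 1 < τ := by
    have h2 : (1 + ε) ∈ K := by
      refine ⟨by linarith, ?_⟩
      convert hεx using 1
      module
    have := hmax h2
    linarith
  refine ⟨τ, hτ1, hτ.2, fun heq => ?_⟩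
  have hc' := hc
  rw [← heq] at hc'
  obtain ⟨δ, hδ, hδx⟩ := car_ext hT hc'
  rw [heq] at hδx
  have h2 : (τ + δ * τ) ∈ K := by
    refine ⟨by nlinarith, ?_⟩
    convert hδx using 1
    module
  have := hmax h2
  nlinarith

theorem exists_chain (hT : IsLFCTiling T) (n : ℕ) : ∀ x : EucSp d,
    Module.finrank ℝ (affineSpan ℝ (car T x)).direction < n →
    ∃ D : Finset (NF T), IsChain (· ≤ ·) (D : Set (NF T)) ∧ (∀ p ∈ D, p.1.1 ⊆ car T x) ∧
      ∃ w : NF T → ℝ, (∀ p ∈ D, 0 < w p) ∧ ∑ p ∈ D, w p = 1 ∧ ∑ p ∈ D, w p • bar hT p = x := by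
  induction n with
  | zero => intro x h; omega
  | succ n ih =>
    intro x hx
    set F : NF T := NF.mk' (isF_car hT x) ⟨x, mem_car x⟩ with hF
    have hF1 : F.1.1 = car T x := rfl
    have hbF : bar hT F ∈ car T x := bar_mem hT F
    by_cases hxb : x = bar hT F
    · refine ⟨{F}, by simp, ?_, fun _ => 1, by simp, by simp, ?_⟩
      · intro p hp
        rw [Finset.mem_singleton] at hp
        rw [hp, hF1]
      · simp [← hxb]
    · obtain ⟨τ, hτ, hyF, hyne⟩ := exit_pt hT hbF hxb
      set y := bar hT F + τ • (x - bar hT F) with hy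
      have hysub : car T y ⊆ car T x := car_sub (isF_car hT x) hyF
      have hlt := finrank_lt ((isF_car hT x).exposed hT (isF_car hT y) hysub) ⟨y, mem_car y⟩ hyne
      obtain ⟨D, hD, hDy, w, hw, hw1, hwy⟩ := ih y (by omega)
      have hDF : ∀ p ∈ D, p ≤ F := fun p hp => (hDy p hp).trans hysub
      have hFD : F ∉ D := by
        intro h
        exact hyne (Set.Subset.antisymm hysub (hDy F h))
      have hne : ∀ p ∈ D, p ≠ F := fun p hp h => hFD (h ▸ hp)
      have hτ0 : (0:ℝ) < τ := by linarith
      refine ⟨insert F D, ?_, ?_, fun p => if p = F then 1 - τ⁻¹ else τ⁻¹ * w p, ?_, ?_, ?_⟩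
      · rw [Finset.coe_insert]
        exact hD.insert fun p hp _ => Or.inr (hDF p hp)
      · intro p hp
        rcases Finset.mem_insert.1 hp with rfl | hp
        · exact hF1.subset
        · exact (hDy p hp).trans hysub
      · intro p hp
        rcases Finset.mem_insert.1 hp with rfl | hp
        · beta_reduce
          rw [if_pos rfl]
          have := inv_lt_one_of_one_lt₀ hτ
          linarith
        · beta_reduce
          rw [if_neg (hne p hp)]
          exact mul_pos (inv_pos.2 hτ0) (hw p hp)
      · rw [Finset.sum_insert hFD, if_pos rfl, Finset.sum_congr rfl (fun p hp => if_neg (hne p hp)),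
          ← Finset.mul_sum, hw1]
        ring
      · rw [Finset.sum_insert hFD]
        beta_reduce
        rw [if_pos rfl,
          Finset.sum_congr rfl (g := fun p => τ⁻¹ • (w p • bar hT p))
            (fun p hp => by rw [if_neg (hne p hp), mul_smul]),
          ← Finset.smul_sum, hwy, hy, smul_add, smul_smul, inv_mul_cancel₀ hτ0.ne']
        module

theorem chain_unique (hT : IsLFCTiling T) (n : ℕ) : ∀ (D D' : Finset (NF T)) (w w' : NF T → ℝ),
    D.card + D'.card < n →
    IsChain (· ≤ ·) (D : Set (NF T)) → IsChain (· ≤ ·) (D' : Set (NF T)) →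
    (∀ p ∈ D, 0 < w p) → (∀ p ∈ D', 0 < w' p) → ∑ p ∈ D, w p = ∑ p ∈ D', w' p →
    ∑ p ∈ D, w p • bar hT p = ∑ p ∈ D', w' p • bar hT p → D = D' := by
  induction n with
  | zero => intro D D' w w' h; omega
  | succ n ih =>
    have key : ∀ (D D' : Finset (NF T)) (w w' : NF T → ℝ) (M : NF T), M ∈ D → M ∈ D' →
        w M ≤ w' M →  D.card + D'.card < n + 1 →
        IsChain (· ≤ ·) (D : Set (NF T)) → IsChain (· ≤ ·) (D' : Set (NF T)) →
        (∀ p ∈ D, 0 < w p) → (∀ p ∈ D', 0 < w' p) → ∑ p ∈ D, w p = ∑ p ∈ D', w' p →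
        ∑ p ∈ D, w p • bar hT p = ∑ p ∈ D', w' p • bar hT p → D = D' := by
      intro D D' w w' M hM hM' hle hcard hD hD' hw hw' hs hx
      have hc1 := Finset.card_erase_add_one hM
      have hc2 := Finset.card_erase_add_one hM'
      rw [← Finset.add_sum_erase _ _ hM, ← Finset.add_sum_erase _ _ hM'] at hs hx
      have hchain : IsChain (· ≤ ·) ((D.erase M : Finset (NF T)) : Set (NF T)) :=
        hD.mono (Finset.coe_subset.2 (Finset.erase_subset _ _))
      rcases hle.eq_or_lt with heq | hlt
      · have := ih (D.erase M) (D'.erase M) w w' (by omega) hchain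
          (hD'.mono (Finset.coe_subset.2 (Finset.erase_subset _ _)))
          (fun p hp => hw p (Finset.mem_of_mem_erase hp))
          (fun p hp => hw' p (Finset.mem_of_mem_erase hp))
          (by rw [heq] at hs; exact add_left_cancel hs)
          (by rw [heq] at hx; exact add_left_cancel hx)
        rw [← Finset.insert_erase hM, this, Finset.insert_erase hM']
      · exfalso
        have := ih (D.erase M) D' w (fun p => if p = M then w' M - w M else w' p) (by omega)
          hchain hD' (fun p hp => hw p (Finset.mem_of_mem_erase hp))
          (fun p hp => by
            by_cases h : p = M
            · simp only [h, if_true]; linarith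
            · simp only [h, if_false]; exact hw' p hp)
          (by
            rw [← Finset.add_sum_erase _ _ hM', if_pos rfl, Finset.sum_congr rfl
              (fun p hp => if_neg (Finset.ne_of_mem_erase hp))]
            linarith)
          (by
            rw [← Finset.add_sum_erase _ _ hM', if_pos rfl, Finset.sum_congr (s₁ := D'.erase M) rfl
              (g := fun p => w' p • bar hT p)
              (fun p hp => by rw [if_neg (Finset.ne_of_mem_erase hp)]), sub_smul]
            rw [sub_add_eq_add_sub, ← hx]
            abel)
        have hM2 := hM'
        rw [← this] at hM2
        exact Finset.notMem_erase _ _ hM2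
    intro D D' w w' hcard hD hD' hw hw' hs hx
    have hnn : ∀ (E : Finset (NF T)) (v : NF T → ℝ), (∀ p ∈ E, 0 < v p) → E.Nonempty →
      0 < ∑ p ∈ E, v p := fun E v hv hE => Finset.sum_pos hv hE
    rcases D.eq_empty_or_nonempty with rfl | hne
    · rcases D'.eq_empty_or_nonempty with rfl | hne'
      · rfl
      · have := hnn _ _ hw' hne'
        rw [Finset.sum_empty] at hs
        linarith
    rcases D'.eq_empty_or_nonempty with rfl | hne'
    · have := hnn _ _ hw hne
      rw [Finset.sum_empty] at hs
      linarith
    obtain ⟨M, hM, hmax⟩ := chain_max hD hne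
    obtain ⟨M', hM', hmax'⟩ := chain_max hD' hne'
    have hpos := hnn _ _ hw hne
    set σ := ∑ p ∈ D, w p with hσ
    have hc1 := car_sum hT (w := fun p => σ⁻¹ * w p)
      (fun p hp => mul_pos (inv_pos.2 hpos) (hw p hp))
      (by rw [← Finset.mul_sum, ← hσ, inv_mul_cancel₀ hpos.ne']) hM hmax
    have hc2 := car_sum hT (w := fun p => σ⁻¹ * w' p)
      (fun p hp => mul_pos (inv_pos.2 hpos) (hw' p hp))
      (by rw [← Finset.mul_sum, ← hs, inv_mul_cancel₀ hpos.ne']) hM' hmax'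
    simp only [mul_smul, ← Finset.smul_sum] at hc1 hc2
    rw [hx, hc2] at hc1
    have hMM : M' = M := NF.ext' hc1
    subst hMM
    rcases le_total (w M') (w' M') with h | h
    · exact key D D' w w' M' hM hM' h hcard hD hD' hw hw' hs hx
    · exact (key D' D w' w M' hM' hM h (by omega) hD' hD hw' hw hs.symm hx.symm).symm

theorem near_finite (hT : IsLFCTiling T) {R : Set (EucSp d)} (hR : Bornology.IsBounded R) :
    {p : NF T | ∃ t ∈ T, (t ∩ R).Nonempty ∧ p.1.1 ⊆ t}.Finite := by
  have h1 : {F : Set (EucSp d) | ∃ t ∈ {t ∈ T | (t ∩ R).Nonempty}, IsExposed ℝ t F}.Finite := by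
    have := (hT.locally_finite R hR).biUnion (t := fun t => {F | IsExposed ℝ t F}) (fun t ht => by
      obtain ⟨⟨S, hS⟩, -⟩ := hT.polytope t ht.1
      exact faces_finite hS)
    refine this.subset ?_
    rintro F ⟨t, ht, hF⟩
    exact Set.mem_biUnion ht hF
  refine Set.Finite.of_finite_image (f := fun p : NF T => p.1.1) (h1.subset ?_) ?_
  · rintro _ ⟨p, ⟨t, ht, htR, hp⟩, rfl⟩
    exact ⟨t, ⟨ht, htR⟩, p.isF.of_sub hT ht hp⟩
  · intro p _ q _ h
    exact NF.ext' h

noncomputable def ch (hT : IsLFCTiling T) (x : EucSp d) : Finset (NF T) :=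
  (exists_chain hT _ x (Nat.lt_succ_self _)).choose

theorem ch_spec (hT : IsLFCTiling T) (x : EucSp d) :
    IsChain (· ≤ ·) (ch hT x : Set (NF T)) ∧ (∀ p ∈ ch hT x, p.1.1 ⊆ car T x) ∧
      ∃ w : NF T → ℝ, (∀ p ∈ ch hT x, 0 < w p) ∧ ∑ p ∈ ch hT x, w p = 1 ∧
        ∑ p ∈ ch hT x, w p • bar hT p = x :=
  (exists_chain hT _ x (Nat.lt_succ_self _)).choose_spec

theorem ch_uniq (hT : IsLFCTiling T) (D : Finset (NF T)) (w : NF T → ℝ)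
    (hD : IsChain (· ≤ ·) (D : Set (NF T))) (hw : ∀ p ∈ D, 0 < w p) (h1 : ∑ p ∈ D, w p = 1) :
    ch hT (∑ p ∈ D, w p • bar hT p) = D := by
  obtain ⟨hc, -, w', hw', h1', hx⟩ := ch_spec hT (∑ p ∈ D, w p • bar hT p)
  exact chain_unique hT _ _ _ w' w (Nat.lt_succ_self _) hc hD hw' hw (h1'.trans h1.symm) hx

theorem ch_star (hT : IsLFCTiling T) (x : EucSp d) : ∀ᶠ y in 𝓝 x, ch hT x ⊆ ch hT y := by
  have hfin := near_finite hT (Metric.isBounded_ball (x := x) (r := 1))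
  set N := hfin.toFinset with hN
  have hmem : ∀ y ∈ Metric.ball x 1, ch hT y ⊆ N := by
    intro y hy p hp
    obtain ⟨t, ht, hyt⟩ := exists_tile hT y
    rw [hN, Set.Finite.mem_toFinset]
    exact ⟨t, ht, ⟨y, hyt, hy⟩,
      ((ch_spec hT y).2.1 p hp).trans (car_sub ⟨t, ht, IsExposed.refl t⟩ hyt)⟩
  have hev : ∀ᶠ y in 𝓝 x, ∀ D ∈ N.powerset, IsChain (· ≤ ·) (D : Set (NF T)) → ¬ ch hT x ⊆ D →
      y ∉ convexHull ℝ ((D.image (bar hT) : Finset (EucSp d)) : Set (EucSp d)) := by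
    rw [Filter.eventually_all_finset]
    intro D _
    by_cases hD : IsChain (· ≤ ·) (D : Set (NF T)) ∧ ¬ ch hT x ⊆ D
    · have hcl : IsClosed (convexHull ℝ ((D.image (bar hT) : Finset (EucSp d)) : Set (EucSp d))) :=
        ((D.image (bar hT)).finite_toSet.isCompact_convexHull ℝ).isClosed
      have hx : x ∉ convexHull ℝ ((D.image (bar hT) : Finset (EucSp d)) : Set (EucSp d)) := by
        intro hx
        rw [Finset.coe_image, ← Set.image_id (bar hT '' _)] at hx
        have : ∃ w : NF T → ℝ, (∀ p ∈ D, 0 ≤ w p) ∧ ∑ p ∈ D, w p = 1 ∧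
            ∑ p ∈ D, w p • bar hT p = x := by
          rw [Set.image_id, ← Finset.coe_image, Finset.mem_convexHull'] at hx
          obtain ⟨w, hw, hw1, hwx⟩ := hx
          have hinj : Set.InjOn (bar hT) (D : Set (NF T)) := by
            intro p _ q _ h
            apply NF.ext'
            rw [← car_bar hT p, ← car_bar hT q, h]
          refine ⟨fun p => w (bar hT p), fun p hp => hw _ (Finset.mem_image_of_mem _ hp), ?_, ?_⟩
          · rw [← hw1, Finset.sum_image hinj]
          · rw [← hwx, Finset.sum_image hinj]
        obtain ⟨w, hw, hw1, hwx⟩ := this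
        have hz : ∀ y ∈ D, y ∉ D.filter (fun y => w y ≠ 0) → w y = 0 := by
          intro y hy h
          by_contra h0
          exact h (Finset.mem_filter.2 ⟨hy, h0⟩)
        have hs1 : ∑ y ∈ D.filter (fun y => w y ≠ 0), w y = 1 := by
          rw [Finset.sum_subset (Finset.filter_subset _ _) hz, hw1]
        have hs2 : ∑ y ∈ D.filter (fun y => w y ≠ 0), w y • bar hT y = x := by
          rw [Finset.sum_subset (Finset.filter_subset _ _), hwx]
          intro y hy h
          rw [hz y hy h, zero_smul]
        have := ch_uniq hT (D.filter (fun y => w y ≠ 0)) w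
          (hD.1.mono (Finset.coe_subset.2 (Finset.filter_subset _ _)))
          (fun p hp => lt_of_le_of_ne (hw p (Finset.mem_filter.1 hp).1)
            (Ne.symm (Finset.mem_filter.1 hp).2)) hs1
        rw [hs2] at this
        exact hD.2 (this ▸ Finset.filter_subset _ _)
      filter_upwards [hcl.isOpen_compl.mem_nhds hx] with y hy _ _
      exact hy
    · exact Filter.Eventually.of_forall fun y h1 h2 => absurd ⟨h1, h2⟩ hD
  filter_upwards [hev, Metric.ball_mem_nhds x one_pos] with y hy hyb
  by_contra hcon
  refine hy (ch hT y) (Finset.mem_powerset.2 (hmem y hyb)) (ch_spec hT y).1 hcon ?_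
  obtain ⟨-, -, w, hw, hw1, hwx⟩ := ch_spec hT y
  have : ∑ p ∈ ch hT y, w p • bar hT p ∈
      convexHull ℝ (((ch hT y).image (bar hT) : Finset (EucSp d)) : Set (EucSp d)) :=
    (convex_convexHull ℝ _).sum_mem (fun p hp => (hw p hp).le) hw1 (fun p hp =>
      subset_convexHull ℝ _ (Finset.mem_coe.2 (Finset.mem_image_of_mem _ hp)))
  rwa [hwx] at this

noncomputable def tilBC (hT : IsLFCTiling T) : BC (NF T) d where
  rk := frk
  b := bar hT
  C := ch hT
  rk_strictMono := fun _ _ h => frk_lt hT h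
  rk_le := fun p => (Submodule.finrank_le _).trans (by simp)
  chain := fun x => (ch_spec hT x).1
  repr := fun x => (ch_spec hT x).2.2
  uniq := ch_uniq hT
  star := ch_star hT
  countable := by
    rw [← Set.countable_univ_iff]
    have : (⋃ n : ℕ, {p : NF T | ∃ t ∈ T, (t ∩ Metric.ball 0 (n:ℝ)).Nonempty ∧ p.1.1 ⊆ t}).Countable :=
      Set.countable_iUnion fun n => (near_finite hT Metric.isBounded_ball).countable
    refine this.mono ?_
    intro p _
    obtain ⟨t, ht, hp⟩ := p.isF
    obtain ⟨x, hx⟩ := p.2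
    obtain ⟨n, hn⟩ := exists_nat_gt ‖x‖
    exact Set.mem_iUnion.2 ⟨n, t, ht, ⟨x, hp.subset hx, by simpa using hn⟩, hp.subset⟩
  fin_comp := fun p => by
    refine (near_finite hT (p.isF.compact hT).isBounded).subset ?_
    intro q hq
    obtain ⟨t, ht, hqt⟩ := q.isF
    refine ⟨t, ht, ?_, hqt.subset⟩
    rcases hq with h | h
    · obtain ⟨x, hx⟩ := q.2
      exact ⟨x, hqt.subset hx, h hx⟩
    · obtain ⟨x, hx⟩ := p.2
      exact ⟨x, hqt.subset (h hx), hx⟩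
  nodigon := by
    intro F F' G G' hF hG hrF hrG hr h1 h2 h3 h4
    have hintr := F.isF.inter hT F'.isF
    have hne : (F.1.1 ∩ F'.1.1).Nonempty := by
      obtain ⟨x, hx⟩ := G.2
      exact ⟨x, h1.le hx, h2.le hx⟩
    set H : NF T := NF.mk' hintr hne with hH
    have hHF : H ≤ F := fun x hx => hx.1
    have hHF' : H ≤ F' := fun x hx => hx.2
    have hlt : H < F := by
      refine lt_of_le_of_ne hHF ?_
      intro h
      have h5 : F ≤ F' := h ▸ hHF'
      have h6 := frk_lt hT (lt_of_le_of_ne h5 hF)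
      omega
    have hrk := frk_lt hT hlt
    have key : ∀ K : NF T, K < F → K < F' → frk K + 1 = frk F → K = H := by
      intro K hK hK' hr'
      by_contra hne'
      have hKH : K ≤ H := fun x hx => ⟨hK.le hx, hK'.le hx⟩
      have h5 := frk_lt hT (lt_of_le_of_ne hKH hne')
      omega
    exact hG ((key G h1 h2 (by omega)).trans (key G' h3 h4 (by omega)).symm)

end Til
end TVF

namespace TVF
open Topology Filter

section Link
variable {d : ℕ} {T : Set (Set (EucSp d))}

theorem isF_empty (hT : IsLFCTiling T) : IsF T ∅ := by
  obtain ⟨t, ht, -⟩ := exists_tile hT 0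
  exact ⟨t, ht, isExposed_empty⟩

def botF (hT : IsLFCTiling T) : TFace T := ⟨∅, isF_empty hT⟩

theorem botF_le (hT : IsLFCTiling T) (F : TFace T) : botF hT ≤ F := Set.empty_subset F.1

def inc (p : NF T) : TPoset T := ((p.1 : TFace T) : WithTop (TFace T))

theorem inc_le {p q : NF T} : inc p ≤ inc q ↔ p ≤ q := WithTop.coe_le_coe

theorem inc_inj {p q : NF T} (h : inc p = inc q) : p = q :=
  Subtype.ext (WithTop.coe_injective h)

theorem face_cases (hT : IsLFCTiling T) (F : TFace T) : F = botF hT ∨ ∃ p : NF T, F = p.1 := by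
  rcases F.1.eq_empty_or_nonempty with h | h
  · exact Or.inl (Subtype.ext h)
  · exact Or.inr ⟨⟨F, h⟩, rfl⟩

theorem q_cases (hT : IsLFCTiling T) (x : TPoset T) :
    x = ⊤ ∨ x = ((botF hT : TFace T) : WithTop (TFace T)) ∨ ∃ p : NF T, x = inc p := by
  induction x using WithTop.recTopCoe with
  | top => exact Or.inl rfl
  | coe F =>
    rcases face_cases hT F with rfl | ⟨p, rfl⟩
    · exact Or.inr (Or.inl rfl)
    · exact Or.inr (Or.inr ⟨p, rfl⟩)

theorem bot_le' (hT : IsLFCTiling T) (x : TPoset T) :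
    ((botF hT : TFace T) : WithTop (TFace T)) ≤ x := by
  induction x using WithTop.recTopCoe with
  | top => exact le_top
  | coe F => exact WithTop.coe_le_coe.2 (botF_le hT F)

theorem inc_ne_top (p : NF T) : inc p ≠ ⊤ := WithTop.coe_ne_top

theorem inc_ne_bot (hT : IsLFCTiling T) (p : NF T) :
    inc p ≠ ((botF hT : TFace T) : WithTop (TFace T)) := by
  intro h
  have h1 : p.1 = botF hT := WithTop.coe_injective h
  have h2 := p.2
  rw [h1] at h2
  exact Set.not_nonempty_empty h2

/-- The carrier of the flag of the face poset attached to a chain of nonempty faces. -/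
def fcar (hT : IsLFCTiling T) (D : Finset (NF T)) : Set (TPoset T) :=
  {x | x = ⊤ ∨ x = ((botF hT : TFace T) : WithTop (TFace T)) ∨ ∃ p ∈ D, x = inc p}

theorem inc_mem_fcar (hT : IsLFCTiling T) {D : Finset (NF T)} {p : NF T} :
    inc p ∈ fcar hT D ↔ p ∈ D := by
  constructor
  · rintro (h | h | ⟨q, hq, h⟩)
    · exact absurd h (inc_ne_top p)
    · exact absurd h (inc_ne_bot hT p)
    · rw [inc_inj h]; exact hq
  · intro h
    exact Or.inr (Or.inr ⟨p, h, rfl⟩)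

theorem fcar_chain (hT : IsLFCTiling T) {D : Finset (NF T)}
    (hD : IsChain (· ≤ ·) (D : Set (NF T))) : IsChain (· ≤ ·) (fcar hT D) := by
  rintro x (rfl | rfl | ⟨p, hp, rfl⟩) y hy hxy
  · exact Or.inr le_top
  · exact Or.inl (bot_le' hT y)
  · rcases hy with rfl | rfl | ⟨q, hq, rfl⟩
    · exact Or.inl le_top
    · exact Or.inr (bot_le' hT _)
    · have hne : p ≠ q := fun h => hxy (by rw [h])
      rcases hD hp hq hne with h | h
      · exact Or.inl (inc_le.2 h)
      · exact Or.inr (inc_le.2 h)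

theorem sub_fcar (hT : IsLFCTiling T) {D : Finset (NF T)} {s : Set (TPoset T)}
    (h : ∀ p, inc p ∈ s → p ∈ D) : s ⊆ fcar hT D := by
  intro x hx
  rcases q_cases hT x with rfl | rfl | ⟨p, rfl⟩
  · exact Or.inl rfl
  · exact Or.inr (Or.inl rfl)
  · exact (inc_mem_fcar hT).2 (h p hx)

theorem inc_chain {s : Set (TPoset T)} (hs : IsChain (· ≤ ·) s) :
    IsChain (· ≤ ·) {p : NF T | inc p ∈ s} := by
  intro p hp q hq hne
  rcases hs hp hq (fun h => hne (inc_inj h)) with h | h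
  · exact Or.inl (inc_le.1 h)
  · exact Or.inr (inc_le.1 h)

def ofFl (hT : IsLFCTiling T) (Φ : Fl (NF T) d) : Flag (TPoset T) where
  carrier := fcar hT Φ.1
  Chain' := fcar_chain hT Φ.2.1
  max_chain' := by
    intro s hs hsub
    refine Set.Subset.antisymm hsub (sub_fcar hT ?_)
    intro p hp
    have hc : IsChain (· ≤ ·) ((insert p Φ.1 : Finset (NF T)) : Set (NF T)) := by
      refine (inc_chain hs).mono ?_
      intro q hq
      rcases Finset.mem_insert.1 (Finset.mem_coe.1 hq) with rfl | hq
      · exact hp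
      · exact hsub ((inc_mem_fcar hT).2 hq)
    have h1 := (tilBC hT).card_le hc
    by_contra hpn
    rw [Finset.card_insert_of_notMem hpn, Φ.2.2] at h1
    omega

theorem inc_mem_ofFl (hT : IsLFCTiling T) {Φ : Fl (NF T) d} {p : NF T} :
    inc p ∈ ofFl hT Φ ↔ p ∈ Φ.1 := inc_mem_fcar hT

theorem top_mem_ofFl (hT : IsLFCTiling T) (Φ : Fl (NF T) d) : (⊤ : TPoset T) ∈ ofFl hT Φ :=
  Or.inl rfl

theorem bot_mem_ofFl (hT : IsLFCTiling T) (Φ : Fl (NF T) d) :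
    (((botF hT : TFace T) : WithTop (TFace T)) : TPoset T) ∈ ofFl hT Φ :=
  Or.inr (Or.inl rfl)

theorem ofFl_surj (hT : IsLFCTiling T) (Φ : Flag (TPoset T)) : ∃ Ψ, Φ = ofFl hT Ψ := by
  have hchain := inc_chain Φ.Chain'
  set S : Set (NF T) := {p : NF T | inc p ∈ Φ.carrier} with hS
  have hD' : ∃ D' : Finset (NF T), IsChain (· ≤ ·) (D' : Set (NF T)) ∧ S ⊆ (D' : Set (NF T)) ∧
      D'.card = d + 1 := by
    rcases S.eq_empty_or_nonempty with h | ⟨p, hp⟩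
    · obtain ⟨t, ht, h0⟩ := exists_tile hT 0
      let p : NF T := NF.mk' ⟨t, ht, IsExposed.refl t⟩ ⟨0, h0⟩
      obtain ⟨D', h1, -, h3⟩ := (tilBC hT).exists_flag (D := {p}) (by simp) (by simp)
      exact ⟨D', h1, by rw [h]; exact Set.empty_subset _, h3⟩
    · have hfin : S.Finite := by
        refine ((tilBC hT).fin_comp p).subset ?_
        intro q hq
        by_cases h : q = p
        · exact Or.inl h.le
        · exact hchain hq hp h
      obtain ⟨D', h1, h2, h3⟩ := (tilBC hT).exists_flag (D := hfin.toFinset)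
        (by rw [Set.Finite.coe_toFinset]; exact hchain)
        ⟨p, (Set.Finite.mem_toFinset hfin).2 hp⟩
      exact ⟨D', h1, fun q hq => h2 ((Set.Finite.mem_toFinset hfin).2 hq), h3⟩
  obtain ⟨D', h1, h2, h3⟩ := hD'
  refine ⟨⟨D', h1, h3⟩, ?_⟩
  have := Φ.max_chain' (fcar_chain hT h1) (sub_fcar hT fun p hp => h2 hp)
  exact Flag.ext this

theorem ofFl_inj (hT : IsLFCTiling T) {Φ Ψ : Fl (NF T) d} (h : ofFl hT Φ = ofFl hT Ψ) : Φ = Ψ := by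
  apply Subtype.ext
  ext p
  rw [← inc_mem_ofFl hT, h, inc_mem_ofFl hT]

/-- The faces of the tiling are the nonempty faces with a bottom element adjoined. -/
noncomputable def botIso (hT : IsLFCTiling T) : WithBot (NF T) ≃o TFace T :=
  RelIso.ofSurjective
    (OrderEmbedding.ofMapLEIff (fun x : WithBot (NF T) =>
        (WithBot.recBotCoe (botF hT) (fun p => p.1) x : TFace T)) (by
      intro x y
      induction x using WithBot.recBotCoe with
      | bot => simp only [WithBot.recBotCoe_bot, bot_le, iff_true]; exact botF_le hT _
      | coe p =>
        induction y using WithBot.recBotCoe with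
        | bot =>
          simp only [WithBot.recBotCoe_bot, WithBot.recBotCoe_coe]
          constructor
          · intro h
            obtain ⟨x, hx⟩ := p.2
            exact absurd (h hx) (Set.notMem_empty x)
          · intro h
            exact absurd h (WithBot.not_coe_le_bot p)
        | coe q =>
          simp only [WithBot.recBotCoe_coe, WithBot.coe_le_coe]
          exact Iff.rfl))
    (by
      intro F
      rcases face_cases hT F with rfl | ⟨p, rfl⟩
      · exact ⟨⊥, rfl⟩
      · exact ⟨(p : WithBot (NF T)), rfl⟩)

theorem botIso_coe (hT : IsLFCTiling T) (p : NF T) : botIso hT (p : WithBot (NF T)) = p.1 := rfl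

noncomputable def extIso (hT : IsLFCTiling T) (γ : NF T ≃o NF T) : TPoset T ≃o TPoset T :=
  (((botIso hT).symm.trans γ.withBotCongr).trans (botIso hT)).withTopCongr

theorem extIso_inc (hT : IsLFCTiling T) (γ : NF T ≃o NF T) (p : NF T) :
    extIso hT γ (inc p) = inc (γ p) := by
  have h1 : (botIso hT).symm p.1 = (p : WithBot (NF T)) := by
    rw [OrderIso.symm_apply_eq]; rfl
  have h2 : extIso hT γ (inc p) =
    ((botIso hT (γ.withBotCongr ((botIso hT).symm p.1)) : TFace T) : WithTop (TFace T)) := rfl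
  rw [h2, h1]
  rfl

theorem iso_top (γ : TPoset T ≃o TPoset T) : γ ⊤ = ⊤ := γ.map_top

theorem iso_bot (hT : IsLFCTiling T) (γ : TPoset T ≃o TPoset T) :
    γ ((botF hT : TFace T) : WithTop (TFace T)) = ((botF hT : TFace T) : WithTop (TFace T)) := by
  apply le_antisymm
  · rw [← OrderIso.le_symm_apply]
    exact bot_le' hT _
  · exact bot_le' hT _

theorem iso_inc (hT : IsLFCTiling T) (γ : TPoset T ≃o TPoset T) (p : NF T) :
    ∃ q, γ (inc p) = inc q := by
  rcases q_cases hT (γ (inc p)) with h | h | h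
  · rw [← iso_top γ] at h
    exact absurd (γ.injective h) (inc_ne_top p)
  · rw [← iso_bot hT γ] at h
    exact absurd (γ.injective h) (inc_ne_bot hT p)
  · exact h

theorem exists_res (hT : IsLFCTiling T) (γ : TPoset T ≃o TPoset T) :
    ∃ δ : NF T ≃o NF T, ∀ p, γ (inc p) = inc (δ p) := by
  choose f hf using iso_inc hT γ
  choose g hg using iso_inc hT γ.symm
  refine ⟨⟨⟨f, g, ?_, ?_⟩, ?_⟩, hf⟩
  · intro p
    apply inc_inj
    rw [← hg, ← hf, OrderIso.symm_apply_apply]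
  · intro p
    apply inc_inj
    rw [← hf, ← hg, OrderIso.apply_symm_apply]
  · intro p q
    show f p ≤ f q ↔ p ≤ q
    rw [← inc_le, ← hf, ← hf, γ.le_iff_le, inc_le]

theorem mem_mapFl_iff {P : Type} [PartialOrder P] {γ : P ≃o P} {Φ : Fl P d} {F : P} :
    γ F ∈ (mapFl γ Φ).1 ↔ F ∈ Φ.1 := by
  constructor
  · intro h
    have h' : γ F ∈ Φ.1.map γ.toEquiv.toEmbedding := h
    obtain ⟨G, hG, hGF⟩ := Finset.mem_map.1 h'
    have : G = F := γ.injective hGF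
    rwa [← this]
  · exact mem_mapFl

theorem same_iff (hT : IsLFCTiling T) (Φ Ψ : Fl (NF T) d) :
    SameFlagOrbit (ofFl hT Φ) (ofFl hT Ψ) ↔ O Φ Ψ := by
  constructor
  · rintro ⟨γ, hγ⟩
    obtain ⟨δ, hδ⟩ := exists_res hT γ
    refine ⟨δ, ?_⟩
    apply Subtype.ext
    ext p
    obtain ⟨q, rfl⟩ := δ.surjective p
    rw [mem_mapFl_iff, ← inc_mem_ofFl hT, ← inc_mem_ofFl hT (Φ := Ψ), ← hδ]
    have : γ (inc q) ∈ (ofFl hT Ψ : Set (TPoset T)) ↔ inc q ∈ (ofFl hT Φ : Set (TPoset T)) := by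
      rw [← hγ, γ.injective.mem_set_image]
    exact this.symm
  · rintro ⟨δ, rfl⟩
    refine ⟨extIso hT δ, ?_⟩
    ext y
    obtain ⟨x, rfl⟩ := (extIso hT δ).surjective y
    rw [(extIso hT δ).injective.mem_set_image]
    show x ∈ ofFl hT Φ ↔ _ ∈ ofFl hT (mapFl δ Φ)
    rcases q_cases hT x with rfl | rfl | ⟨p, rfl⟩
    · rw [iso_top]
      exact iff_of_true (top_mem_ofFl hT _) (top_mem_ofFl hT _)
    · rw [iso_bot]
      exact iff_of_true (bot_mem_ofFl hT _) (bot_mem_ofFl hT _)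
    · rw [extIso_inc, inc_mem_ofFl, inc_mem_ofFl, mem_mapFl_iff]

theorem tileRank_inc (p : NF T) : tileRank T (inc p) = (frk p : ℤ) := by
  have h : tileRank T (inc p) = setRank p.1.1 := rfl
  rw [h, setRank, if_neg p.2.ne_empty]
  rfl

theorem to_of (hT : IsLFCTiling T) (hd : 1 ≤ d) {I : Set ℕ}
    (h2 : InClass (tileRank T) (d + 1) I) : (tilBC hT).TO I := by
  obtain ⟨⟨Φ, Ψ, hne, hall⟩, hcls⟩ := h2
  constructor
  · obtain ⟨Φ', rfl⟩ := ofFl_surj hT Φ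
    obtain ⟨Ψ', rfl⟩ := ofFl_surj hT Ψ
    refine ⟨Φ', Ψ', ?_, ?_⟩
    · rwa [same_iff] at hne
    · intro Ω
      have := hall (ofFl hT Ω)
      rwa [same_iff, same_iff] at this
  · intro Φ i hi
    rw [← same_iff hT]
    refine hcls _ _ i (by omega) ⟨?_, ?_⟩
    · intro h
      exact (tilBC hT).sg_ne hd hi Φ (ofFl_inj hT h).symm
    · intro x hx
      rcases q_cases hT x with rfl | rfl | ⟨p, rfl⟩
      · exact iff_of_true (top_mem_ofFl hT _) (top_mem_ofFl hT _)
      · exact iff_of_true (bot_mem_ofFl hT _) (bot_mem_ofFl hT _)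
      · rw [tileRank_inc] at hx
        have hpi : (tilBC hT).rk p ≠ i := fun h => hx (by exact_mod_cast h)
        have hpd := (tilBC hT).rk_le p
        rw [inc_mem_ofFl, inc_mem_ofFl]
        have hel := (tilBC hT).el_sg i Φ hpd hpi
        constructor
        · intro h
          have h3 := (tilBC hT).eq_el Φ h rfl
          rw [h3, ← hel]
          exact (tilBC hT).el_mem _ _
        · intro h
          have h3 := (tilBC hT).eq_el _ h rfl
          rw [h3, hel]
          exact (tilBC hT).el_mem _ _

end Link
end TVF

/-- If the face poset of an LFC tiling of `ℝ^d` is in class `2_I` and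
`j ∈ {0, …, d}` with `j ∉ I`, then `j = 0` or `j = d`. -/
theorem tiling_vertex_or_facet_intransitive {d : ℕ} (T : Set (Set (EucSp d)))
    (hT : IsLFCTiling T)
    (I : Set ℕ) (hI : I ⊆ Set.Iic d)
    (h2 : InClass (tileRank T) (d + 1) I)
    (j : ℕ) (hj : j ≤ d) (hjI : j ∉ I) :
    j = 0 ∨ j = d := by
  by_contra hcon
  push Not at hcon
  exact (TVF.to_of hT (by omega) h2).main (j := j) (by omega) (by omega) hjI
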